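/- arXiv:1304.5450 — 2 statements merged into one kernel-verified Lean document; each statement's English description precedes it below -/
import Mathlib

section
/- Let q ≥ 2 be a prime power and H = PSL₃(F_q). Then for every integer k with 2 ≤ k and k·|Aut H| ≤ φ₂(H), the direct power Hᵏ admits an unmixed Beauville structure. -/
open scoped MatrixGroups

/-- `Σ(T)`: the union of all conjugates of the cyclic subgroups generated by the
three entries of the triple `T = (a, b, c)`. -/
def SigmaSet {G : Type*} [Group G] (T : G × G × G) : Set G :=
  {x | ∃ g : G, g * x * g⁻¹ ∈
    (Subgroup.zpowers T.1 : Set G) ∪ (Subgroup.zpowers T.2.1 : Set G) ∪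
      (Subgroup.zpowers T.2.2 : Set G)}

/-- `T = (a,b,c)` is a generating triple: `a*b*c = 1` and `{a,b,c}` generates. -/
def IsGenTriple {G : Type*} [Group G] (T : G × G × G) : Prop :=
  T.1 * T.2.1 * T.2.2 = 1 ∧ Subgroup.closure {T.1, T.2.1, T.2.2} = ⊤

/-- `T` is hyperbolic: the reciprocals of the orders of its entries sum to less than 1. -/
def IsHyperbolic {G : Type*} [Group G] (T : G × G × G) : Prop :=
  (orderOf T.1 : ℚ)⁻¹ + (orderOf T.2.1 : ℚ)⁻¹ + (orderOf T.2.2 : ℚ)⁻¹ < 1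

/-- An unmixed Beauville structure on `G`: a pair of hyperbolic generating triples
`T₁, T₂` with `Σ(T₁) ∩ Σ(T₂) = {1}`. -/
def HasBeauvilleStructure (G : Type*) [Group G] : Prop :=
  ∃ T₁ T₂ : G × G × G, IsGenTriple T₁ ∧ IsHyperbolic T₁ ∧ IsGenTriple T₂ ∧ IsHyperbolic T₂ ∧
    SigmaSet T₁ ∩ SigmaSet T₂ = {1}

/-- `φ₂(H)`: the number of ordered generating pairs of `H`. -/
noncomputable def phi2 (H : Type*) [Group H] : ℕ :=
  Nat.card {p : H × H // Subgroup.closure {p.1, p.2} = ⊤}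

/-- Two triples are equivalent if some automorphism carries one to the other entrywise. -/
def TripleEquiv {H : Type*} [Group H] (T T' : H × H × H) : Prop :=
  ∃ α : MulAut H, α T.1 = T'.1 ∧ α T.2.1 = T'.2.1 ∧ α T.2.2 = T'.2.2

section Hall

/-- In a nonabelian simple group, a normal subgroup containing all commutators is everything. -/
theorem eq_top_of_commutator_mem {H : Type*} [Group H] [IsSimpleGroup H]
    (hna : ∃ x y : H, x * y ≠ y * x) (N : Subgroup H) [hN : N.Normal]
    (h : ∀ x y : H, x * y * x⁻¹ * y⁻¹ ∈ N) : N = ⊤ := by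
  rcases hN.eq_bot_or_eq_top with h1 | h1
  · obtain ⟨x, y, hxy⟩ := hna
    have := h x y
    rw [h1, Subgroup.mem_bot] at this
    exact absurd (by rw [← mul_inv_eq_iff_eq_mul, ← mul_inv_eq_one]; simpa [mul_assoc] using this) hxy
  · exact h1

/-- If the coordinates `a i`, `a j` of a subgroup of a power of a finite simple group are not
linked by an automorphism, then the subgroup contains elements trivial at `i` and arbitrary at
`j`. -/
theorem exists_mem_one_at {ι H : Type*} [Group H] [Finite H] [IsSimpleGroup H]
    (K : Subgroup (ι → H)) (hK : ∀ i (h : H), ∃ x ∈ K, x i = h) (i j : ι)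
    (hij : ¬ ∃ α : MulAut H, ∀ x ∈ K, α (x i) = x j) (h : H) :
    ∃ x ∈ K, x i = 1 ∧ x j = h := by
  let N : Subgroup H := (K ⊓ (Pi.evalMonoidHom (fun _ : ι => H) i).ker).map
    (Pi.evalMonoidHom (fun _ : ι => H) j)
  have hmem : ∀ h, h ∈ N ↔ ∃ x ∈ K, x i = 1 ∧ x j = h := by
    intro h
    simp only [N, Subgroup.mem_map, Subgroup.mem_inf, MonoidHom.mem_ker, Pi.evalMonoidHom_apply,
      and_assoc]
  have hN : N.Normal := by
    constructor
    intro n hn g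
    obtain ⟨x, hx, hx1, rfl⟩ := (hmem n).1 hn
    obtain ⟨y, hy, rfl⟩ := hK j g
    exact (hmem _).2 ⟨y * x * y⁻¹, K.mul_mem (K.mul_mem hy hx) (K.inv_mem hy), by simp [hx1],
      by simp⟩
  rcases hN.eq_bot_or_eq_top with h1 | h1
  · exfalso
    apply hij
    have key : ∀ x ∈ K, ∀ y ∈ K, x i = y i → x j = y j := by
      intro x hx y hy hxy
      have : x j * (y j)⁻¹ ∈ N :=
        (hmem _).2 ⟨x * y⁻¹, K.mul_mem hx (K.inv_mem hy), by simp [hxy], by simp⟩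
      rw [h1, Subgroup.mem_bot, mul_inv_eq_one] at this
      exact this
    choose f hf hfi using hK i
    let φ : H →* H :=
      { toFun := fun h => f h j
        map_one' := key _ (hf 1) 1 K.one_mem (by simp [hfi])
        map_mul' := fun a b => key _ (hf _) (f a * f b) (K.mul_mem (hf _) (hf _)) (by simp [hfi]) }
    have hφ : ∀ x ∈ K, φ (x i) = x j := fun x hx => key _ (hf _) x hx (hfi _)
    have hsurj : Function.Surjective φ := by
      intro b
      obtain ⟨x, hx, rfl⟩ := hK j b
      exact ⟨x i, hφ x hx⟩
    exact ⟨MulEquiv.ofBijective φ (Finite.injective_iff_surjective.2 hsurj |> fun hi => ⟨hi, hsurj⟩),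
      hφ⟩
  · exact (hmem h).1 (h1 ▸ Subgroup.mem_top h)

/-- A subgroup of a power of a nonabelian finite simple group that projects onto every factor is
everything unless two coordinates are linked by an automorphism. -/
theorem eq_top_of_not_linked {ι H : Type*} [Finite ι] [Group H] [Finite H] [IsSimpleGroup H]
    (hna : ∃ x y : H, x * y ≠ y * x)
    (K : Subgroup (ι → H)) (hK : ∀ i (h : H), ∃ x ∈ K, x i = h)
    (hij : ∀ i j, i ≠ j → ¬ ∃ α : MulAut H, ∀ x ∈ K, α (x i) = x j) : K = ⊤ := by
  classical
  have := Fintype.ofFinite ι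
  have key : ∀ (j : ι) (S : Finset ι), j ∉ S → ∀ h : H, ∃ x ∈ K, (∀ i ∈ S, x i = 1) ∧ x j = h := by
    intro j S
    induction S using Finset.induction_on with
    | empty => intro _ h; obtain ⟨x, hx, hxj⟩ := hK j h; exact ⟨x, hx, by simp, hxj⟩
    | insert i S hi ih =>
      intro hj
      rw [Finset.mem_insert, not_or] at hj
      let N : Subgroup H :=
        { carrier := {h | ∃ x ∈ K, (∀ i' ∈ insert i S, x i' = 1) ∧ x j = h}
          one_mem' := ⟨1, K.one_mem, by simp⟩
          mul_mem' := by
            rintro _ _ ⟨x, hx, hx1, rfl⟩ ⟨y, hy, hy1, rfl⟩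
            exact ⟨x * y, K.mul_mem hx hy, fun i' hi' => by simp [hx1 i' hi', hy1 i' hi'], rfl⟩
          inv_mem' := by
            rintro _ ⟨x, hx, hx1, rfl⟩
            exact ⟨x⁻¹, K.inv_mem hx, fun i' hi' => by simp [hx1 i' hi'], rfl⟩ }
      have hN : N.Normal := by
        constructor
        rintro _ ⟨x, hx, hx1, rfl⟩ g
        obtain ⟨y, hy, rfl⟩ := hK j g
        exact ⟨y * x * y⁻¹, K.mul_mem (K.mul_mem hy hx) (K.inv_mem hy),
          fun i' hi' => by simp [hx1 i' hi'], by simp⟩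
      have htop : N = ⊤ := by
        apply eq_top_of_commutator_mem hna
        intro a b
        obtain ⟨x, hx, hx1, rfl⟩ := ih hj.2 a
        obtain ⟨y, hy, hy1, rfl⟩ := exists_mem_one_at K hK i j (hij i j (Ne.symm hj.1)) b
        refine ⟨x * y * x⁻¹ * y⁻¹, K.mul_mem (K.mul_mem (K.mul_mem hx hy) (K.inv_mem hx))
          (K.inv_mem hy), fun i' hi' => ?_, by simp⟩
        rcases Finset.mem_insert.1 hi' with rfl | h'
        · simp [hy1]
        · simp [hx1 i' h']
      intro h
      have : h ∈ N := htop ▸ Subgroup.mem_top h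
      exact this
  rw [eq_top_iff]
  intro x _
  apply Subgroup.pi_mem_of_mulSingle_mem
  intro j
  obtain ⟨y, hy, hy1, hyj⟩ := key j (Finset.univ.erase j) (by simp) (x j)
  convert hy
  ext i
  by_cases h : i = j
  · subst h; simp [hyj]
  · rw [Pi.mulSingle_eq_of_ne h, hy1 i (by simp [h])]

end Hall

section Triples

/-- `E` is the locus where `f` attains its maximum, which is positive. -/
def IsMaxLocus {ι : Type*} (f : ι → ℕ) (E : Set ι) : Prop :=
  ∃ m, 0 < m ∧ (∀ i, f i ≤ m) ∧ ∀ i, i ∈ E ↔ f i = m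

/-- The entries of a triple, indexed by `Fin 3`. -/
def tripleEntry {H : Type*} (T : H × H × H) : Fin 3 → H := ![T.1, T.2.1, T.2.2]

/-- The triple in a power of `H` with given coordinates. -/
def powTriple {ι H : Type*} (U : ι → H × H × H) : (ι → H) × (ι → H) × (ι → H) :=
  (fun i => (U i).1, fun i => (U i).2.1, fun i => (U i).2.2)

theorem tripleEntry_powTriple {ι H : Type*} (U : ι → H × H × H) (x : Fin 3) (i : ι) :
    tripleEntry (powTriple U) x i = tripleEntry (U i) x := by
  fin_cases x <;> rfl

/-- The cyclic rotation of a triple. -/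
def rotTriple {H : Type*} (T : H × H × H) : H × H × H := (T.2.1, T.2.2, T.1)

theorem tripleEntry_rotTriple {H : Type*} (T : H × H × H) (x : Fin 3) :
    tripleEntry (rotTriple T) x = tripleEntry T (x + 1) := by
  fin_cases x <;> rfl

variable {H : Type*} [Group H]

theorem isGenTriple_powTriple {ι : Type*} [Finite ι] [Finite H] [IsSimpleGroup H]
    (hna : ∃ x y : H, x * y ≠ y * x) (U : ι → H × H × H) (hU : ∀ i, IsGenTriple (U i))
    (hne : ∀ i j, i ≠ j → ¬ TripleEquiv (U i) (U j)) : IsGenTriple (powTriple U) := by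
  refine ⟨funext fun i => (hU i).1, ?_⟩
  have hsub : ({(powTriple U).1, (powTriple U).2.1, (powTriple U).2.2} : Set (ι → H)) ⊆
    Subgroup.closure {(powTriple U).1, (powTriple U).2.1, (powTriple U).2.2} :=
      Subgroup.subset_closure
  refine eq_top_of_not_linked hna _ (fun i h => ?_) (fun i j hij ⟨α, hα⟩ => hne i j hij ⟨α,
    hα _ (hsub (Or.inl rfl)), hα _ (hsub (Or.inr (Or.inl rfl))),
    hα _ (hsub (Or.inr (Or.inr rfl)))⟩)
  have h1 : (Subgroup.closure {(powTriple U).1, (powTriple U).2.1, (powTriple U).2.2}).map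
      (Pi.evalMonoidHom (fun _ : ι => H) i) = ⊤ := by
    rw [MonoidHom.map_closure, ← (hU i).2]
    congr 1
    simp [Set.image_insert_eq, powTriple]
  obtain ⟨x, hx, rfl⟩ := (h1 ▸ Subgroup.mem_top h :
    h ∈ (Subgroup.closure {(powTriple U).1, (powTriple U).2.1, (powTriple U).2.2}).map
      (Pi.evalMonoidHom (fun _ : ι => H) i))
  exact ⟨x, hx, rfl⟩

theorem mem_sigmaSet_iff (T : H × H × H) (h : H) :
    h ∈ SigmaSet T ↔ ∃ x, ∃ g : H, g * h * g⁻¹ ∈ Subgroup.zpowers (tripleEntry T x) := by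
  simp only [SigmaSet, Set.mem_ofPred_eq, Set.mem_union, SetLike.mem_coe, Fin.exists_fin_succ,
    tripleEntry, Fin.exists_fin_zero]
  simp [or_assoc, exists_or]

theorem isMaxLocus_of_pow {ι : Type*} [Finite ι] [Finite H] {l r : ℕ} (hl : l.Prime)
    (a : ι → H) (h : orderOf (a ^ r) = l) : IsMaxLocus (fun i => (orderOf (a i)).factorization l) {i | (a ^ r) i ≠ 1} := by
  have hr0 : r ≠ 0 := by rintro rfl; simp at h; exact hl.one_lt.ne h
  have hN0 : orderOf a ≠ 0 := (orderOf_pos a).ne'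
  have hdvd : orderOf a ∣ r * l := by
    rw [orderOf_dvd_iff_pow_eq_one, pow_mul, ← h, pow_orderOf_eq_one]
  have hrl : r * l ≠ 0 := mul_ne_zero hr0 hl.ne_zero
  have hndvd : ¬ orderOf a ∣ r := by
    rw [orderOf_dvd_iff_pow_eq_one]; intro h1; rw [h1, orderOf_one] at h; exact hl.one_lt.ne h
  have hfac : ∀ l', l' ≠ l → (r * l).factorization l' = r.factorization l' := by
    intro l' hl'
    rw [Nat.factorization_mul hr0 hl.ne_zero, Finsupp.add_apply, hl.factorization,
      Finsupp.single_apply, if_neg (Ne.symm hl'), add_zero]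
  have hfacl : (r * l).factorization l = r.factorization l + 1 := by
    rw [Nat.factorization_mul hr0 hl.ne_zero, Finsupp.add_apply, hl.factorization,
      Finsupp.single_apply, if_pos rfl]
  have hle := (Nat.factorization_le_iff_dvd hN0 hrl).2 hdvd
  have hm : (orderOf a).factorization l = r.factorization l + 1 := by
    apply le_antisymm ((hle l).trans hfacl.le)
    by_contra! hlt
    apply hndvd
    rw [← Nat.factorization_le_iff_dvd hN0 hr0]
    intro l'
    by_cases hl' : l' = l
    · subst hl'; omega
    · exact (hle l').trans (hfac l' hl').le
  have hoi : ∀ i, orderOf (a i) ∣ orderOf a := fun i =>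
    orderOf_map_dvd (Pi.evalMonoidHom (fun _ : ι => H) i) a
  have hoi0 : ∀ i, orderOf (a i) ≠ 0 := fun i => (orderOf_pos (a i)).ne'
  have hlei := fun i => (Nat.factorization_le_iff_dvd (hoi0 i) hN0).2 (hoi i)
  refine ⟨r.factorization l + 1, by omega, fun i => hm ▸ hlei i l, fun i => ?_⟩
  simp only [Set.mem_ofPred_eq, Pi.pow_apply, ne_eq, ← orderOf_dvd_iff_pow_eq_one]
  rw [← Nat.factorization_le_iff_dvd (hoi0 i) hr0]
  constructor
  · intro h1
    by_contra h2
    apply h1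
    intro l'
    by_cases hl' : l' = l
    · subst hl'; have := hlei i l'; omega
    · exact (hlei i l').trans ((hle l').trans (hfac l' hl').le)
  · intro h1 h2
    have := h2 l
    omega

theorem sigmaSet_disjoint {ι : Type*} [Finite ι] [Finite H] (U V : ι → H × H × H)
    (h : ∀ (l : ℕ), l.Prime → ∀ (x x' : Fin 3) (E : Set ι), E.Nonempty →
      IsMaxLocus (fun i => (orderOf (tripleEntry (U i) x)).factorization l) E →
      IsMaxLocus (fun i => (orderOf (tripleEntry (V i) x')).factorization l) E → False) :
    SigmaSet (powTriple U) ∩ SigmaSet (powTriple V) = {1} := by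
  apply Set.eq_singleton_iff_unique_mem.2
  refine ⟨⟨⟨1, by simp⟩, ⟨1, by simp⟩⟩, ?_⟩
  rintro g ⟨hg1, hg2⟩
  by_contra hne
  set l := (orderOf g).minFac with hl
  have hlp : l.Prime := Nat.minFac_prime (by simpa [orderOf_eq_one_iff] using hne)
  obtain ⟨c, hc⟩ := Nat.minFac_dvd (orderOf g)
  have hc0 : c ≠ 0 := by rintro rfl; exact (orderOf_pos g).ne' (by simpa using hc)
  have ho : orderOf (g ^ c) = l := by
    rw [orderOf_pow_of_dvd hc0 (Dvd.intro_left _ hc.symm), hc, ← hl, Nat.mul_div_cancel _ (by omega)]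
  have key : ∀ W : ι → H × H × H, g ∈ SigmaSet (powTriple W) → ∃ x,
      IsMaxLocus (fun i => (orderOf (tripleEntry (W i) x)).factorization l) {i | (g ^ c) i ≠ 1} := by
    intro W hW
    obtain ⟨x, y, hxy⟩ := (mem_sigmaSet_iff _ _).1 hW
    rw [← mem_powers_iff_mem_zpowers] at hxy
    obtain ⟨n, hn⟩ := hxy
    have h1 : tripleEntry (powTriple W) x ^ (n * c) = y * g ^ c * y⁻¹ := by
      rw [pow_mul, show tripleEntry (powTriple W) x ^ n = _ from hn, conj_pow]
    have h2 : orderOf (tripleEntry (powTriple W) x ^ (n * c)) = l := by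
      rw [h1, ← ho]
      exact orderOf_injective (MulAut.conj y).toMonoidHom (MulAut.conj y).injective (g ^ c)
    refine ⟨x, ?_⟩
    have h3 := isMaxLocus_of_pow hlp _ h2
    have h4 : {i | (tripleEntry (powTriple W) x ^ (n * c)) i ≠ 1} = {i | (g ^ c) i ≠ 1} := by
      ext i
      rw [h1]
      simp [conj_eq_one_iff]
    rw [h4] at h3
    simp only [tripleEntry_powTriple] at h3
    exact h3
  obtain ⟨x, hx⟩ := key U hg1
  obtain ⟨x', hx'⟩ := key V hg2
  refine h l hlp x x' _ ?_ hx hx'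
  by_contra hE
  rw [Set.not_nonempty_iff_eq_empty] at hE
  have : g ^ c = 1 := by
    ext i
    by_contra hi
    exact (Set.mem_empty_iff_false i).1 (hE ▸ hi)
  rw [this, orderOf_one] at ho
  exact hlp.one_lt.ne ho

theorem isHyperbolic_powTriple {ι : Type*} [Finite ι] [Finite H] (U : ι → H × H × H)
    (h : ∀ x, ∃ i j, tripleEntry (U i) x ≠ 1 ∧ tripleEntry (U j) x ≠ 1 ∧
      (orderOf (tripleEntry (U i) x)).Coprime (orderOf (tripleEntry (U j) x))) :
    IsHyperbolic (powTriple U) := by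
  have key : ∀ x, (orderOf (tripleEntry (powTriple U) x) : ℚ)⁻¹ ≤ 4⁻¹ := by
    intro x
    obtain ⟨i, j, hi, hj, hc⟩ := h x
    have hd : ∀ i, orderOf (tripleEntry (U i) x) ∣ orderOf (tripleEntry (powTriple U) x) := fun i =>
      tripleEntry_powTriple U x i ▸
        orderOf_map_dvd (Pi.evalMonoidHom (fun _ : ι => H) i) (tripleEntry (powTriple U) x)
    have h1 := Nat.le_of_dvd (orderOf_pos _) (hc.mul_dvd_of_dvd_of_dvd (hd i) (hd j))
    rw [← orderOf_eq_one_iff.ne] at hi hj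
    have h2 := orderOf_pos (tripleEntry (U i) x)
    have h3 := orderOf_pos (tripleEntry (U j) x)
    have h4 : 4 ≤ orderOf (tripleEntry (powTriple U) x) :=
      (Nat.mul_le_mul (show 2 ≤ _ by omega) (show 2 ≤ _ by omega)).trans h1
    gcongr
    exact_mod_cast h4
  have h0 := key 0
  have h1 := key 1
  have h2 := key 2
  simp only [tripleEntry, Matrix.cons_val] at h0 h1 h2
  unfold IsHyperbolic
  linarith

theorem IsGenTriple.rotTriple {T : H × H × H} (h : IsGenTriple T) : IsGenTriple (rotTriple T) := by
  refine ⟨?_, ?_⟩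
  · have := h.1
    simp only [_root_.rotTriple]
    rw [mul_assoc] at this
    exact mul_eq_one_iff_eq_inv.2 (eq_inv_of_mul_eq_one_right this)
  · rw [← h.2]
    congr 1
    ext
    simp only [_root_.rotTriple, Set.mem_insert_iff, Set.mem_singleton_iff]
    tauto

theorem TripleEquiv.refl (T : H × H × H) : TripleEquiv T T := ⟨1, rfl, rfl, rfl⟩

theorem TripleEquiv.symm {T T' : H × H × H} : TripleEquiv T T' → TripleEquiv T' T := by
  rintro ⟨α, h1, h2, h3⟩
  exact ⟨α⁻¹, by simp [← h1], by simp [← h2], by simp [← h3]⟩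

theorem TripleEquiv.trans {T T' T'' : H × H × H} :
    TripleEquiv T T' → TripleEquiv T' T'' → TripleEquiv T T'' := by
  rintro ⟨α, h1, h2, h3⟩ ⟨β, h4, h5, h6⟩
  exact ⟨β * α, by simp [h1, h4], by simp [h2, h5], by simp [h3, h6]⟩

theorem TripleEquiv.rotTriple {T T' : H × H × H} : TripleEquiv T T' →
    TripleEquiv (rotTriple T) (rotTriple T') := by
  rintro ⟨α, h1, h2, h3⟩
  exact ⟨α, h2, h3, h1⟩

theorem TripleEquiv.orderOf_eq {T T' : H × H × H} (h : TripleEquiv T T') (x : Fin 3) :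
    orderOf (tripleEntry T x) = orderOf (tripleEntry T' x) := by
  obtain ⟨α, h1, h2, h3⟩ := h
  have key : ∀ x, tripleEntry T' x = α (tripleEntry T x) := by
    intro x
    fin_cases x
    · exact h1.symm
    · exact h2.symm
    · exact h3.symm
  rw [key]
  exact (orderOf_injective α.toMonoidHom α.injective _).symm

end Triples

section Arrangement

/-- The orbit of `x` under a map of order three, as a list. -/
def orbitList {X : Type*} (ρ : X → X) (x : X) : List X := [x, ρ x, ρ (ρ x)]

variable {X : Type*} {ρ : X → X}

theorem mem_orbitList {x y : X} : y ∈ orbitList ρ x ↔ y = x ∨ y = ρ x ∨ y = ρ (ρ x) := by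
  simp [orbitList]

theorem self_mem_orbitList (x : X) : x ∈ orbitList ρ x := mem_orbitList.2 (Or.inl rfl)

theorem orbitList_symm (hρ : ∀ x, ρ (ρ (ρ x)) = x) {x y : X} (h : y ∈ orbitList ρ x) :
    x ∈ orbitList ρ y := by
  rw [mem_orbitList] at *
  rcases h with rfl | rfl | rfl <;> simp [hρ]

theorem apply_mem_orbitList (hρ : ∀ x, ρ (ρ (ρ x)) = x) {x y : X} :
    ρ y ∈ orbitList ρ x ↔ y ∈ orbitList ρ x := by
  have h1 : ∀ y, y ∈ orbitList ρ x → ρ y ∈ orbitList ρ x := by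
    intro y h
    rw [mem_orbitList] at *
    rcases h with rfl | rfl | rfl <;> simp [hρ]
  exact ⟨fun h => hρ y ▸ h1 _ (h1 _ h), h1 y⟩

theorem nodup_orbitList (hρ : ∀ x, ρ (ρ (ρ x)) = x) {x : X} (hx : ρ x ≠ x) :
    (orbitList ρ x).Nodup := by
  have h1 : ρ (ρ x) ≠ x := fun h => hx (by rw [← h, hρ, h])
  have h2 : ρ (ρ x) ≠ ρ x := fun h => hx (by have := congrArg (ρ ∘ ρ) h; simp only [Function.comp_apply, hρ] at this; exact this)
  simp [orbitList, hx.symm, h1.symm, h2.symm]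

theorem mem_flatMap_orbitList_apply (hρ : ∀ x, ρ (ρ (ρ x)) = x) {L : List X} {y : X} :
    ρ y ∈ L.flatMap (orbitList ρ) ↔ y ∈ L.flatMap (orbitList ρ) := by
  simp only [List.mem_flatMap, apply_mem_orbitList hρ]

theorem length_flatMap_orbitList (L : List X) : (L.flatMap (orbitList ρ)).length = 3 * L.length := by
  induction L with
  | nil => rfl
  | cons a L ih => simp [List.flatMap_cons, ih, orbitList]; omega

theorem getElem?_flatMap_orbitList (L : List X) (i j : ℕ) (hj : j < 3) :
    (L.flatMap (orbitList ρ))[3 * i + j]? = (L[i]?).map (ρ^[j]) := by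
  induction L generalizing i with
  | nil => simp
  | cons a L ih =>
    cases i with
    | zero => interval_cases j <;> simp [List.flatMap_cons, orbitList]
    | succ i =>
      rw [List.flatMap_cons, List.getElem?_append_right (by simp [orbitList]; omega)]
      simp only [orbitList, List.length_cons, List.length_nil, List.getElem?_cons_succ]
      rw [← ih i]
      congr 1
      omega

theorem exists_orbit_lists [Fintype X] [DecidableEq X] (hρ : ∀ x, ρ (ρ (ρ x)) = x) {x₁ x₂ x₃ : X}
    (h1 : ρ x₁ ≠ x₁) (h2 : ρ x₂ ≠ x₂) (h3 : ρ x₃ ≠ x₃) (h12 : x₂ ∉ orbitList ρ x₁)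
    (h13 : x₃ ∉ orbitList ρ x₁) (h23 : x₃ ∉ orbitList ρ x₂) (k : ℕ) (hk : 6 ≤ k)
    (hkX : k ≤ Fintype.card X) :
    ∃ L T : List X, ((x₁ :: x₂ :: L).flatMap (orbitList ρ) ++ T).Nodup ∧
      ((x₁ :: x₂ :: L).flatMap (orbitList ρ) ++ T).length = k ∧
      x₃ ∉ (x₁ :: x₂ :: L).flatMap (orbitList ρ) ∧
      ∀ t ∈ T, ρ t = t ∨ t ∈ orbitList ρ x₃ := by
  induction k, hk using Nat.le_induction with
  | base =>
    refine ⟨[], [], ?_, by simp [orbitList], by simp [h13, h23], by simp⟩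
    simp only [List.flatMap_cons, List.flatMap_nil, List.append_nil]
    rw [List.nodup_append']
    refine ⟨nodup_orbitList hρ h1, nodup_orbitList hρ h2, fun a ha hb => h12 ?_⟩
    have := orbitList_symm hρ hb
    rw [mem_orbitList] at this
    rcases this with rfl | h | h
    · exact ha
    · exact h ▸ (apply_mem_orbitList hρ).2 ha
    · exact h ▸ (apply_mem_orbitList hρ).2 ((apply_mem_orbitList hρ).2 ha)
  | succ k hk ih =>
    obtain ⟨L, T, hnd, hlen, hx3, hT⟩ := ih (by omega)
    set O := (x₁ :: x₂ :: L).flatMap (orbitList ρ) with hO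
    by_cases hz : ∃ z, z ∉ O ++ T ∧ (ρ z = z ∨ z ∈ orbitList ρ x₃)
    · obtain ⟨z, hz1, hz2⟩ := hz
      refine ⟨L, z :: T, ?_, ?_, hx3, ?_⟩
      · rw [← hO]
        exact List.nodup_middle.2 (List.nodup_cons.2 ⟨hz1, hnd⟩)
      · rw [← hO]; simp at hlen ⊢; omega
      · simpa [hz2] using hT
    · push Not at hz
      have hO3 : ∀ w, w ∈ orbitList ρ x₃ → w ∈ T := by
        intro w hw
        by_contra hwT
        refine (hz w ?_).2 hw
        rw [List.mem_append, not_or]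
        refine ⟨fun hwO => hx3 ?_, hwT⟩
        rw [mem_orbitList] at hw
        rcases hw with rfl | rfl | rfl
        · exact hwO
        · exact (mem_flatMap_orbitList_apply hρ).1 hwO
        · exact (mem_flatMap_orbitList_apply hρ).1 ((mem_flatMap_orbitList_apply hρ).1 hwO)
      obtain ⟨z, hzn⟩ : ∃ z, z ∉ O ++ T := by
        by_contra! hall
        have : (Finset.univ : Finset X).card ≤ (O ++ T).toFinset.card :=
          Finset.card_le_card fun z _ => List.mem_toFinset.2 (hall z)
        have h5 := List.toFinset_card_le (O ++ T)
        rw [Finset.card_univ] at this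
        omega
      obtain ⟨hzf, hz3⟩ := hz z hzn
      rw [List.mem_append, not_or] at hzn
      rw [List.nodup_append'] at hnd
      have hzo : ∀ w ∈ orbitList ρ z, w ∉ O ∧ w ∉ T := by
        intro w hw
        have hzw := orbitList_symm hρ hw
        constructor
        · intro hwO
          apply hzn.1
          rw [mem_orbitList] at hzw
          rcases hzw with rfl | h | h
          · exact hwO
          · exact h ▸ (mem_flatMap_orbitList_apply hρ).2 hwO
          · exact h ▸ (mem_flatMap_orbitList_apply hρ).2 ((mem_flatMap_orbitList_apply hρ).2 hwO)
        · intro hwT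
          rw [mem_orbitList] at hzw
          rcases hT w hwT with hf | h3
          · rcases hzw with rfl | h | h
            · exact hzf hf
            · exact hzf (by rw [h, hf, hf])
            · exact hzf (by rw [h, hf, hf, hf])
          · apply hz3
            rcases hzw with rfl | h | h
            · exact h3
            · exact h ▸ (apply_mem_orbitList hρ).2 h3
            · exact h ▸ (apply_mem_orbitList hρ).2 ((apply_mem_orbitList hρ).2 h3)
      have hO' : (x₁ :: x₂ :: (L ++ [z])).flatMap (orbitList ρ) = O ++ orbitList ρ z := by
        simp [hO, List.flatMap_append]
      refine ⟨L ++ [z], (T.erase x₃).erase (ρ x₃), ?_, ?_, ?_, ?_⟩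
      · rw [hO', List.nodup_append', List.nodup_append']
        refine ⟨⟨hnd.1, nodup_orbitList hρ hzf, fun w hw hw' => (hzo w hw').1 hw⟩,
          (hnd.2.1.erase _).erase _, fun w hw hw' => ?_⟩
        have hwT := List.mem_of_mem_erase (List.mem_of_mem_erase hw')
        rcases List.mem_append.1 hw with h | h
        · exact hnd.2.2 h hwT
        · exact (hzo w h).2 hwT
      · have e1 : x₃ ∈ T := hO3 _ (self_mem_orbitList x₃)
        have e2 : ρ x₃ ∈ T.erase x₃ :=
          (List.mem_erase_of_ne h3).2 (hO3 _ ((apply_mem_orbitList hρ).2 (self_mem_orbitList x₃)))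
        rw [hO', List.length_append, List.length_append, List.length_erase_of_mem e2,
          List.length_erase_of_mem e1]
        have e3 := List.length_pos_of_mem e2
        rw [List.length_erase_of_mem e1] at e3
        rw [List.length_append] at hlen
        have e4 : (orbitList ρ z).length = 3 := rfl
        omega
      · rw [hO', List.mem_append, not_or]
        exact ⟨hx3, fun h => hz3 (orbitList_symm hρ h)⟩
      · intro t ht
        exact hT t (List.mem_of_mem_erase (List.mem_of_mem_erase ht))

theorem exists_arrangement_seq [Fintype X] [DecidableEq X] (hρ : ∀ x, ρ (ρ (ρ x)) = x)
    {x₁ x₂ x₃ : X}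
    (h1 : ρ x₁ ≠ x₁) (h2 : ρ x₂ ≠ x₂) (h3 : ρ x₃ ≠ x₃) (h12 : x₂ ∉ orbitList ρ x₁)
    (h13 : x₃ ∉ orbitList ρ x₁) (h23 : x₃ ∉ orbitList ρ x₂) (k : ℕ) (hk : 6 ≤ k)
    (hkX : k ≤ Fintype.card X) :
    ∃ (y : ℕ → X) (s : ℕ), 2 ≤ s ∧ 3 * s ≤ k ∧ (∀ m n, m < k → n < k → y m = y n → m = n) ∧
      y 0 = x₁ ∧ y 3 = x₂ ∧ (∀ i j, i < s → j < 3 → y (3 * i + j) = ρ^[j] (y (3 * i))) ∧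
      ∀ n, 3 * s ≤ n → n < k → ρ (y n) = y n ∨ y n ∈ orbitList ρ x₃ := by
  obtain ⟨L, T, hnd, hlen, -, hT⟩ := exists_orbit_lists hρ h1 h2 h3 h12 h13 h23 k hk hkX
  set M := x₁ :: x₂ :: L with hM
  have hMl : 2 ≤ M.length := by simp [hM]
  have hfl := length_flatMap_orbitList (ρ := ρ) M
  have hlen' := hlen
  rw [List.length_append, hfl] at hlen'
  have hget : ∀ i j, i < M.length → j < 3 →
      ((M.flatMap (orbitList ρ) ++ T)[3 * i + j]?).getD x₁ = ρ^[j] ((M[i]?).getD x₁) := by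
    intro i j hi hj
    rw [List.getElem?_append_left (by omega), getElem?_flatMap_orbitList M i j hj]
    simp [hi]
  refine ⟨fun n => ((M.flatMap (orbitList ρ) ++ T)[n]?).getD x₁, M.length, hMl, by omega, ?_, ?_,
    ?_, ?_, ?_⟩
  · intro m n hm hn h
    rw [← hlen] at hm hn
    simp only [List.getElem?_eq_getElem hm, List.getElem?_eq_getElem hn, Option.getD_some] at h
    exact (List.Nodup.getElem_inj_iff hnd).1 h
  · simpa [hM] using hget 0 0 (by omega) (by omega)
  · simpa [hM] using hget 1 0 (by omega) (by omega)
  · intro i j hi hj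
    have e := hget i 0 hi (by omega)
    simp only [add_zero, Function.iterate_zero, id] at e
    simp only [hget i j hi hj, e]
  · intro n hn hnk
    apply hT
    simp only
    have hn' := hn
    rw [← hfl] at hn'
    rw [List.getElem?_append_right hn', List.getElem?_eq_getElem (by omega), Option.getD_some]
    exact List.getElem_mem _

/-- The maximal loci of a rotation-compatible arrangement and of its shift by three never agree. -/
theorem shift_locus_false {v : X → Fin 3 → ℕ}
    (hv : ∀ x e, v (ρ x) e = v x (e + 1)) {x₁ x₂ x₃ : X}
    (hcop : ∀ e e', v x₁ e = 0 ∨ v x₂ e' = 0)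
    (hdom : ∀ e, ∃ e', v x₃ e ≤ v x₁ e' ∨ v x₃ e ≤ v x₂ e') {k : ℕ} (hk : 6 ≤ k)
    {y : ℕ → X} {s : ℕ} (hs : 2 ≤ s) (hsk : 3 * s ≤ k) (hy0 : y 0 = x₁) (hy3 : y 3 = x₂)
    (hy : ∀ i j, i < s → j < 3 → y (3 * i + j) = ρ^[j] (y (3 * i)))
    (htail : ∀ n, 3 * s ≤ n → n < k → ρ (y n) = y n ∨ y n ∈ orbitList ρ x₃)
    (e e' : Fin 3) (E : Set (Fin k)) (hE : E.Nonempty)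
    (hU : IsMaxLocus (fun n : Fin k => v (y n) e) E)
    (hV : IsMaxLocus (fun n : Fin k => v (y ((n + 3) % k)) e') E) : False := by
  obtain ⟨m, hm, hUle, hUE⟩ := hU
  obtain ⟨m', hm', hVle, hVE⟩ := hV
  have hUle : ∀ n, n < k → v (y n) e ≤ m := fun n hn => hUle ⟨n, hn⟩
  have hVle : ∀ n, n < k → v (y n) e' ≤ m' := by
    intro n hn
    have h := hVle ⟨(n + (k - 3)) % k, Nat.mod_lt _ (by omega)⟩
    simp only [Nat.mod_add_mod] at h
    rwa [show n + (k - 3) + 3 = n + k by omega, Nat.add_mod_right, Nat.mod_eq_of_lt hn] at h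
  have hvit : ∀ x (j : ℕ) (hj : j < 3) e, v (ρ^[j] x) e = v x (e + ⟨j, hj⟩) := by
    intro x j hj e
    interval_cases j
    · change _ = v x (e + 0); simp
    · exact hv x e
    · change v (ρ (ρ x)) e = v x (e + (1 + 1))
      rw [hv, hv, add_assoc]
  have hrot : ∀ i, i < s → ∀ e e', ∃ j, j < 3 ∧ v (y (3 * i + j)) e' = v (y (3 * i)) e := by
    intro i hi e e'
    refine ⟨(e - e' : Fin 3).val, (e - e').isLt, ?_⟩
    rw [hy i _ hi (e - e').isLt, hvit _ _ (e - e').isLt]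
    simp
  have hback : ∀ i, i < s → ∀ j, j < 3 → ∀ e, ∃ e', v (y (3 * i)) e' = v (y (3 * i + j)) e := by
    intro i hi j hj e
    exact ⟨e + ⟨j, hj⟩, by rw [hy i j hi hj, hvit _ _ hj]⟩
  have hx3 : ∀ x ∈ orbitList ρ x₃, ∀ e, ∃ i, i < 2 ∧ ∃ e', v x e ≤ v (y (3 * i)) e' := by
    intro x hx e
    obtain ⟨e₁, he₁⟩ : ∃ e₁, v x e = v x₃ e₁ := by
      rw [mem_orbitList] at hx
      rcases hx with rfl | rfl | rfl
      · exact ⟨e, rfl⟩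
      · exact ⟨_, hv _ _⟩
      · exact ⟨_, (hv _ _).trans (hv _ _)⟩
    obtain ⟨e₂, h | h⟩ := hdom e₁
    · exact ⟨0, by omega, e₂, by rw [he₁, mul_zero, hy0]; exact h⟩
    · exact ⟨1, by omega, e₂, by rw [he₁, mul_one, hy3]; exact h⟩
  have hfix : ∀ x, ρ x = x → ∀ e e', v x e = v x e' := by
    intro x hx
    have h1 : ∀ e, v x e = v x (e + 1) := fun e => by rw [← hv, hx]
    have h2 : ∀ e, v x e = v x 0 := by
      intro e
      fin_cases e
      · rfl
      · exact (h1 0).symm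
      · exact h1 2
    intro e e'
    rw [h2 e, h2 e']
  have hcmp : ∀ n, n < k → ∀ e e', ∃ n', n' < k ∧ v (y n) e ≤ v (y n') e' := by
    intro n hn e e'
    by_cases hns : n < 3 * s
    · obtain ⟨e₁, he₁⟩ := hback (n / 3) (by omega) (n % 3) (by omega) e
      rw [Nat.div_add_mod] at he₁
      obtain ⟨j, hj, hj'⟩ := hrot (n / 3) (by omega) e₁ e'
      exact ⟨3 * (n / 3) + j, by omega, by rw [hj', he₁]⟩
    · rcases htail n (by omega) hn with h | h
      · exact ⟨n, hn, (hfix _ h e e').le⟩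
      · obtain ⟨i, hi, e₁, he₁⟩ := hx3 _ h e
        obtain ⟨j, hj, hj'⟩ := hrot i (by omega) e₁ e'
        exact ⟨3 * i + j, by omega, by rw [hj']; exact he₁⟩
  obtain ⟨n₀, hn₀⟩ := hE
  have hmm : m = m' := by
    apply le_antisymm
    · obtain ⟨n', hn', h⟩ := hcmp n₀ n₀.2 e e'
      have := (hUE n₀).1 hn₀
      simp only at this
      rw [this] at h
      exact h.trans (hVle n' hn')
    · obtain ⟨n', hn', h⟩ := hcmp ((n₀ + 3) % k) (Nat.mod_lt _ (by omega)) e' e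
      have := (hVE n₀).1 hn₀
      simp only at this
      rw [this] at h
      exact h.trans (hUle n' hn')
  subst hmm
  have hbd : ∀ n, n < k → ∀ e₁, v (y n) e₁ ≤ m := by
    intro n hn e₁
    obtain ⟨n', hn', h⟩ := hcmp n hn e₁ e
    exact h.trans (hUle n' hn')
  have hlink : ∀ i, i + 1 < s → ((∃ e, v (y (3 * i)) e = m) ↔ ∃ e, v (y (3 * (i + 1))) e = m) := by
    intro i hi
    have hiff : ∀ j, j < 3 → (v (y (3 * i + j)) e = m ↔ v (y (3 * (i + 1) + j)) e' = m) := by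
      intro j hj
      have a1 := hUE ⟨3 * i + j, by omega⟩
      have a2 := hVE ⟨3 * i + j, by omega⟩
      simp only at a1 a2
      rw [Nat.mod_eq_of_lt (by omega), show 3 * i + j + 3 = 3 * (i + 1) + j by ring] at a2
      exact a1.symm.trans a2
    constructor
    · rintro ⟨e₁, he₁⟩
      obtain ⟨j, hj, h⟩ := hrot i (by omega) e₁ e
      obtain ⟨e₂, he₂⟩ := hback (i + 1) hi j hj e'
      exact ⟨e₂, he₂.trans ((hiff j hj).1 (h.trans he₁))⟩
    · rintro ⟨e₁, he₁⟩
      obtain ⟨j, hj, h⟩ := hrot (i + 1) (by omega) e₁ e'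
      obtain ⟨e₂, he₂⟩ := hback i (by omega) j hj e
      exact ⟨e₂, he₂.trans ((hiff j hj).2 (h.trans he₁))⟩
  have hno0 : ¬ ∃ e, v (y (3 * 0)) e = m := by
    intro h
    obtain ⟨e₁, he₁⟩ := h
    obtain ⟨e₂, he₂⟩ := (hlink 0 (by omega)).1 ⟨e₁, he₁⟩
    rw [mul_zero, hy0] at he₁
    rw [zero_add, mul_one, hy3] at he₂
    rcases hcop e₁ e₂ with h | h <;> omega
  have hno : ∀ i, i < s → ¬ ∃ e, v (y (3 * i)) e = m := by
    intro i
    induction i with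
    | zero => exact fun _ => hno0
    | succ i ih => exact fun hi h => ih (by omega) ((hlink i hi).2 h)
  have htl : ∀ n, n < k → ∀ e₁, v (y n) e₁ = m → 3 * s ≤ n ∧ ∀ e₂, v (y n) e₂ = m := by
    intro n hn e₁ he₁
    by_cases hns : n < 3 * s
    · exfalso
      obtain ⟨e₂, he₂⟩ := hback (n / 3) (by omega) (n % 3) (by omega) e₁
      rw [Nat.div_add_mod] at he₂
      exact hno (n / 3) (by omega) ⟨e₂, he₂.trans he₁⟩
    · refine ⟨by omega, ?_⟩
      rcases htail n (by omega) hn with h | h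
      · exact fun e₂ => (hfix _ h e₂ e₁).trans he₁
      · obtain ⟨i, hi, e₂, he₂⟩ := hx3 _ h e₁
        exact absurd ⟨e₂, le_antisymm (hbd _ (by omega) _) (he₁ ▸ he₂)⟩ (hno i (by omega))
  obtain ⟨n, hn, hmax⟩ := (Set.toFinite E).exists_maximal ⟨n₀, hn₀⟩
  have h1 := (hVE n).1 hn
  simp only at h1
  obtain ⟨h2, h3⟩ := htl _ (Nat.mod_lt _ (by omega)) _ h1
  obtain ⟨h4, -⟩ := htl n n.2 e ((hUE n).1 hn)
  by_cases hlt : n.1 + 3 < k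
  · rw [Nat.mod_eq_of_lt hlt] at h3
    have h5 := hmax ((hUE ⟨n.1 + 3, hlt⟩).2 (h3 e)) (by rw [Fin.le_def]; simp)
    rw [Fin.le_def] at h5
    simp at h5
  · rw [Nat.mod_eq_sub_mod (by omega), Nat.mod_eq_of_lt (by omega)] at h2
    omega

theorem exists_arrangement [Fintype X] [DecidableEq X] (hρ : ∀ x, ρ (ρ (ρ x)) = x)
    {v : ℕ → X → Fin 3 → ℕ} (hv : ∀ l x e, v l (ρ x) e = v l x (e + 1)) {x₁ x₂ x₃ : X}
    (h1 : ρ x₁ ≠ x₁) (h2 : ρ x₂ ≠ x₂) (h3 : ρ x₃ ≠ x₃) (h12 : x₂ ∉ orbitList ρ x₁)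
    (h13 : x₃ ∉ orbitList ρ x₁) (h23 : x₃ ∉ orbitList ρ x₂)
    (hcop : ∀ l e e', v l x₁ e = 0 ∨ v l x₂ e' = 0)
    (hdom : ∀ l e, ∃ e', v l x₃ e ≤ v l x₁ e' ∨ v l x₃ e ≤ v l x₂ e') {k : ℕ} (hk : 2 ≤ k)
    (hkX : k ≤ Fintype.card X) :
    ∃ U V : Fin k → X, Function.Injective U ∧ Function.Injective V ∧
      (∃ i j, U i ∈ orbitList ρ x₁ ∧ U j ∈ orbitList ρ x₂) ∧
      (∃ i j, V i ∈ orbitList ρ x₁ ∧ V j ∈ orbitList ρ x₂) ∧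
      ∀ l e e' (E : Set (Fin k)), E.Nonempty → IsMaxLocus (fun n => v l (U n) e) E →
        IsMaxLocus (fun n => v l (V n) e') E → False := by
  rcases Nat.lt_or_ge k 6 with hk6 | hk6
  · have hit : ∀ x n, n < 3 → ρ^[n] x ∈ orbitList ρ x := by
      intro x n hn; interval_cases n <;> simp [orbitList]
    have hinj : ∀ x, ρ x ≠ x → ∀ m n, m < 3 → n < 3 → ρ^[m] x = ρ^[n] x → m = n := by
      intro x hx m n hm hn h
      have hnd := nodup_orbitList hρ hx
      simp only [orbitList, List.nodup_cons, List.mem_cons, List.not_mem_nil, or_false,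
        not_or] at hnd
      obtain ⟨⟨a1, a2⟩, a3, -⟩ := hnd
      interval_cases m <;> interval_cases n <;>
        simp only [Function.iterate_succ_apply', Function.iterate_zero, id] at h ⊢
      exacts [(a1 h).elim, (a2 h).elim, (a1 h.symm).elim, (a3 h).elim, (a2 h.symm).elim,
        (a3 h.symm).elim]
    have hdisj : ∀ w, w ∈ orbitList ρ x₁ → w ∈ orbitList ρ x₂ → False := by
      intro w ha hb
      apply h12
      have := orbitList_symm hρ hb
      rw [mem_orbitList] at this
      rcases this with rfl | h | h
      · exact ha
      · exact h ▸ (apply_mem_orbitList hρ).2 ha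
      · exact h ▸ (apply_mem_orbitList hρ).2 ((apply_mem_orbitList hρ).2 ha)
    have hcop' : ∀ l x, x ∈ orbitList ρ x₁ → ∀ x', x' ∈ orbitList ρ x₂ → ∀ e e',
        v l x e = 0 ∨ v l x' e' = 0 := by
      intro l x hx x' hx' e e'
      rw [mem_orbitList] at hx hx'
      rcases hx with rfl | rfl | rfl <;> rcases hx' with rfl | rfl | rfl <;>
        (try simp only [hv]) <;> apply hcop
    let W : X → X → Fin k → X := fun a b n =>
      if n.1 < (k + 1) / 2 then ρ^[n.1] a else ρ^[n.1 - (k + 1) / 2] b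
    have hWinj : ∀ a b, ρ a ≠ a → ρ b ≠ b →
        (∀ w, w ∈ orbitList ρ a → w ∈ orbitList ρ b → False) → Function.Injective (W a b) := by
      intro a b ha hb hab m n hmn
      have hm := m.2
      have hn := n.2
      simp only [W] at hmn
      apply Fin.ext
      split_ifs at hmn with c1 c2 c2
      · exact hinj a ha _ _ (by omega) (by omega) hmn
      · exact (hab _ (hit a m (by omega)) (hmn ▸ hit b _ (by omega))).elim
      · exact (hab _ (hit a n (by omega)) (hmn ▸ hit b _ (by omega))).elim
      · have := hinj b hb _ _ (by omega) (by omega) hmn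
        omega
    have hW0 : ∀ a b, W a b ⟨0, by omega⟩ = a := by
      intro a b; simp only [W]; rw [if_pos (by omega)]; rfl
    have hW1 : ∀ a b, W a b ⟨(k + 1) / 2, by omega⟩ = b := by
      intro a b; simp only [W]; rw [if_neg (by omega)]; simp
    refine ⟨W x₁ x₂, W x₂ x₁, hWinj _ _ h1 h2 hdisj, hWinj _ _ h2 h1 fun w a b => hdisj w b a,
      ⟨_, _, by rw [hW0]; exact self_mem_orbitList _, by rw [hW1]; exact self_mem_orbitList _⟩,
      ⟨_, _, by rw [hW1]; exact self_mem_orbitList _, by rw [hW0]; exact self_mem_orbitList _⟩,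
      ?_⟩
    rintro l e e' E ⟨n, hn⟩ ⟨m, hm, -, hmE⟩ ⟨m', hm', -, hmE'⟩
    have b1 := (hmE n).1 hn
    have b2 := (hmE' n).1 hn
    have hn2 := n.2
    simp only [W] at b1 b2
    split_ifs at b1 b2 with c
    · rcases hcop' l _ (hit x₁ n (by omega)) _ (hit x₂ n (by omega)) e e' with h | h <;> omega
    · rcases hcop' l _ (hit x₁ (n - (k + 1) / 2) (by omega)) _
        (hit x₂ (n - (k + 1) / 2) (by omega)) e' e with h | h <;> omega
  · obtain ⟨y, s, hs, hsk, hinj, hy0, hy3, hy, htail⟩ :=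
      exists_arrangement_seq hρ h1 h2 h3 h12 h13 h23 k hk6 hkX
    have hmod : ∀ n, n % k < k := fun n => Nat.mod_lt _ (by omega)
    refine ⟨fun n => y n, fun n => y ((n + 3) % k), fun m n h => Fin.ext (hinj _ _ m.2 n.2 h),
      fun m n h => Fin.ext ?_, ⟨⟨0, by omega⟩, ⟨3, by omega⟩, ?_, ?_⟩,
      ⟨⟨k - 3, by omega⟩, ⟨0, by omega⟩, ?_, ?_⟩, ?_⟩
    · have h4 : (m.1 + 3) ≡ (n.1 + 3) [MOD k] := hinj _ _ (hmod _) (hmod _) h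
      have h5 := Nat.ModEq.add_right_cancel' 3 h4
      rwa [Nat.ModEq, Nat.mod_eq_of_lt m.2, Nat.mod_eq_of_lt n.2] at h5
    · simp only [hy0]; exact self_mem_orbitList _
    · simp only [hy3]; exact self_mem_orbitList _
    · simp only [show k - 3 + 3 = k by omega, Nat.mod_self, hy0]; exact self_mem_orbitList _
    · simp only [show (0 + 3) % k = 3 from Nat.mod_eq_of_lt (by omega), hy3]
      exact self_mem_orbitList _
    · intro l e e' E hE hU hV
      exact shift_locus_false (hv l) (hcop l) (hdom l) hk6 hs hsk hy0 hy3 hy htail e e' E hE hU hV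

end Arrangement

section Assembly

theorem hasBeauvilleStructure_pow {ι H : Type*} [Finite ι] [Group H] [Finite H] [IsSimpleGroup H]
    (hna : ∃ x y : H, x * y ≠ y * x) (U V : ι → H × H × H)
    (hU : ∀ i, IsGenTriple (U i)) (hV : ∀ i, IsGenTriple (V i))
    (hUe : ∀ i j, i ≠ j → ¬ TripleEquiv (U i) (U j))
    (hVe : ∀ i j, i ≠ j → ¬ TripleEquiv (V i) (V j))
    (hUh : ∀ x, ∃ i j, tripleEntry (U i) x ≠ 1 ∧ tripleEntry (U j) x ≠ 1 ∧
      (orderOf (tripleEntry (U i) x)).Coprime (orderOf (tripleEntry (U j) x)))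
    (hVh : ∀ x, ∃ i j, tripleEntry (V i) x ≠ 1 ∧ tripleEntry (V j) x ≠ 1 ∧
      (orderOf (tripleEntry (V i) x)).Coprime (orderOf (tripleEntry (V j) x)))
    (h : ∀ (l : ℕ), l.Prime → ∀ (x x' : Fin 3) (E : Set ι), E.Nonempty →
      IsMaxLocus (fun i => (orderOf (tripleEntry (U i) x)).factorization l) E →
      IsMaxLocus (fun i => (orderOf (tripleEntry (V i) x')).factorization l) E → False) :
    HasBeauvilleStructure (ι → H) :=
  ⟨powTriple U, powTriple V, isGenTriple_powTriple hna U hU hUe, isHyperbolic_powTriple U hUh,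
    isGenTriple_powTriple hna V hV hVe, isHyperbolic_powTriple V hVh, sigmaSet_disjoint U V h⟩

variable (H : Type*) [Group H]

/-- Generating triples up to automorphism. -/
def genTripleSetoid : Setoid {T : H × H × H // IsGenTriple T} where
  r T T' := TripleEquiv T.1 T'.1
  iseqv := ⟨fun T => TripleEquiv.refl T.1, TripleEquiv.symm, TripleEquiv.trans⟩

/-- Classes of generating triples under the automorphism group. -/
abbrev GenClass := Quotient (genTripleSetoid H)

variable {H}

/-- The rotation of a class of generating triples. -/
def GenClass.rot : GenClass H → GenClass H :=
  Quotient.map (fun T => ⟨rotTriple T.1, T.2.rotTriple⟩) fun _ _ h => TripleEquiv.rotTriple h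

/-- The order of the entry at a given position of a class of generating triples. -/
noncomputable def GenClass.order (c : GenClass H) (x : Fin 3) : ℕ :=
  Quotient.lift (fun T : {T : H × H × H // IsGenTriple T} => orderOf (tripleEntry T.1 x))
    (fun _ _ h => TripleEquiv.orderOf_eq h x) c

/-- The class of a generating triple. -/
def GenClass.mk {T : H × H × H} (h : IsGenTriple T) : GenClass H := Quotient.mk _ ⟨T, h⟩

theorem GenClass.mk_eq_iff {T T' : H × H × H} (h : IsGenTriple T) (h' : IsGenTriple T') :
    GenClass.mk h = GenClass.mk h' ↔ TripleEquiv T T' := by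
  unfold GenClass.mk
  rw [Quotient.eq]
  rfl

theorem GenClass.exists_rep (c : GenClass H) : ∃ (T : H × H × H) (h : IsGenTriple T), c = GenClass.mk h := by
  induction c using Quotient.inductionOn with
  | h T => exact ⟨T.1, T.2, rfl⟩

theorem GenClass.rot_mk {T : H × H × H} (h : IsGenTriple T) :
    (GenClass.mk h).rot = GenClass.mk h.rotTriple := rfl

theorem GenClass.order_mk {T : H × H × H} (h : IsGenTriple T) (x : Fin 3) :
    (GenClass.mk h).order x = orderOf (tripleEntry T x) := rfl

theorem GenClass.rot_rot_rot (c : GenClass H) : c.rot.rot.rot = c := by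
  obtain ⟨T, h, rfl⟩ := c.exists_rep
  rfl

theorem GenClass.order_rot (c : GenClass H) (x : Fin 3) : c.rot.order x = c.order (x + 1) := by
  obtain ⟨T, h, rfl⟩ := c.exists_rep
  rw [rot_mk, order_mk, order_mk, tripleEntry_rotTriple]

theorem isGenTriple_of_closure {a b : H} (h : Subgroup.closure {a, b} = ⊤) :
    IsGenTriple (a, b, (a * b)⁻¹) := by
  refine ⟨by simp, top_le_iff.1 (h ▸ Subgroup.closure_mono ?_)⟩
  simp [Set.insert_subset_iff]

theorem le_card_genClass [Finite H] {k : ℕ} (hk : k * Nat.card (MulAut H) ≤ phi2 H) :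
    k ≤ Nat.card (GenClass H) := by
  have hpos : 0 < Nat.card (MulAut H) := Nat.card_pos
  let f : {p : H × H // Subgroup.closure {p.1, p.2} = ⊤} → GenClass H :=
    fun p => GenClass.mk (isGenTriple_of_closure p.2)
  have hf : ∀ p, ∃ α : MulAut H, α (f p).out.1.1 = p.1.1 ∧ α (f p).out.1.2.1 = p.1.2 := by
    intro p
    have : GenClass.mk (f p).out.2 = f p := Quotient.out_eq (f p)
    obtain ⟨α, h1, h2, -⟩ := (GenClass.mk_eq_iff _ (isGenTriple_of_closure p.2)).1 this
    exact ⟨α, h1, h2⟩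
  choose α hα using hf
  have hinj : Function.Injective fun p => (f p, α p) := by
    intro p q h
    simp only [Prod.mk.injEq] at h
    apply Subtype.ext
    apply Prod.ext
    · rw [← (hα p).1, ← (hα q).1, h.1, h.2]
    · rw [← (hα p).2, ← (hα q).2, h.1, h.2]
  have h1 := Nat.card_le_card_of_injective _ hinj
  rw [Nat.card_prod] at h1
  exact Nat.le_of_mul_le_mul_right (hk.trans h1) hpos

theorem hasBeauvilleStructure_of_classes [Finite H] [IsSimpleGroup H]
    (hna : ∃ x y : H, x * y ≠ y * x) {ι : Type*} [Finite ι] (U V : ι → GenClass H)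
    (hU : Function.Injective U) (hV : Function.Injective V)
    (hUh : ∀ x, ∃ i j, (U i).order x ≠ 1 ∧ (U j).order x ≠ 1 ∧
      ((U i).order x).Coprime ((U j).order x))
    (hVh : ∀ x, ∃ i j, (V i).order x ≠ 1 ∧ (V j).order x ≠ 1 ∧
      ((V i).order x).Coprime ((V j).order x))
    (h : ∀ (l : ℕ), l.Prime → ∀ (x x' : Fin 3) (E : Set ι), E.Nonempty →
      IsMaxLocus (fun i => ((U i).order x).factorization l) E →
      IsMaxLocus (fun i => ((V i).order x').factorization l) E → False) :
    HasBeauvilleStructure (ι → H) := by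
  choose U' hUg hUc using fun i => (U i).exists_rep
  choose V' hVg hVc using fun i => (V i).exists_rep
  refine hasBeauvilleStructure_pow hna U' V' hUg hVg ?_ ?_ ?_ ?_ ?_
  · intro i j hij he
    exact hij (hU (by rw [hUc i, hUc j, GenClass.mk_eq_iff]; exact he))
  · intro i j hij he
    exact hij (hV (by rw [hVc i, hVc j, GenClass.mk_eq_iff]; exact he))
  · simpa only [hUc, GenClass.order_mk, ne_eq, orderOf_eq_one_iff] using hUh
  · simpa only [hVc, GenClass.order_mk, ne_eq, orderOf_eq_one_iff] using hVh
  · simpa only [hUc, hVc, GenClass.order_mk] using h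

/-- The Beauville criterion for powers of a finite simple group: two generating triples of coprime
orders, and a third one whose orders are controlled by the first two, all in different free orbits
of the rotation. -/
theorem hasBeauvilleStructure_of_three [Finite H] [IsSimpleGroup H]
    (hna : ∃ x y : H, x * y ≠ y * x) {T₁ T₂ T₃ : H × H × H}
    (g₁ : IsGenTriple T₁) (g₂ : IsGenTriple T₂) (g₃ : IsGenTriple T₃)
    (n₁ : ∀ x, tripleEntry T₁ x ≠ 1) (n₂ : ∀ x, tripleEntry T₂ x ≠ 1)
    (hcop : ∀ x x', (orderOf (tripleEntry T₁ x)).Coprime (orderOf (tripleEntry T₂ x')))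
    (r₁ : ¬ TripleEquiv (rotTriple T₁) T₁) (r₂ : ¬ TripleEquiv (rotTriple T₂) T₂)
    (r₃ : ¬ TripleEquiv (rotTriple T₃) T₃)
    (h₁₃ : ¬ TripleEquiv T₃ T₁ ∧ ¬ TripleEquiv T₃ (rotTriple T₁) ∧
      ¬ TripleEquiv T₃ (rotTriple (rotTriple T₁)))
    (h₂₃ : ¬ TripleEquiv T₃ T₂ ∧ ¬ TripleEquiv T₃ (rotTriple T₂) ∧
      ¬ TripleEquiv T₃ (rotTriple (rotTriple T₂)))
    (hdom : ∀ (l : ℕ) (x : Fin 3), ∃ x',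
      (orderOf (tripleEntry T₃ x)).factorization l ≤ (orderOf (tripleEntry T₁ x')).factorization l ∨
      (orderOf (tripleEntry T₃ x)).factorization l ≤ (orderOf (tripleEntry T₂ x')).factorization l)
    {k : ℕ} (hk2 : 2 ≤ k) (hk : k * Nat.card (MulAut H) ≤ phi2 H) :
    HasBeauvilleStructure (Fin k → H) := by
  classical
  have := Fintype.ofFinite (GenClass H)
  have hkc := le_card_genClass hk
  rw [Nat.card_eq_fintype_card] at hkc
  have hmem : ∀ {T T' : H × H × H} (h : IsGenTriple T) (h' : IsGenTriple T'),
      GenClass.mk h' ∈ orbitList GenClass.rot (GenClass.mk h) ↔ TripleEquiv T' T ∨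
        TripleEquiv T' (rotTriple T) ∨ TripleEquiv T' (rotTriple (rotTriple T)) := by
    intro T T' h h'
    simp only [mem_orbitList, GenClass.rot_mk, GenClass.mk_eq_iff]
  have hord1 : ∀ c ∈ orbitList GenClass.rot (GenClass.mk g₁), ∀ x,
      ∃ x', c.order x = orderOf (tripleEntry T₁ x') := by
    intro c hc x
    rw [mem_orbitList] at hc
    rcases hc with rfl | rfl | rfl <;> simp only [GenClass.order_rot, GenClass.order_mk] <;>
      exact ⟨_, rfl⟩
  have hord2 : ∀ c ∈ orbitList GenClass.rot (GenClass.mk g₂), ∀ x,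
      ∃ x', c.order x = orderOf (tripleEntry T₂ x') := by
    intro c hc x
    rw [mem_orbitList] at hc
    rcases hc with rfl | rfl | rfl <;> simp only [GenClass.order_rot, GenClass.order_mk] <;>
      exact ⟨_, rfl⟩
  have h12 : GenClass.mk g₂ ∉ orbitList GenClass.rot (GenClass.mk g₁) := by
    intro h
    obtain ⟨x', hx'⟩ := hord1 _ h 0
    rw [GenClass.order_mk] at hx'
    have := hcop x' 0
    rw [← hx', Nat.coprime_self, orderOf_eq_one_iff] at this
    exact n₂ 0 this
  obtain ⟨U, V, hU, hV, ⟨i, j, hi, hj⟩, ⟨i', j', hi', hj'⟩, hUV⟩ :=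
    exists_arrangement (ρ := GenClass.rot) (v := fun l c x => (GenClass.order c x).factorization l)
      GenClass.rot_rot_rot (fun l c x => by simp only [GenClass.order_rot])
      (x₁ := GenClass.mk g₁) (x₂ := GenClass.mk g₂) (x₃ := GenClass.mk g₃)
      (by rwa [GenClass.rot_mk, ne_eq, GenClass.mk_eq_iff])
      (by rwa [GenClass.rot_mk, ne_eq, GenClass.mk_eq_iff])
      (by rwa [GenClass.rot_mk, ne_eq, GenClass.mk_eq_iff]) h12
      (by rw [hmem]; tauto) (by rw [hmem]; tauto)
      (fun l x x' => by
        simp only [GenClass.order_mk]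
        by_contra! hne
        have h1 := Nat.dvd_of_factorization_pos hne.1
        have h2 := Nat.dvd_of_factorization_pos hne.2
        have h3 := Nat.dvd_gcd h1 h2
        rw [hcop x x', Nat.dvd_one] at h3
        rw [h3] at hne
        simp at hne)
      (fun l x => by simpa only [GenClass.order_mk] using hdom l x) hk2 hkc
  have hyp : ∀ W : Fin k → GenClass H, ∀ i j, W i ∈ orbitList GenClass.rot (GenClass.mk g₁) →
      W j ∈ orbitList GenClass.rot (GenClass.mk g₂) → ∀ x, ∃ i j, (W i).order x ≠ 1 ∧
        (W j).order x ≠ 1 ∧ ((W i).order x).Coprime ((W j).order x) := by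
    intro W i j hi hj x
    obtain ⟨x₁, h₁⟩ := hord1 _ hi x
    obtain ⟨x₂, h₂⟩ := hord2 _ hj x
    refine ⟨i, j, ?_⟩
    rw [h₁, h₂, ne_eq, ne_eq, orderOf_eq_one_iff, orderOf_eq_one_iff]
    exact ⟨n₁ _, n₂ _, hcop _ _⟩
  exact hasBeauvilleStructure_of_classes hna U V hU hV (hyp U i j hi hj) (hyp V i' j' hi' hj')
    fun l _ x x' E => hUV l x x' E

end Assembly

section SpecialLinearThree

open Matrix Matrix.SpecialLinearGroup
open scoped commutatorElement

variable {F : Type*} [Field F]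

theorem SL3.diag2n_eq {i j : Fin 3} (hij : i ≠ j) {c : F} (hc : c ≠ 0) :
    diag2n hij c hc = transvection hij c * transvection hij.symm (-c⁻¹) * transvection hij c *
      (transvection hij (-1) * transvection hij.symm 1 * transvection hij (-1)) := by
  apply Subtype.ext
  simp only [diag2n_coe, Matrix.SpecialLinearGroup.coe_mul, transvection_coe, mul_add, add_mul, mul_one,
    one_mul, Matrix.single_mul_single_same, Matrix.single_mul_single_of_ne _ _ _ _ hij,
    Matrix.single_mul_single_of_ne _ _ _ _ hij.symm]
  ext a b
  fin_cases i <;> fin_cases j <;> first | exact absurd rfl hij | skip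
  all_goals
    fin_cases a <;> fin_cases b <;> simp [Matrix.one_apply, Matrix.single_apply, hc]

theorem SL3.eq_top_of_transvection_mem {K : Subgroup SL(3, F)}
    (hK : ∀ (i j : Fin 3) (hij : i ≠ j) (c : F), transvection hij c ∈ K) : K = ⊤ := by
  refine eq_top_iff.2 fun M _ ↦ diagonal_transvection_induction' (· ∈ K) M
    (fun i j hij c hc ↦ ?_) hK (fun _ _ ↦ K.mul_mem)
  rw [SL3.diag2n_eq]
  have := hK
  exact K.mul_mem (K.mul_mem (K.mul_mem (hK ..) (hK ..)) (hK ..))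
    (K.mul_mem (K.mul_mem (hK ..) (hK ..)) (hK ..))

theorem SL3.commutator_transvection {i j k : Fin 3} (hij : i ≠ j) (hjk : j ≠ k) (hik : i ≠ k)
    (a b : F) : ⁅transvection hij a, transvection hjk b⁆ = transvection hik (a * b) := by
  apply Subtype.ext
  simp only [commutatorElement_def, transvection_inv, Matrix.SpecialLinearGroup.coe_mul,
    transvection_coe, mul_add, add_mul, mul_one,
    one_mul, Matrix.single_mul_single_same, Matrix.single_mul_single_of_ne _ _ _ _ hij.symm,
    Matrix.single_mul_single_of_ne _ _ _ _ hik.symm,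
    Matrix.single_mul_single_of_ne _ _ _ _ hjk.symm, zero_mul, mul_zero]
  ext a b
  simp [Matrix.one_apply, Matrix.single_apply]
  grind

theorem SL3.isPerfect : Group.IsPerfect SL(3, F) := by
  refine ⟨SL3.eq_top_of_transvection_mem fun i j hij c ↦ ?_⟩
  obtain ⟨k, hik, hkj⟩ : ∃ k : Fin 3, i ≠ k ∧ k ≠ j := by
    revert i j; decide
  rw [show transvection hij c = ⁅transvection hik c, transvection hkj 1⁆ by
    rw [SL3.commutator_transvection hik hkj hij, mul_one]]
  exact Subgroup.commutator_mem_commutator trivial trivial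

open scoped LinearAlgebra.Projectivization

/-- The Iwasawa structure on the plane given by the transvection groups with a fixed centre. -/
noncomputable abbrev PSL3.iwasawa :
    MulAction.IwasawaStructure PSL(3, F) (ℙ F (Fin 3 → F)) where
  T := PSL.iwasawaT
  is_comm p := by
    have hSL : IsMulCommutative (lineStab (F := F) (ι := Fin 3) p.submodule) := by
      rw [← Projectivization.mk_rep p, Projectivization.submodule_mk]
      exact lineStab_isMulCommutative_of_span p.rep p.rep_nonzero
    exact Subgroup.map_isMulCommutative _ _
  is_conj g p := by
    obtain ⟨g_SL, rfl⟩ := QuotientGroup.mk_surjective g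
    rw [Matrix.ProjectiveSpecialLinearGroup.smul_proj_mk]
    change Subgroup.map _ _ = _
    rw [PSL.smul_submodule, Matrix.SpecialLinearGroup.lineStab_smul,
      PSL.iwasawaT_map_conj]
  is_generator := by
    have h : (⨆ p : ℙ F (Fin 3 → F), lineStab p.submodule) = (⊤ : Subgroup SL(3, F)) :=
      SL3.eq_top_of_transvection_mem fun i j hij c ↦ by
        have hm := SL2Gen.transvection_mem_lineStab hij c
        rw [← Projectivization.submodule_mk (K := F) _ (Pi.single_ne_zero_iff.2 one_ne_zero)] at hm
        exact Subgroup.mem_iSup_of_mem _ hm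
    have h' : iSup (PSL.iwasawaT (F := F) (ι := Fin 3)) =
        Subgroup.map (QuotientGroup.mk' (Subgroup.center SL(3, F)))
          (⨆ p : ℙ F (Fin 3 → F), lineStab p.submodule) := by
      rw [Subgroup.map_iSup]
    rw [h', h]
    exact Subgroup.map_top_of_surjective _ (QuotientGroup.mk'_surjective _)

theorem PSL3.isSimpleGroup : IsSimpleGroup PSL(3, F) := by
  have : Group.IsPerfect SL(3, F) := SL3.isPerfect
  have h : Group.IsPerfect PSL(3, F) := inferInstance
  exact MulAction.IwasawaStructure.isSimpleGroup h.commutator_eq_top PSL3.iwasawa inferInstance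

theorem PSL3.exists_mul_ne_mul : ∃ x y : PSL(3, F), x * y ≠ y * x := by
  have : Group.IsPerfect SL(3, F) := SL3.isPerfect
  have h : Group.IsPerfect PSL(3, F) := inferInstance
  by_contra! hc
  have hbot : commutator PSL(3, F) = ⊥ := by
    rw [commutator_def, Subgroup.commutator_eq_bot_iff_le_centralizer]
    exact fun x _ y _ ↦ hc _ _
  exact bot_ne_top (hbot.symm.trans h.commutator_eq_top)

end SpecialLinearThree

section Generation

open Matrix Matrix.SpecialLinearGroup
open scoped commutatorElement

variable {F : Type*} [Field F]

/-- The companion matrix of `X ^ 3 - γ X ^ 2 - β X - 1`. -/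
def SL3.companion (γ β : F) : SL(3, F) :=
  ⟨!![0, 0, 1; 1, 0, β; 0, 1, γ], by simp [Matrix.det_fin_three]⟩

/-- The companion matrix of `X ^ 3 - β X - ρ ^ 3`, rescaled to determinant one. -/
def SL3.scaledCompanion (β ρ : F) (hρ : ρ ≠ 0) : SL(3, F) :=
  ⟨!![0, 0, ρ ^ 2; ρ⁻¹, 0, ρ⁻¹ * β; 0, ρ⁻¹, 0], by simp [Matrix.det_fin_three]; field_simp⟩

/-- The transvection with entry `r` in position `(i, j)`. -/
abbrev SL3.tv (i j : Fin 3) (r : F) (hij : i ≠ j := by decide) : SL(3, F) := transvection hij r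

theorem SL3.tv_coe (i j : Fin 3) (r : F) (hij : i ≠ j) :
    (SL3.tv i j r hij : Matrix (Fin 3) (Fin 3) F) = 1 + single i j r := rfl

theorem SL3.companion_coe (γ β : F) :
    (SL3.companion γ β : Matrix (Fin 3) (Fin 3) F) = !![0, 0, 1; 1, 0, β; 0, 1, γ] := rfl

theorem SL3.scaledCompanion_coe (β ρ : F) (hρ : ρ ≠ 0) :
    (SL3.scaledCompanion β ρ hρ : Matrix (Fin 3) (Fin 3) F) =
      !![0, 0, ρ ^ 2; ρ⁻¹, 0, ρ⁻¹ * β; 0, ρ⁻¹, 0] := rfl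

theorem SL3.companion_mul_tv02 (γ β r : F) :
    SL3.companion γ β * SL3.tv 0 2 r = SL3.tv 1 0 r * SL3.companion γ β := by
  ext a b
  rw [Matrix.SpecialLinearGroup.coe_mul, Matrix.SpecialLinearGroup.coe_mul, SL3.tv_coe, SL3.tv_coe,
    SL3.companion_coe]
  fin_cases a <;> fin_cases b <;>
    simp [Matrix.mul_apply, Fin.sum_univ_three, Matrix.one_apply, Matrix.single_apply]

theorem SL3.companion_mul_tv12 (γ β r : F) :
    SL3.companion γ β * SL3.tv 1 2 r = SL3.tv 2 0 r * SL3.companion γ β := by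
  ext a b
  rw [Matrix.SpecialLinearGroup.coe_mul, Matrix.SpecialLinearGroup.coe_mul, SL3.tv_coe, SL3.tv_coe,
    SL3.companion_coe]
  fin_cases a <;> fin_cases b <;>
    simp [Matrix.mul_apply, Fin.sum_univ_three, Matrix.one_apply, Matrix.single_apply]

theorem SL3.companion_mul_tv10 (γ β r : F) :
    SL3.companion γ β * SL3.tv 1 0 r =
      SL3.tv 2 1 r * SL3.tv 2 0 (-(β * r)) * SL3.companion γ β := by
  ext a b
  rw [Matrix.SpecialLinearGroup.coe_mul, Matrix.SpecialLinearGroup.coe_mul,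
    Matrix.SpecialLinearGroup.coe_mul, SL3.tv_coe, SL3.tv_coe, SL3.tv_coe, SL3.companion_coe]
  fin_cases a <;> fin_cases b <;>
    simp [Matrix.mul_apply, Fin.sum_univ_three, Matrix.one_apply, Matrix.single_apply]
  all_goals ring

variable {K : Subgroup SL(3, F)} {γ β : F}

theorem SL3.tv02_mem_iff (hA : SL3.companion γ β ∈ K) (r : F) :
    SL3.tv 0 2 r ∈ K ↔ SL3.tv 1 0 r ∈ K := by
  rw [← K.mul_mem_cancel_left hA, SL3.companion_mul_tv02, K.mul_mem_cancel_right hA]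

theorem SL3.tv12_mem_iff (hA : SL3.companion γ β ∈ K) (r : F) :
    SL3.tv 1 2 r ∈ K ↔ SL3.tv 2 0 r ∈ K := by
  rw [← K.mul_mem_cancel_left hA, SL3.companion_mul_tv12, K.mul_mem_cancel_right hA]

theorem SL3.tv10_mem_iff (hA : SL3.companion γ β ∈ K) (r : F) :
    SL3.tv 1 0 r ∈ K ↔ SL3.tv 2 1 r * SL3.tv 2 0 (-(β * r)) ∈ K := by
  rw [← K.mul_mem_cancel_left hA, SL3.companion_mul_tv10, K.mul_mem_cancel_right hA]

theorem SL3.tv_mul_mem {i j k : Fin 3} (hij : i ≠ j) (hjk : j ≠ k) (hik : i ≠ k) {a b : F}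
    (ha : SL3.tv i j a hij ∈ K) (hb : SL3.tv j k b hjk ∈ K) : SL3.tv i k (a * b) hik ∈ K := by
  rw [SL3.tv, ← SL3.commutator_transvection hij hjk hik, commutatorElement_def]
  exact K.mul_mem (K.mul_mem (K.mul_mem ha hb) (K.inv_mem ha)) (K.inv_mem hb)

theorem SL3.tv_add_mem {i j : Fin 3} (hij : i ≠ j) {a b : F}
    (ha : SL3.tv i j a hij ∈ K) (hb : SL3.tv i j b hij ∈ K) : SL3.tv i j (a + b) hij ∈ K := by
  rw [SL3.tv, transvection_add]
  exact K.mul_mem ha hb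

theorem SL3.tv_neg_mem {i j : Fin 3} (hij : i ≠ j) {a : F}
    (ha : SL3.tv i j a hij ∈ K) : SL3.tv i j (-a) hij ∈ K := by
  rw [SL3.tv, ← transvection_inv]
  exact K.inv_mem ha

theorem SL3.eq_top_of_tv_mem (hA : SL3.companion γ β ∈ K) (hR : ∀ r : F, SL3.tv 1 0 r ∈ K) :
    K = ⊤ := by
  have h02 r : SL3.tv 0 2 r ∈ K := (SL3.tv02_mem_iff hA r).2 (hR r)
  have h12 r : SL3.tv 1 2 r ∈ K := by
    simpa using SL3.tv_mul_mem (by decide) (by decide) (by decide) (hR r) (h02 1)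
  have h20 r : SL3.tv 2 0 r ∈ K := (SL3.tv12_mem_iff hA r).1 (h12 r)
  have h21 r : SL3.tv 2 1 r ∈ K :=
    (K.mul_mem_cancel_right (h20 _)).1 ((SL3.tv10_mem_iff hA r).1 (hR r))
  have h01 r : SL3.tv 0 1 r ∈ K := by
    simpa using SL3.tv_mul_mem (by decide) (by decide) (by decide) (h02 r) (h21 1)
  refine SL3.eq_top_of_transvection_mem fun i j hij c ↦ ?_
  fin_cases i <;> fin_cases j <;> first | exact absurd rfl hij | skip
  exacts [h01 c, h02 c, hR c, h12 c, h20 c, h21 c]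

/-- The ring of multipliers of the root group in position `(2, 1)`. -/
def SL3.multipliers (K : Subgroup SL(3, F)) : Subring F where
  carrier := {s | ∀ r : F, SL3.tv 1 0 r ∈ K → SL3.tv 1 0 (s * r) ∈ K}
  mul_mem' ha hb r hr := by rw [mul_assoc]; exact ha _ (hb _ hr)
  one_mem' r hr := by rwa [one_mul]
  add_mem' ha hb r hr := by rw [add_mul]; exact SL3.tv_add_mem _ (ha _ hr) (hb _ hr)
  zero_mem' r hr := by rw [zero_mul, SL3.tv, transvection_coeff_zero]; exact K.one_mem
  neg_mem' ha r hr := by rw [neg_mul]; exact SL3.tv_neg_mem _ (ha _ hr)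

theorem Subring.inv_mem_of_finite [Finite F] (S : Subring F) {s : F} (hs : s ∈ S) : s⁻¹ ∈ S := by
  have := Fintype.ofFinite F
  rcases eq_or_ne s 0 with rfl | h
  · simp
  · have h1 : 1 < Fintype.card F := Fintype.one_lt_card
    have : s⁻¹ = s ^ (Fintype.card F - 2) := by
      refine (eq_inv_of_mul_eq_one_left ?_).symm
      rw [← pow_succ, show Fintype.card F - 2 + 1 = Fintype.card F - 1 by omega,
        FiniteField.pow_card_sub_one_eq_one s h]
    rw [this]
    exact S.pow_mem hs _

theorem SL3.tv12_mul_mem (hA : SL3.companion γ β ∈ K) {a b : F} (ha : SL3.tv 1 0 a ∈ K)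
    (hb : SL3.tv 1 0 b ∈ K) : SL3.tv 1 2 (a * b) ∈ K :=
  SL3.tv_mul_mem (by decide) (by decide) (by decide) ha ((SL3.tv02_mem_iff hA b).2 hb)

theorem SL3.tv10_mul_mem (hA : SL3.companion γ β ∈ K) {a b : F} (ha : SL3.tv 1 2 a ∈ K)
    (hb : SL3.tv 1 2 b ∈ K) : SL3.tv 1 0 (a * b) ∈ K :=
  SL3.tv_mul_mem (by decide) (by decide) (by decide) ha ((SL3.tv12_mem_iff hA b).1 hb)

theorem SL3.mul_mem_multipliers (hA : SL3.companion γ β ∈ K) {a b c : F}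
    (ha : SL3.tv 1 0 a ∈ K) (hb : SL3.tv 1 0 b ∈ K) (hc : SL3.tv 1 0 c ∈ K) :
    a * b * c ∈ SL3.multipliers K := fun r hr ↦ by
  rw [mul_assoc (a * b)]
  exact SL3.tv10_mul_mem hA (SL3.tv12_mul_mem hA ha hb) (SL3.tv12_mul_mem hA hc hr)

theorem SL3.mul_mem_multipliers' (hA : SL3.companion γ β ∈ K) {a b : F}
    (ha : SL3.tv 1 2 a ∈ K) (hb : SL3.tv 1 0 b ∈ K) :
    a * b ∈ SL3.multipliers K := fun r hr ↦ by
  rw [mul_assoc a]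
  exact SL3.tv10_mul_mem hA ha (SL3.tv12_mul_mem hA hb hr)

theorem SL3.eq_top_of_multipliers (hA : SL3.companion γ β ∈ K) {v : F} (hv0 : v ≠ 0)
    (hv : SL3.tv 1 0 v ∈ K) (h : SL3.multipliers K = ⊤) : K = ⊤ :=
  SL3.eq_top_of_tv_mem hA fun r ↦ by
    have : r * v⁻¹ ∈ SL3.multipliers K := h ▸ Subring.mem_top _
    simpa [hv0] using this v hv

theorem SL3.torus_eq {s v : F} (hs : s ≠ 0) (hv : v ≠ 0) :
    diag2n (show (0 : Fin 3) ≠ 2 by decide) s hs =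
      SL3.tv 0 2 (s * v) * SL3.tv 2 0 (-(s * v)⁻¹) * SL3.tv 0 2 (s * v) *
        (SL3.tv 0 2 (-v) * SL3.tv 2 0 v⁻¹ * SL3.tv 0 2 (-v)) := by
  apply Subtype.ext
  simp only [diag2n_coe, Matrix.SpecialLinearGroup.coe_mul, SL3.tv_coe, mul_add, add_mul, mul_one,
    one_mul, Matrix.single_mul_single_same]
  ext a b
  fin_cases a <;> fin_cases b <;> simp [Matrix.one_apply, Matrix.single_apply] <;> field_simp <;>
    ring

theorem SL3.torus_mul {s : F} (hs : s ≠ 0) (r β : F) :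
    diag2n (show (0 : Fin 3) ≠ 2 by decide) s hs * (SL3.tv 2 1 r * SL3.tv 2 0 (-(β * r))) =
      SL3.tv 2 0 (β * r * s⁻¹ * (1 - s⁻¹)) *
        (SL3.tv 2 1 (s⁻¹ * r) * SL3.tv 2 0 (-(β * (s⁻¹ * r)))) *
        diag2n (show (0 : Fin 3) ≠ 2 by decide) s hs := by
  apply Subtype.ext
  simp only [diag2n_coe, Matrix.SpecialLinearGroup.coe_mul, SL3.tv_coe]
  ext a b
  fin_cases a <;> fin_cases b <;>
    simp [Matrix.mul_apply, Fin.sum_univ_three, Matrix.one_apply, Matrix.single_apply,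
      Matrix.diagonal_apply]
  all_goals field_simp
  all_goals ring

/-- A transvection together with a companion matrix of nonzero `β` generates, provided that the
parameter of the transvection generates the field. -/
theorem SL3.eq_top_of_tv02_mem [Finite F] (hA : SL3.companion γ β ∈ K) {v : F} (hv0 : v ≠ 0)
    (hv : SL3.tv 0 2 v ∈ K) (hβ : ∀ S : Subring F, β ∈ S)
    (hgen : ∀ S : Subring F, v ∈ S → S = ⊤)
    (hp : (∀ S : Subring F, v ^ 3 ∈ S → v ∈ S) ∨ (β ≠ 0 ∧ (v ^ 3 ≠ 1 ∨ (2 : F) ≠ 0))) :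
    K = ⊤ := by
  have hv' : SL3.tv 1 0 v ∈ K := (SL3.tv02_mem_iff hA v).1 hv
  have hv3 : v ^ 3 ∈ SL3.multipliers K := by
    convert SL3.mul_mem_multipliers hA hv' hv' hv' using 1; ring
  refine SL3.eq_top_of_multipliers hA hv0 hv' (hgen _ ?_)
  rcases hp with hp | ⟨hβ0, hp⟩
  · exact hp _ hv3
  obtain ⟨s, hs, hs0, hs1⟩ : ∃ s ∈ SL3.multipliers K, s ≠ 0 ∧ s ≠ 1 := by
    rcases hp with hp | hp
    · exact ⟨_, hv3, pow_ne_zero _ hv0, hp⟩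
    · refine ⟨-1, neg_mem (one_mem _), by simp, fun h ↦ hp ?_⟩
      linear_combination -h
  have hsi : s⁻¹ ∈ SL3.multipliers K := Subring.inv_mem_of_finite _ hs
  have h02 {a : F} (ha : a ∈ SL3.multipliers K) : SL3.tv 0 2 (a * v) ∈ K :=
    (SL3.tv02_mem_iff hA _).2 (ha v hv')
  have h20 {a : F} (ha : a ∈ SL3.multipliers K) : SL3.tv 2 0 (a * v⁻¹) ∈ K := by
    rw [← SL3.tv12_mem_iff hA]
    have h3 : (v ^ 3)⁻¹ * a ∈ SL3.multipliers K :=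
      mul_mem (Subring.inv_mem_of_finite _ hv3) ha
    convert SL3.tv12_mul_mem hA (h3 v hv') hv' using 2
    field_simp
  have hD : diag2n (show (0 : Fin 3) ≠ 2 by decide) s hs0 ∈ K := by
    rw [SL3.torus_eq hs0 hv0]
    have e1 := h02 (neg_mem (one_mem _))
    have e2 := h20 (one_mem _)
    have e3 := h20 (neg_mem hsi)
    rw [neg_one_mul] at e1
    rw [one_mul] at e2
    rw [show -s⁻¹ * v⁻¹ = -(s * v)⁻¹ by rw [mul_inv, neg_mul]] at e3
    exact K.mul_mem (K.mul_mem (K.mul_mem (h02 hs) e3) (h02 hs)) (K.mul_mem (K.mul_mem e1 e2) e1)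
  have hu := K.mul_mem hD ((SL3.tv10_mem_iff hA v).1 hv')
  rw [SL3.torus_mul, K.mul_mem_cancel_right hD,
    K.mul_mem_cancel_right ((SL3.tv10_mem_iff hA _).1 (hsi v hv')), ← SL3.tv12_mem_iff hA] at hu
  have h1 := SL3.mul_mem_multipliers' hA hu hv'
  have hc : β * s⁻¹ * (1 - s⁻¹) ≠ 0 := by
    refine mul_ne_zero (mul_ne_zero hβ0 (inv_ne_zero hs0)) (sub_ne_zero.2 fun h ↦ hs1 ?_)
    exact (inv_eq_one.1 h.symm)
  have h2 : v ^ 2 ∈ SL3.multipliers K := by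
    have := mul_mem h1 (Subring.inv_mem_of_finite _
      (mul_mem (mul_mem (hβ (SL3.multipliers K)) hsi) (sub_mem (one_mem _) hsi)))
    convert this using 1
    field_simp
  have := mul_mem hv3 (Subring.inv_mem_of_finite _ h2)
  convert this using 1
  field_simp

theorem SL3.homology_mul_tv {ρ : F} (hρ : ρ ≠ 0) {h : SL(3, F)}
    (hh : (h : Matrix (Fin 3) (Fin 3) F) = !![ρ ^ 2, 0, 0; 0, ρ⁻¹, 0; 0, 0, ρ⁻¹]) (r : F) :
    SL3.tv 1 0 r * h = h * SL3.tv 1 0 (ρ ^ 3 * r) := by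
  ext a b
  rw [Matrix.SpecialLinearGroup.coe_mul, Matrix.SpecialLinearGroup.coe_mul, SL3.tv_coe, SL3.tv_coe,
    hh]
  fin_cases a <;> fin_cases b <;>
    simp [Matrix.mul_apply, Fin.sum_univ_three, Matrix.one_apply, Matrix.single_apply]
  all_goals field_simp

theorem SL3.companion_generate [Finite F] (hA : SL3.companion 0 β ∈ K) {ρ : F} (hρ : ρ ≠ 0)
    (hB : SL3.scaledCompanion β ρ hρ ∈ K) (hβ0 : β ≠ 0) (hμ : ρ ^ 3 ≠ 1)
    (hgen : ∀ S : Subring F, ρ ^ 3 ∈ S → β ^ 3 ∈ S → S = ⊤) : K = ⊤ := by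
  set A := SL3.companion 0 β
  set B := SL3.scaledCompanion β ρ hρ
  let h : SL(3, F) := ⟨!![ρ ^ 2, 0, 0; 0, ρ⁻¹, 0; 0, 0, ρ⁻¹], by
    simp [Matrix.det_fin_three]; field_simp⟩
  have hh : (h : Matrix (Fin 3) (Fin 3) F) = !![ρ ^ 2, 0, 0; 0, ρ⁻¹, 0; 0, 0, ρ⁻¹] := rfl
  have hhA : h * A = B := by
    ext a b
    rw [Matrix.SpecialLinearGroup.coe_mul, hh, SL3.companion_coe, SL3.scaledCompanion_coe]
    fin_cases a <;> fin_cases b <;> simp [Matrix.mul_apply, Fin.sum_univ_three]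
  have hhK : h ∈ K := by rwa [← K.mul_mem_cancel_right hA, hhA]
  have hmul {r : F} (hr : SL3.tv 1 0 r ∈ K) : SL3.tv 1 0 (ρ ^ 3 * r) ∈ K := by
    rwa [← K.mul_mem_cancel_left hhK, ← SL3.homology_mul_tv hρ hh, K.mul_mem_cancel_right hhK]
  have hμm : ρ ^ 3 ∈ SL3.multipliers K := fun r hr ↦ hmul hr
  let g : SL(3, F) := ⟨!![ρ⁻¹, 0, 0; ρ⁻¹ * (β * (1 - ρ ^ 3)), ρ ^ 2, 0; 0, 0, ρ⁻¹], by
    simp [Matrix.det_fin_three]; field_simp⟩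
  have hg : (g : Matrix (Fin 3) (Fin 3) F) =
    !![ρ⁻¹, 0, 0; ρ⁻¹ * (β * (1 - ρ ^ 3)), ρ ^ 2, 0; 0, 0, ρ⁻¹] := rfl
  have hgA : g * A = A * h := by
    ext a b
    rw [Matrix.SpecialLinearGroup.coe_mul, Matrix.SpecialLinearGroup.coe_mul, hh, hg,
      SL3.companion_coe]
    fin_cases a <;> fin_cases b <;> simp [Matrix.mul_apply, Fin.sum_univ_three]
    all_goals field_simp
    all_goals ring
  have hgK : g ∈ K := by
    rw [← K.mul_mem_cancel_right hA, hgA]; exact K.mul_mem hA hhK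
  set c : F := (1 - ρ ^ 3) * ((ρ ^ 3)⁻¹ - 1) with hc
  have hcomm : h * g = SL3.tv 1 0 (β * c) * (g * h) := by
    ext a b
    simp only [Matrix.SpecialLinearGroup.coe_mul, hh, hg, SL3.tv_coe]
    fin_cases a <;> fin_cases b <;>
      simp [Matrix.mul_apply, Fin.sum_univ_three, Matrix.one_apply, Matrix.single_apply]
    all_goals try simp only [hc]
    all_goals field_simp
    all_goals ring
  have hvK : SL3.tv 1 0 (β * c) ∈ K := by
    rw [← K.mul_mem_cancel_right (K.mul_mem hgK hhK), ← hcomm]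
    exact K.mul_mem hhK hgK
  have hc0 : c ≠ 0 := mul_ne_zero (sub_ne_zero.2 hμ.symm)
    (sub_ne_zero.2 fun h ↦ hμ (inv_eq_one.1 h))
  have hcm : c ∈ SL3.multipliers K := mul_mem (sub_mem (one_mem _) hμm)
    (sub_mem (Subring.inv_mem_of_finite _ hμm) (one_mem _))
  refine SL3.eq_top_of_multipliers hA (mul_ne_zero hβ0 hc0) hvK (hgen _ hμm ?_)
  have := mul_mem (SL3.mul_mem_multipliers hA hvK hvK hvK)
    (Subring.inv_mem_of_finite _ (pow_mem hcm 3))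
  convert this using 1
  field_simp

end Generation

section Orders

open Polynomial

variable {F : Type*} [Field F] [Fintype F]

theorem AdjoinRoot.root_pow_eq_one_of_cubic {f : F[X]} (hf : Irreducible f) (hm : f.Monic)
    (hd : f.natDegree = 3) (h0 : f.coeff 0 = -1) :
    AdjoinRoot.root f ^ (Fintype.card F ^ 2 + Fintype.card F + 1) = 1 := by
  have : Fact (Irreducible f) := ⟨hf⟩
  have : Module.Finite F (AdjoinRoot f) := (AdjoinRoot.powerBasis hm.ne_zero).finite
  have : Finite (AdjoinRoot f) := Module.finite_of_finite F
  have hcard : Nat.card (AdjoinRoot f) = Nat.card F ^ 3 := by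
    rw [Module.natCard_eq_pow_finrank (K := F), (AdjoinRoot.powerBasis hm.ne_zero).finrank,
      AdjoinRoot.powerBasis_dim, hd]
  have hn := FiniteField.algebraMap_norm_eq_pow (K := F) (K' := AdjoinRoot f)
    (x := AdjoinRoot.root f)
  rw [hcard, Nat.card_eq_fintype_card] at hn
  have hnorm : Algebra.norm F (AdjoinRoot.root f) = 1 := by
    have := Algebra.PowerBasis.norm_gen_eq_coeff_zero_minpoly (AdjoinRoot.powerBasis hm.ne_zero)
    rw [AdjoinRoot.minpoly_powerBasis_gen_of_monic hm, AdjoinRoot.powerBasis_dim, hd, h0,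
      AdjoinRoot.powerBasis_gen] at this
    rw [this]; norm_num
  have hq : 1 < Fintype.card F := Fintype.one_lt_card
  have hdiv : (Fintype.card F ^ 3 - 1) / (Fintype.card F - 1) =
      Fintype.card F ^ 2 + Fintype.card F + 1 := by
    refine Nat.div_eq_of_eq_mul_left (by omega) ?_
    zify [Nat.one_le_pow 3 _ (by omega : 0 < Fintype.card F), hq.le]
    ring
  rw [hdiv, hnorm, map_one] at hn
  exact hn.symm

theorem Nat.coprime_sq_sub_one {n q : ℕ} (hq : 1 < q) (h1 : n.Coprime (q - 1))
    (h2 : n ∣ q ^ 2 + q + 1) : n.Coprime q ∧ n.Coprime (q ^ 2 - 1) := by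
  have e : q ^ 2 - 1 = (q - 1) * (q + 1) := by
    zify [Nat.one_le_pow 2 _ (by omega : 0 < q), hq.le]; ring
  refine ⟨Nat.Coprime.coprime_dvd_left h2 ?_, e ▸ h1.mul_right (Nat.Coprime.coprime_dvd_left h2 ?_)⟩
  · rw [show q ^ 2 + q + 1 = 1 + q * (q + 1) by ring]; simp
  · rw [show q ^ 2 + q + 1 = 1 + q * (q + 1) by ring]; simp

theorem Nat.gcd_sq_add_add_one (q : ℕ) (hq : 1 < q) : (q ^ 2 + q + 1).Coprime (q - 1) ∨
    (3 ∣ q - 1 ∧ 3 ∣ q ^ 2 + q + 1 ∧ ((q ^ 2 + q + 1) / 3).Coprime (q - 1)) := by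
  obtain ⟨r, rfl⟩ : ∃ r, q = r + 1 := ⟨q - 1, by omega⟩
  have e : (r + 1) ^ 2 + (r + 1) + 1 = 3 + r * (r + 3) := by ring
  rw [e, Nat.add_sub_cancel]
  by_cases h : 3 ∣ r
  · right
    obtain ⟨s, rfl⟩ := h
    refine ⟨⟨s, rfl⟩, ⟨1 + s * (3 * s + 3), by ring⟩, ?_⟩
    rw [show 3 + 3 * s * (3 * s + 3) = 3 * (1 + 3 * s * (s + 1)) by ring,
      Nat.mul_div_cancel_left _ (by norm_num)]
    simp
  · left
    rw [Nat.coprime_add_mul_left_left]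
    exact (Nat.Prime.coprime_iff_not_dvd Nat.prime_three).2 h

theorem exists_pow_dvd_of_cubic {f : F[X]} (hf : Irreducible f) (hm : f.Monic)
    (hd : f.natDegree = 3) (h0 : f.coeff 0 = -1) :
    ∃ (m : ℕ) (c : F), m.Coprime (Fintype.card F) ∧ m.Coprime (Fintype.card F ^ 2 - 1) ∧
      f ∣ X ^ m - C c := by
  have hq : 1 < Fintype.card F := Fintype.one_lt_card
  have hroot := AdjoinRoot.root_pow_eq_one_of_cubic hf hm hd h0
  have : Fact (Irreducible f) := ⟨hf⟩
  have key (m : ℕ) (c : F) (h : AdjoinRoot.root f ^ m = AdjoinRoot.of f c) : f ∣ X ^ m - C c := by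
    rw [← AdjoinRoot.mk_eq_zero]
    simp [h]
  rcases Nat.gcd_sq_add_add_one _ hq with h | ⟨h3, h3', h⟩
  · exact ⟨_, 1, (Nat.coprime_sq_sub_one hq h dvd_rfl).1, (Nat.coprime_sq_sub_one hq h dvd_rfl).2,
      key _ _ (by simpa using hroot)⟩
  · have hdvd : (Fintype.card F ^ 2 + Fintype.card F + 1) / 3 ∣
        Fintype.card F ^ 2 + Fintype.card F + 1 := Nat.div_dvd_of_dvd h3'
    have h2 := Nat.coprime_sq_sub_one hq h hdvd
    set m := (Fintype.card F ^ 2 + Fintype.card F + 1) / 3 with hmdef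
    have hcube : (AdjoinRoot.root f ^ m) ^ 3 = 1 := by
      rw [← pow_mul, hmdef, Nat.div_mul_cancel h3', hroot]
    obtain ⟨ω, hω⟩ : ∃ ω : Fˣ, orderOf ω = 3 := by
      have : Fact (Nat.Prime 3) := ⟨Nat.prime_three⟩
      refine exists_prime_orderOf_dvd_card' 3 ?_
      rwa [Nat.card_units, Nat.card_eq_fintype_card]
    have hω1 : (ω : F) ≠ 1 := fun h ↦ by
      rw [Units.val_eq_one.1 h, orderOf_one] at hω; omega
    have hω3 : (ω : F) ^ 3 = 1 := by
      rw [← Units.val_pow_eq_pow_val, ← hω, pow_orderOf_eq_one, Units.val_one]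
    have hω2 : (ω : F) ^ 2 + ω + 1 = 0 := by
      have : ((ω : F) - 1) * ((ω : F) ^ 2 + ω + 1) = 0 := by linear_combination hω3
      exact (mul_eq_zero.1 this).resolve_left (sub_ne_zero.2 hω1)
    have hω2' : (AdjoinRoot.of f ω) ^ 2 + AdjoinRoot.of f ω + 1 = 0 := by
      rw [← map_pow, ← map_add, ← map_one (AdjoinRoot.of f), ← map_add, hω2, map_zero]
    have hprod : (AdjoinRoot.root f ^ m - 1) * ((AdjoinRoot.root f ^ m - AdjoinRoot.of f ω) *
        (AdjoinRoot.root f ^ m + 1 + AdjoinRoot.of f ω)) = 0 := by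
      set x := AdjoinRoot.root f ^ m
      linear_combination hcube - (x - 1) * hω2'
    rcases mul_eq_zero.1 hprod with h | h
    · exact ⟨m, 1, h2.1, h2.2, key _ _ (by rw [map_one]; exact sub_eq_zero.1 h)⟩
    rcases mul_eq_zero.1 h with h | h
    · exact ⟨m, ω, h2.1, h2.2, key _ _ (sub_eq_zero.1 h)⟩
    · refine ⟨m, -1 - ω, h2.1, h2.2, key _ _ ?_⟩
      rw [map_sub, map_neg, map_one]
      linear_combination h

/-- A quadratic with nonzero discriminant over a finite field divides `X ^ (q ^ 2 - 1) - 1`. -/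
theorem quadratic_dvd_pow_sub_one {s t : F} (ht : t ≠ 0) (hdisc : s ^ 2 ≠ 4 * t) :
    (X ^ 2 + C s * X + C t : F[X]) ∣ X ^ (Fintype.card F ^ 2 - 1) - 1 := by
  have hq : 1 < Fintype.card F := Fintype.one_lt_card
  set g : F[X] := X ^ 2 + C s * X + C t with hg
  have hm : g.Monic := by rw [hg]; monicity!
  have hd : g.natDegree = 2 := by rw [hg]; compute_degree!
  by_cases hroot : ∃ r, g.IsRoot r
  · obtain ⟨r, hr⟩ := hroot
    have hr' : r ^ 2 + s * r + t = 0 := by simpa [hg] using hr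
    have hfac : g = (X - C r) * (X - C (-s - r)) := by
      rw [hg, show t = r * (-s - r) by linear_combination hr']
      simp only [map_mul, map_sub, map_neg]
      ring
    have hne : r ≠ -s - r := fun h ↦ hdisc (by linear_combination (s + 2 * r) * h - 4 * hr')
    have hpow (x : F) (hx : x ≠ 0) : (X - C x) ∣ (X ^ (Fintype.card F ^ 2 - 1) - 1 : F[X]) := by
      rw [dvd_iff_isRoot]
      simp only [IsRoot, eval_sub, eval_pow, eval_X, eval_one]
      have : Fintype.card F ^ 2 - 1 = (Fintype.card F - 1) * (Fintype.card F + 1) := by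
        zify [Nat.one_le_pow 2 _ (by omega : 0 < Fintype.card F), hq.le]; ring
      rw [this, pow_mul, FiniteField.pow_card_sub_one_eq_one x hx, one_pow, sub_self]
    rw [hfac]
    refine (isCoprime_X_sub_C_of_isUnit_sub (sub_ne_zero.2 hne).isUnit).mul_dvd
      (hpow _ ?_) (hpow _ ?_)
    · rintro rfl; simp at hr'; exact ht hr'
    · intro h; exact ht (by linear_combination hr' + r * h)
  · have hirr : Irreducible g := by
      rw [hm.irreducible_iff_roots_eq_zero_of_degree_le_three (by omega) (by omega)]
      refine Multiset.eq_zero_of_forall_notMem fun r hr ↦ hroot ⟨r, ?_⟩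
      exact isRoot_of_mem_roots hr
    have : Fact (Irreducible g) := ⟨hirr⟩
    have : Module.Finite F (AdjoinRoot g) := (AdjoinRoot.powerBasis hm.ne_zero).finite
    have : Finite (AdjoinRoot g) := Module.finite_of_finite F
    have := Fintype.ofFinite (AdjoinRoot g)
    have hcard : Fintype.card (AdjoinRoot g) = Fintype.card F ^ 2 := by
      rw [← Nat.card_eq_fintype_card, ← Nat.card_eq_fintype_card,
        Module.natCard_eq_pow_finrank (K := F), (AdjoinRoot.powerBasis hm.ne_zero).finrank,
        AdjoinRoot.powerBasis_dim, hd]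
    rw [← AdjoinRoot.mk_eq_zero, map_sub, map_pow, AdjoinRoot.mk_X, map_one, ← hcard, sub_eq_zero]
    refine FiniteField.pow_card_sub_one_eq_one _ fun h ↦ ?_
    have h1 : AdjoinRoot.mk g (X ^ 2 + C s * X + C t) = 0 := AdjoinRoot.mk_self
    simp only [map_add, map_mul, map_pow, AdjoinRoot.mk_X, h, AdjoinRoot.mk_C] at h1
    simp only [ne_eq, OfNat.ofNat_ne_zero, not_false_eq_true, zero_pow, mul_zero, zero_add,
      map_eq_zero] at h1
    exact ht h1

theorem cubic_dvd_pow_sub_one {a : F} (ha : a ≠ 0) (h4 : a ^ 3 ≠ 4) (h2 : 2 * a ^ 3 ≠ -1) :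
    (X ^ 3 - C (a ^ 2 - a⁻¹) * X - 1 : F[X]) ∣ X ^ (Fintype.card F ^ 2 - 1) - 1 := by
  have hq : 1 < Fintype.card F := Fintype.one_lt_card
  have hfac : (X ^ 3 - C (a ^ 2 - a⁻¹) * X - 1 : F[X]) =
      (X - C a) * (X ^ 2 + C a * X + C a⁻¹) := by
    have : C a * C a⁻¹ = (1 : F[X]) := by rw [← C_mul, mul_inv_cancel₀ ha, C_1]
    simp only [map_sub, map_pow]
    linear_combination this
  rw [hfac]
  refine IsCoprime.mul_dvd ?_ ?_ (quadratic_dvd_pow_sub_one (inv_ne_zero ha) fun h ↦ h4 ?_)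
  · have : (X ^ 2 + C a * X + C a⁻¹ : F[X]) =
        (X - C a) * (X + C (2 * a)) + C (2 * a ^ 2 + a⁻¹) := by
      simp only [map_add, map_mul, map_pow, map_ofNat]; ring
    rw [this, add_comm, IsCoprime.add_mul_left_right_iff]
    refine isCoprime_one_right.of_isCoprime_of_dvd_right (IsUnit.dvd ?_)
    rw [isUnit_C, isUnit_iff_ne_zero]
    intro h
    apply h2
    field_simp at h
    linear_combination h
  · rw [dvd_iff_isRoot]
    simp only [IsRoot, eval_sub, eval_pow, eval_X, eval_one]
    have : Fintype.card F ^ 2 - 1 = (Fintype.card F - 1) * (Fintype.card F + 1) := by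
      zify [Nat.one_le_pow 2 _ (by omega : 0 < Fintype.card F), hq.le]; ring
    rw [this, pow_mul, FiniteField.pow_card_sub_one_eq_one a ha, one_pow, sub_self]
  · field_simp at h
    linear_combination h

end Orders

section Projective

open Matrix

variable {F : Type*} [Field F]

/-- The projection from the special linear group. -/
abbrev PSL3.proj : SL(3, F) →* PSL(3, F) := QuotientGroup.mk' _

theorem PSL3.proj_surjective : Function.Surjective (PSL3.proj (F := F)) :=
  QuotientGroup.mk'_surjective _

theorem PSL3.proj_eq_one_iff {M : SL(3, F)} : PSL3.proj M = 1 ↔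
    ∃ r : F, r ^ 3 = 1 ∧ scalar (Fin 3) r = (M : Matrix (Fin 3) (Fin 3) F) := by
  rw [QuotientGroup.mk'_apply, QuotientGroup.eq_one_iff, Matrix.SpecialLinearGroup.mem_center_iff,
    Fintype.card_fin]

theorem PSL3.proj_ne_one {M : SL(3, F)} {i j : Fin 3} (hij : i ≠ j) (h : M i j ≠ 0) :
    PSL3.proj M ≠ 1 := by
  rw [Ne, PSL3.proj_eq_one_iff]
  rintro ⟨r, -, hr⟩
  rw [← hr] at h
  simp [hij] at h

theorem PSL3.proj_pow_eq_one {M : SL(3, F)} {n : ℕ} {c : F}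
    (h : (M : Matrix (Fin 3) (Fin 3) F) ^ n = scalar (Fin 3) c) : PSL3.proj M ^ n = 1 := by
  rw [← map_pow, QuotientGroup.mk'_apply, QuotientGroup.eq_one_iff, Subgroup.mem_center_iff]
  intro X
  apply Subtype.ext
  rw [Matrix.SpecialLinearGroup.coe_mul, Matrix.SpecialLinearGroup.coe_mul,
    Matrix.SpecialLinearGroup.coe_pow, h]
  exact ((scalar_commute c (fun _ ↦ Commute.all _ _) _).eq).symm

theorem PSL3.exists_smul_of_commute {M X : SL(3, F)}
    (h : Commute (PSL3.proj M) (PSL3.proj X)) : ∃ r : F, r ^ 3 = 1 ∧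
      (X * M : Matrix (Fin 3) (Fin 3) F) = r • (M * X : Matrix (Fin 3) (Fin 3) F) := by
  have h1 : PSL3.proj ((M * X)⁻¹ * (X * M)) = 1 := by
    rw [map_mul, map_inv, map_mul, map_mul, h.eq, inv_mul_cancel]
  obtain ⟨r, hr, hs⟩ := PSL3.proj_eq_one_iff.1 h1
  refine ⟨r, hr, ?_⟩
  have : X * M = (M * X) * ((M * X)⁻¹ * (X * M)) := by rw [mul_inv_cancel_left]
  rw [← Matrix.SpecialLinearGroup.coe_mul, this, Matrix.SpecialLinearGroup.coe_mul, ← hs,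
    Matrix.SpecialLinearGroup.coe_mul, Matrix.scalar_apply, ← Matrix.smul_one_eq_diagonal,
    Matrix.mul_smul, mul_one]

theorem PSL3.not_commute {M X : SL(3, F)} {i : Fin 3}
    (h1 : (X * M : Matrix (Fin 3) (Fin 3) F) i i = 1)
    (h2 : (M * X : Matrix (Fin 3) (Fin 3) F) i i = 1)
    (h : (X * M : Matrix (Fin 3) (Fin 3) F) ≠ M * X) :
    ¬ Commute (PSL3.proj M) (PSL3.proj X) := fun hc ↦ by
  obtain ⟨r, -, hr⟩ := PSL3.exists_smul_of_commute hc
  have := congr_fun (congr_fun hr i) i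
  rw [Matrix.smul_apply, h1, h2, smul_eq_mul, mul_one] at this
  rw [← this, one_smul] at hr
  exact h hr

theorem PSL3.commute_of_trace_ne_zero {M X : SL(3, F)}
    (ht : (M : Matrix (Fin 3) (Fin 3) F).trace ≠ 0)
    (h : Commute (PSL3.proj M) (PSL3.proj X)) : Commute M X := by
  obtain ⟨r, -, hr⟩ := PSL3.exists_smul_of_commute h
  have h1 : (X⁻¹ * (X * M) : SL(3, F)) = M := inv_mul_cancel_left _ _
  have h2 := congr_arg (fun A ↦ ((X⁻¹ : SL(3, F)) : Matrix (Fin 3) (Fin 3) F) * A) hr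
  beta_reduce at h2
  rw [← Matrix.SpecialLinearGroup.coe_mul, ← Matrix.SpecialLinearGroup.coe_mul, h1,
    Matrix.mul_smul] at h2
  have h3 := congr_arg Matrix.trace h2
  rw [Matrix.trace_smul, Matrix.trace_mul_comm, mul_assoc, ← Matrix.SpecialLinearGroup.coe_mul,
    mul_inv_cancel, Matrix.SpecialLinearGroup.coe_one, mul_one, smul_eq_mul] at h3
  have hr1 : r = 1 := by
    have : (r - 1) * (M : Matrix (Fin 3) (Fin 3) F).trace = 0 := by linear_combination -h3
    exact sub_eq_zero.1 ((mul_eq_zero.1 this).resolve_right ht)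
  rw [hr1, one_smul] at hr
  exact Subtype.ext hr.symm

theorem PSL3.commute_of_three_eq_zero {M X : SL(3, F)} (h3 : (3 : F) = 0)
    (h : Commute (PSL3.proj M) (PSL3.proj X)) : Commute M X := by
  obtain ⟨r, hr3, hr⟩ := PSL3.exists_smul_of_commute h
  have hr1 : r = 1 := by
    have : (r - 1) ^ 3 = 0 := by linear_combination hr3 + (r - r ^ 2) * h3
    exact sub_eq_zero.1 (pow_eq_zero_iff (by norm_num) |>.1 this)
  rw [hr1, one_smul] at hr
  exact Subtype.ext hr.symm

/-- The centralizer of `g` is abelian. -/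
def HasAbelianCentralizer {G : Type*} [Group G] (g : G) : Prop :=
  ∀ x y, Commute g x → Commute g y → Commute x y

theorem HasAbelianCentralizer.map {G : Type*} [Group G] {g : G} (h : HasAbelianCentralizer g)
    (α : MulAut G) : HasAbelianCentralizer (α g) := fun x y hx hy ↦ by
  have h1 := h (α⁻¹ x) (α⁻¹ y) (by simpa using hx.map (α⁻¹ : MulAut G))
    (by simpa using hy.map (α⁻¹ : MulAut G))
  simpa using h1.map α

theorem HasAbelianCentralizer.inv {G : Type*} [Group G] {g : G} (h : HasAbelianCentralizer g) :
    HasAbelianCentralizer g⁻¹ := fun x y hx hy ↦ h x y (by simpa using hx.inv_left)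
      (by simpa using hy.inv_left)

theorem SL3.commute_of_commute_companion {γ β : F} {X Y : SL(3, F)}
    (hX : Commute (SL3.companion γ β) X) (hY : Commute (SL3.companion γ β) Y) : Commute X Y := by
  have key (X : SL(3, F)) (hX : Commute (SL3.companion γ β) X) :
      ∃ a b c : F, (X : Matrix (Fin 3) (Fin 3) F) =
        a • 1 + b • (SL3.companion γ β : Matrix (Fin 3) (Fin 3) F) +
          c • (SL3.companion γ β : Matrix (Fin 3) (Fin 3) F) ^ 2 := by
    refine ⟨X 0 0, X 1 0, X 2 0, ?_⟩
    have h := congr_arg (fun M : SL(3, F) ↦ (M : Matrix (Fin 3) (Fin 3) F)) hX.eq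
    simp only [Matrix.SpecialLinearGroup.coe_mul] at h
    have e (i j : Fin 3) := congr_fun (congr_fun h i) j
    simp only [SL3.companion_coe, Matrix.mul_apply, Fin.sum_univ_three] at e
    have e00 := e 0 0
    have e10 := e 1 0
    have e20 := e 2 0
    have e01 := e 0 1
    have e11 := e 1 1
    have e21 := e 2 1
    simp at e00 e10 e20 e01 e11 e21
    rw [SL3.companion_coe]
    ext i j
    fin_cases i <;> fin_cases j <;>
      simp [pow_two, Matrix.mul_apply, Fin.sum_univ_three, Matrix.one_apply]
    · linear_combination -e00
    · linear_combination -e01 - e20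
    · linear_combination -e10
    · linear_combination -e11 - e00 - β * e20
    · linear_combination -e20
    · linear_combination -e21 - e10 - γ * e20
  obtain ⟨a, b, c, h⟩ := key X hX
  obtain ⟨a', b', c', h'⟩ := key Y hY
  apply Subtype.ext
  rw [Matrix.SpecialLinearGroup.coe_mul, Matrix.SpecialLinearGroup.coe_mul, h, h']
  simp only [Matrix.add_mul, Matrix.mul_add, Matrix.smul_mul, Matrix.mul_smul, mul_one, one_mul,
    pow_two, mul_assoc, smul_add, smul_comm a', smul_comm b', smul_comm c']
  abel

theorem PSL3.hasAbelianCentralizer_companion {γ β : F}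
    (h : (3 : F) = 0 ∨ γ ≠ 0 ∨ β ≠ 0) :
    HasAbelianCentralizer (PSL3.proj (SL3.companion γ β)) := by
  have key (X : SL(3, F)) (hX : Commute (PSL3.proj (SL3.companion γ β)) (PSL3.proj X)) :
      Commute (SL3.companion γ β) X := by
    rcases h with h | h | h
    · exact PSL3.commute_of_three_eq_zero h hX
    · exact PSL3.commute_of_trace_ne_zero
        (by simpa [SL3.companion_coe, Matrix.trace_fin_three] using h) hX
    · have : Commute (SL3.companion γ β)⁻¹ X := by
        refine PSL3.commute_of_trace_ne_zero ?_ (by rw [map_inv]; exact hX.inv_left)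
        rw [Matrix.SpecialLinearGroup.coe_inv, SL3.companion_coe, Matrix.adjugate_fin_three]
        simpa [Matrix.trace_fin_three] using h
      simpa using this.inv_left
  intro x y hx hy
  obtain ⟨X, rfl⟩ := PSL3.proj_surjective x
  obtain ⟨Y, rfl⟩ := PSL3.proj_surjective y
  exact (SL3.commute_of_commute_companion (key X hx) (key Y hy)).map _

theorem PSL3.not_hasAbelianCentralizer_tv (r : F) :
    ¬ HasAbelianCentralizer (PSL3.proj (SL3.tv 1 0 r)) := fun h ↦ by
  have h1 : Commute (SL3.tv 1 0 r) (SL3.tv 1 2 1) := by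
    apply Subtype.ext
    simp [Matrix.SpecialLinearGroup.coe_mul, SL3.tv_coe, mul_add, add_mul]
    abel
  have h2 : Commute (SL3.tv 1 0 r) (SL3.tv 2 0 1) := by
    apply Subtype.ext
    simp [Matrix.SpecialLinearGroup.coe_mul, SL3.tv_coe, mul_add, add_mul]
    abel
  refine PSL3.not_commute (i := 1) ?_ ?_ ?_ (h _ _ (h1.map PSL3.proj) (h2.map PSL3.proj))
  · simp [SL3.tv_coe, mul_add, add_mul, Matrix.single_apply]
  · simp [SL3.tv_coe, mul_add, add_mul, Matrix.single_apply]
  · intro h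
    have := congr_fun (congr_fun h 1) 0
    simp [SL3.tv_coe, mul_add, add_mul, Matrix.single_apply] at this

theorem PSL3.not_hasAbelianCentralizer_homology {h : SL(3, F)} {s t : F}
    (hh : (h : Matrix (Fin 3) (Fin 3) F) = !![s, 0, 0; 0, t, 0; 0, 0, t]) :
    ¬ HasAbelianCentralizer (PSL3.proj h) := fun hab ↦ by
  have h1 : Commute h (SL3.tv 1 2 1) := by
    apply Subtype.ext
    rw [Matrix.SpecialLinearGroup.coe_mul, Matrix.SpecialLinearGroup.coe_mul, SL3.tv_coe, hh]
    ext i j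
    fin_cases i <;> fin_cases j <;>
      simp [Matrix.mul_apply, Fin.sum_univ_three, Matrix.one_apply, Matrix.single_apply]
  have h2 : Commute h (SL3.tv 2 1 1) := by
    apply Subtype.ext
    rw [Matrix.SpecialLinearGroup.coe_mul, Matrix.SpecialLinearGroup.coe_mul, SL3.tv_coe, hh]
    ext i j
    fin_cases i <;> fin_cases j <;>
      simp [Matrix.mul_apply, Fin.sum_univ_three, Matrix.one_apply, Matrix.single_apply]
  refine PSL3.not_commute (i := 0) ?_ ?_ ?_ (hab _ _ (h1.map PSL3.proj) (h2.map PSL3.proj))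
  · simp [SL3.tv_coe, mul_add, add_mul, Matrix.single_apply]
  · simp [SL3.tv_coe, mul_add, add_mul, Matrix.single_apply]
  · intro h
    have := congr_fun (congr_fun h 1) 1
    simp [SL3.tv_coe, mul_add, add_mul, Matrix.single_apply] at this

theorem PSL3.closure_eq_top {x y : SL(3, F)} (h : Subgroup.closure {x, y} = ⊤) :
    Subgroup.closure {PSL3.proj x, PSL3.proj y} = ⊤ := by
  have := congr_arg (Subgroup.map PSL3.proj) h
  rwa [MonoidHom.map_closure, Set.image_pair, Subgroup.map_top_of_surjective _
    PSL3.proj_surjective] at this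

end Projective

section Assembly

variable {H : Type*} [Group H]

theorem MulAut.eq_one_of_pow_eq_one_of_coprime {n m : ℕ} (hnm : n.Coprime m) (α : MulAut H) {x y : H}
    (hxy : α x = y) (hx : x ^ n = 1) (hy : y ^ m = 1) : x = 1 := by
  have hxm : x ^ m = 1 := α.injective (by rw [map_pow, hxy, hy, map_one])
  have := pow_gcd_eq_one.2 ⟨hx, hxm⟩
  rwa [hnm, pow_one] at this

theorem Nat.Coprime.orderOf_coprime {G : Type*} [Monoid G] {n m : ℕ} (hnm : n.Coprime m) {x y : G}
    (hx : x ^ n = 1) (hy : y ^ m = 1) : (orderOf x).Coprime (orderOf y) :=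
  (hnm.coprime_dvd_left (orderOf_dvd_of_pow_eq_one hx)).coprime_dvd_right
    (orderOf_dvd_of_pow_eq_one hy)

theorem Subgroup.closure_pair_inv_right (x y : H) :
    Subgroup.closure {x, y⁻¹} = Subgroup.closure {x, y} := by
  apply le_antisymm <;> rw [Subgroup.closure_le, Set.pair_subset_iff]
  · exact ⟨Subgroup.subset_closure (by simp), Subgroup.inv_mem _ (Subgroup.subset_closure (by simp))⟩
  · exact ⟨Subgroup.subset_closure (by simp), (Subgroup.inv_mem_iff _).1
      (Subgroup.subset_closure (by simp))⟩

/-- A Beauville criterion for powers of `H` in terms of two generating pairs `(A, B)`, `(A', B')`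
and the quotients `t = B A⁻¹`, `h = B' A'⁻¹`. -/
theorem hasBeauvilleStructure_of_two_pairs [Finite H] [IsSimpleGroup H]
    (hna : ∃ x y : H, x * y ≠ y * x) {A B t A' B' h : H} {n m N : ℕ}
    (hnm : n.Coprime m) (hnN : n.Coprime N) (hmN : m.Coprime N)
    (hA : A ^ n = 1) (ht : t ^ n = 1) (hB : B ^ m = 1)
    (hA' : A' ^ N = 1) (hB' : B' ^ N = 1) (hh : h ^ N = 1)
    (hA1 : A ≠ 1) (ht1 : t ≠ 1) (hB1 : B ≠ 1) (hA'1 : A' ≠ 1) (hB'1 : B' ≠ 1) (hh1 : h ≠ 1)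
    (hAB : B * A⁻¹ = t) (hAB' : B' * A'⁻¹ = h)
    (hgen : Subgroup.closure {A, B} = ⊤) (hgen' : Subgroup.closure {A', B'} = ⊤)
    (hcA : HasAbelianCentralizer A) (hct : ¬ HasAbelianCentralizer t)
    (hcA' : HasAbelianCentralizer A') (hch : ¬ HasAbelianCentralizer h)
    {k : ℕ} (hk2 : 2 ≤ k) (hk : k * Nat.card (MulAut H) ≤ phi2 H) :
    HasBeauvilleStructure (Fin k → H) := by
  have g₁ : IsGenTriple (B, A⁻¹, (B * A⁻¹)⁻¹) := isGenTriple_of_closure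
    (by rw [Subgroup.closure_pair_inv_right, Set.pair_comm, hgen])
  have g₂ : IsGenTriple (B', A'⁻¹, (B' * A'⁻¹)⁻¹) := isGenTriple_of_closure
    (by rw [Subgroup.closure_pair_inv_right, Set.pair_comm, hgen'])
  have g₃ : IsGenTriple (A, B⁻¹, (A * B⁻¹)⁻¹) := isGenTriple_of_closure
    (by rw [Subgroup.closure_pair_inv_right, hgen])
  rw [hAB] at g₁
  rw [hAB'] at g₂
  rw [show (A * B⁻¹)⁻¹ = t by rw [← hAB]; group] at g₃
  have hAi : A⁻¹ ^ n = 1 := by rw [inv_pow, hA, inv_one]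
  have hti : t⁻¹ ^ n = 1 := by rw [inv_pow, ht, inv_one]
  have hBi : B⁻¹ ^ m = 1 := by rw [inv_pow, hB, inv_one]
  have hA'i : A'⁻¹ ^ N = 1 := by rw [inv_pow, hA', inv_one]
  have hhi : h⁻¹ ^ N = 1 := by rw [inv_pow, hh, inv_one]
  refine hasBeauvilleStructure_of_three hna g₁ g₂ g₃ ?_ ?_ ?_ ?_ ?_ ?_ ⟨?_, ?_, ?_⟩ ⟨?_, ?_, ?_⟩
    ?_ hk2 hk
  · intro x
    fin_cases x
    exacts [hB1, inv_ne_one.2 hA1, inv_ne_one.2 ht1]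
  · intro x
    fin_cases x
    exacts [hB'1, inv_ne_one.2 hA'1, inv_ne_one.2 hh1]
  · intro x x'
    fin_cases x <;> fin_cases x'
    exacts [hmN.orderOf_coprime hB hB', hmN.orderOf_coprime hB hA'i, hmN.orderOf_coprime hB hhi,
      hnN.orderOf_coprime hAi hB', hnN.orderOf_coprime hAi hA'i, hnN.orderOf_coprime hAi hhi,
      hnN.orderOf_coprime hti hB', hnN.orderOf_coprime hti hA'i, hnN.orderOf_coprime hti hhi]
  · rintro ⟨α, h1, -, -⟩
    exact inv_ne_one.2 hA1 (α.eq_one_of_pow_eq_one_of_coprime hnm h1 hAi hB)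
  · rintro ⟨α, -, h2, -⟩
    refine hch ?_
    have := (hcA'.inv.map α⁻¹).inv
    rw [← show α h⁻¹ = A'⁻¹ from h2] at this
    simpa using this
  · rintro ⟨α, h1, -, -⟩
    exact inv_ne_one.2 hB1 (α.eq_one_of_pow_eq_one_of_coprime hnm.symm h1 hBi hA)
  · rintro ⟨α, h1, -, -⟩
    exact hA1 (α.eq_one_of_pow_eq_one_of_coprime hnm h1 hA hB)
  · rintro ⟨α, -, h2, -⟩
    exact inv_ne_one.2 hB1 (α.eq_one_of_pow_eq_one_of_coprime hnm.symm h2 hBi hti)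
  · rintro ⟨α, h1, -, -⟩
    have := (hcA.map α).inv
    rw [show α A = t⁻¹ from h1, inv_inv] at this
    exact hct this
  · rintro ⟨α, h1, -, -⟩
    exact hA1 (α.eq_one_of_pow_eq_one_of_coprime hnN h1 hA hB')
  · rintro ⟨α, h1, -, -⟩
    exact hA1 (α.eq_one_of_pow_eq_one_of_coprime hnN h1 hA hA'i)
  · rintro ⟨α, h1, -, -⟩
    exact hA1 (α.eq_one_of_pow_eq_one_of_coprime hnN h1 hA hhi)
  · intro l x
    fin_cases x
    · exact ⟨1, .inl (by simp [tripleEntry])⟩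
    · exact ⟨0, .inl (by simp [tripleEntry])⟩
    · exact ⟨2, .inl (by simp [tripleEntry])⟩

end Assembly

section Orders

open Matrix Polynomial

variable {F : Type*} [Field F] [Fintype F]

theorem SL3.pow_card_sq_of_unipotent {M : SL(3, F)}
    (hM : ((M : Matrix (Fin 3) (Fin 3) F) - 1) ^ 3 = 0) : M ^ (Fintype.card F ^ 2) = 1 := by
  obtain ⟨p, hp, n, hpr, hn⟩ := FiniteField.card' F
  have := Fact.mk hpr
  have hq : 2 ≤ Fintype.card F := Fintype.one_lt_card
  have hq3 : 3 ≤ Fintype.card F ^ 2 := by nlinarith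
  apply Subtype.ext
  have h1 := sub_pow_char_pow_of_commute p (n * 2)
    (Commute.one_right (M : Matrix (Fin 3) (Fin 3) F))
  rw [pow_mul, ← hn, one_pow, pow_eq_zero_of_le hq3 hM] at h1
  rw [Matrix.SpecialLinearGroup.coe_pow, Matrix.SpecialLinearGroup.coe_one]
  exact (sub_eq_zero.1 h1.symm)

theorem PSL3.exists_proj_companion_pow_eq_one {γ β : F}
    (hroot : ∀ x : F, x ^ 3 ≠ γ * x ^ 2 + β * x + 1) :
    ∃ m : ℕ, m.Coprime (Fintype.card F) ∧ m.Coprime (Fintype.card F ^ 2 - 1) ∧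
      PSL3.proj (SL3.companion γ β) ^ m = 1 := by
  set f : F[X] := X ^ 3 - C γ * X ^ 2 - C β * X - 1 with hf
  have hm : f.Monic := by rw [hf]; monicity!
  have hd : f.natDegree = 3 := by rw [hf]; compute_degree!
  have hirr : Irreducible f := by
    refine irreducible_of_degree_le_three_of_not_isRoot (by rw [hd]; decide) fun x hx ↦ ?_
    refine hroot x ?_
    simp [hf, IsRoot.def] at hx
    linear_combination hx
  obtain ⟨m, c, h1, h2, h3⟩ := exists_pow_dvd_of_cubic hirr hm hd (by simp [hf])
  refine ⟨m, h1, h2, PSL3.proj_pow_eq_one (c := c) ?_⟩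
  have h0 : aeval (SL3.companion γ β : Matrix (Fin 3) (Fin 3) F) f = 0 := by
    simp only [hf, map_sub, map_mul, map_pow, aeval_X, aeval_C, map_one, SL3.companion_coe,
      Algebra.algebraMap_eq_smul_one]
    ext i j
    fin_cases i <;> fin_cases j <;>
      simp [pow_succ, Matrix.mul_apply, Fin.sum_univ_three, Matrix.one_apply] <;> ring
  obtain ⟨g, hg⟩ := h3
  have h4 := congr_arg (aeval (SL3.companion γ β : Matrix (Fin 3) (Fin 3) F)) hg
  rw [map_mul, h0, zero_mul, map_sub, map_pow, aeval_X, aeval_C, sub_eq_zero] at h4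
  rw [h4]
  rfl

theorem SL3.pow_card_sq_sub_one_of_cubic {a : F} (ha : a ≠ 0) (h4 : a ^ 3 ≠ 4)
    (h2 : 2 * a ^ 3 ≠ -1) {M : SL(3, F)}
    (hM : (M : Matrix (Fin 3) (Fin 3) F) ^ 3 =
      (a ^ 2 - a⁻¹) • (M : Matrix (Fin 3) (Fin 3) F) + 1) :
    M ^ (Fintype.card F ^ 2 - 1) = 1 := by
  obtain ⟨g, hg⟩ := cubic_dvd_pow_sub_one ha h4 h2
  have h0 : aeval (M : Matrix (Fin 3) (Fin 3) F) (X ^ 3 - C (a ^ 2 - a⁻¹) * X - 1) = 0 := by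
    generalize a ^ 2 - a⁻¹ = β at hM
    rw [map_sub, map_sub, map_mul, map_pow, aeval_X, aeval_C, map_one, hM,
      Algebra.algebraMap_eq_smul_one, Matrix.smul_mul, one_mul, add_sub_cancel_left, sub_self]
  have h := congr_arg (aeval (M : Matrix (Fin 3) (Fin 3) F)) hg
  rw [map_mul, h0, zero_mul, map_sub, map_pow, aeval_X, map_one] at h
  apply Subtype.ext
  rw [Matrix.SpecialLinearGroup.coe_pow, Matrix.SpecialLinearGroup.coe_one]
  exact sub_eq_zero.1 h

theorem SL3.pow_card_sub_one_of_diagonal {s t : F} (hs : s ≠ 0) (ht : t ≠ 0) {M : SL(3, F)}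
    (hM : (M : Matrix (Fin 3) (Fin 3) F) = !![s, 0, 0; 0, t, 0; 0, 0, t]) :
    M ^ (Fintype.card F - 1) = 1 := by
  have : (M : Matrix (Fin 3) (Fin 3) F) = diagonal ![s, t, t] := by
    rw [hM]
    ext i j
    fin_cases i <;> fin_cases j <;> simp
  apply Subtype.ext
  rw [Matrix.SpecialLinearGroup.coe_pow, Matrix.SpecialLinearGroup.coe_one, this,
    Matrix.diagonal_pow, ← Matrix.diagonal_one]
  congr 1
  ext i
  fin_cases i <;> simp [FiniteField.pow_card_sub_one_eq_one, hs, ht]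

theorem mem_of_pow_three_mem (h3 : (3 : F) = 0) (S : Subring F) {v : F} (hv : v ^ 3 ∈ S) :
    v ∈ S := by
  have : CharP F 3 := ringChar.of_eq
    (CharP.ringChar_of_prime_eq_zero Nat.prime_three (mod_cast h3))
  obtain ⟨n, -, hn⟩ := FiniteField.card F 3
  have h := FiniteField.pow_card v
  obtain ⟨e, he⟩ := Nat.exists_eq_succ_of_ne_zero n.ne_zero
  rw [hn, he, pow_succ', pow_mul] at h
  rw [← h]
  exact S.pow_mem hv _

/-- The Beauville property of powers, given suitable parameters in the field. -/
theorem hasBeauvilleStructure_of_parameters {v ρ a b : F} (hv0 : v ≠ 0)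
    (hvgen : ∀ S : Subring F, v ∈ S → S = ⊤) (hvroot : ∀ y : F, y ^ 3 ≠ v * (y + 1))
    (hv3 : v ^ 3 ≠ 1 ∨ (2 : F) ≠ 0) (hρ : ρ ≠ 0) (hρ3 : ρ ^ 3 ≠ 1) (ha : a ≠ 0) (hb : b ≠ 0)
    (hβ : a ^ 2 - a⁻¹ ≠ 0) (hab : a ^ 2 - a⁻¹ = ρ ^ 2 * (b ^ 2 - b⁻¹))
    (ha4 : a ^ 3 ≠ 4) (ha2 : 2 * a ^ 3 ≠ -1) (hb4 : b ^ 3 ≠ 4) (hb2 : 2 * b ^ 3 ≠ -1)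
    (hgen : ∀ S : Subring F, ρ ^ 3 ∈ S → (a ^ 2 - a⁻¹) ^ 3 ∈ S → S = ⊤)
    {k : ℕ} (hk2 : 2 ≤ k) (hk : k * Nat.card (MulAut PSL(3, F)) ≤ phi2 PSL(3, F)) :
    HasBeauvilleStructure (Fin k → PSL(3, F)) := by
  have := PSL3.isSimpleGroup (F := F)
  set q := Fintype.card F
  set β := a ^ 2 - a⁻¹ with hβdef
  set A := SL3.companion (3 : F) (-3)
  set B := SL3.companion (3 : F) (v - 3)
  set A' := SL3.companion 0 β
  set B' := SL3.scaledCompanion β ρ hρ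
  have hBt : B = A * SL3.tv 0 2 v := by
    apply Subtype.ext
    rw [Matrix.SpecialLinearGroup.coe_mul, SL3.companion_coe, SL3.companion_coe, SL3.tv_coe]
    ext i j
    fin_cases i <;> fin_cases j <;>
      simp [Matrix.mul_apply, Fin.sum_univ_three, Matrix.one_apply, Matrix.single_apply]
    ring
  have ht : B * A⁻¹ = SL3.tv 1 0 v := by
    rw [hBt, SL3.companion_mul_tv02, mul_inv_cancel_right]
  set h := B' * A'⁻¹ with hh
  have hhd : (h : Matrix (Fin 3) (Fin 3) F) = !![ρ ^ 2, 0, 0; 0, ρ⁻¹, 0; 0, 0, ρ⁻¹] := by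
    rw [hh, Matrix.SpecialLinearGroup.coe_mul, Matrix.SpecialLinearGroup.coe_inv,
      SL3.companion_coe, SL3.scaledCompanion_coe, Matrix.adjugate_fin_three]
    ext i j
    fin_cases i <;> fin_cases j <;> simp [Matrix.mul_apply, Fin.sum_univ_three]
  obtain ⟨m, hmq, hmN, hBm⟩ := PSL3.exists_proj_companion_pow_eq_one (F := F) (γ := 3)
    (β := v - 3) fun x hx ↦ hvroot (x - 1) (by linear_combination hx)
  have hqN : q.Coprime (q ^ 2 - 1) := by
    have : 1 ≤ q ^ 2 := Nat.one_le_pow _ _ Fintype.card_pos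
    have h1 : (q ^ 2 - 1 + 1).Coprime (q ^ 2 - 1) := by simp
    rw [Nat.sub_add_cancel this] at h1
    exact Nat.Coprime.coprime_dvd_left (dvd_pow_self _ two_ne_zero) h1
  refine hasBeauvilleStructure_of_two_pairs (H := PSL(3, F)) PSL3.exists_mul_ne_mul
    (A := PSL3.proj A) (B := PSL3.proj B) (t := PSL3.proj (SL3.tv 1 0 v))
    (A' := PSL3.proj A') (B' := PSL3.proj B') (h := PSL3.proj h)
    (n := q ^ 2) (m := m) (N := q ^ 2 - 1)
    (hmq.symm.pow_left 2) (hqN.pow_left 2) hmN ?_ ?_ hBm ?_ ?_ ?_ ?_ ?_ ?_ ?_ ?_ ?_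
    (by rw [← map_inv, ← map_mul, ht]) (by rw [← map_inv, ← map_mul])
    (PSL3.closure_eq_top ?_) (PSL3.closure_eq_top ?_)
    (PSL3.hasAbelianCentralizer_companion ?_) (PSL3.not_hasAbelianCentralizer_tv v)
    (PSL3.hasAbelianCentralizer_companion (.inr (.inr hβ)))
    (PSL3.not_hasAbelianCentralizer_homology hhd) hk2 hk
  · rw [← map_pow, SL3.pow_card_sq_of_unipotent, map_one]
    rw [SL3.companion_coe]
    ext i j
    fin_cases i <;> fin_cases j <;>
      simp [pow_succ, Matrix.mul_apply, Fin.sum_univ_three, Matrix.one_apply] <;> ring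
  · rw [← map_pow, SL3.pow_card_sq_of_unipotent, map_one]
    rw [SL3.tv_coe, add_sub_cancel_left, pow_succ, pow_two, Matrix.single_mul_single_of_ne,
      zero_mul]
    decide
  · rw [← map_pow, SL3.pow_card_sq_sub_one_of_cubic ha ha4 ha2, map_one]
    rw [SL3.companion_coe]
    ext i j
    fin_cases i <;> fin_cases j <;>
      simp [pow_succ, Matrix.mul_apply, Fin.sum_univ_three, Matrix.one_apply, β]
  · rw [← map_pow, SL3.pow_card_sq_sub_one_of_cubic hb hb4 hb2, map_one]
    rw [SL3.scaledCompanion_coe, hab]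
    generalize b ^ 2 - b⁻¹ = c
    ext i j
    fin_cases i <;> fin_cases j <;>
      simp [pow_succ, Matrix.mul_apply, Fin.sum_univ_three, Matrix.one_apply] <;> field_simp <;>
      simp
  · obtain ⟨c, hc⟩ : q - 1 ∣ q ^ 2 - 1 := by simpa using Nat.sub_dvd_pow_sub_pow q 1 2
    rw [← map_pow, hc, pow_mul, SL3.pow_card_sub_one_of_diagonal (pow_ne_zero 2 hρ)
      (inv_ne_zero hρ) hhd, one_pow, map_one]
  · exact PSL3.proj_ne_one (i := 0) (j := 2) (by decide) (by simp [A, SL3.companion_coe])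
  · exact PSL3.proj_ne_one (i := 1) (j := 0) (by decide) (by simp [SL3.tv_coe, hv0])
  · exact PSL3.proj_ne_one (i := 0) (j := 2) (by decide) (by simp [B, SL3.companion_coe])
  · exact PSL3.proj_ne_one (i := 0) (j := 2) (by decide) (by simp [A', SL3.companion_coe])
  · exact PSL3.proj_ne_one (i := 0) (j := 2) (by decide)
      (by simp [B', SL3.scaledCompanion_coe, hρ])
  · rw [Ne, PSL3.proj_eq_one_iff, hhd]
    rintro ⟨r, -, hr⟩
    have h0 := congr_fun (congr_fun hr 0) 0
    have h1 := congr_fun (congr_fun hr 1) 1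
    simp at h0 h1
    refine hρ3 ?_
    rw [pow_succ, ← h0, h1, inv_mul_cancel₀ hρ]
  · set K := Subgroup.closure {A, B} with hK
    have hA : A ∈ K := Subgroup.subset_closure (by simp)
    have hB : B ∈ K := Subgroup.subset_closure (by simp)
    refine SL3.eq_top_of_tv02_mem hA hv0 ?_ (fun S ↦ ?_) hvgen ?_
    · rw [hBt] at hB
      exact (K.mul_mem_cancel_left hA).1 hB
    · exact S.neg_mem (by simp)
    · by_cases h3 : (3 : F) = 0
      · exact .inl fun S ↦ mem_of_pow_three_mem h3 S
      · exact .inr ⟨neg_ne_zero.2 h3, hv3⟩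
  · exact SL3.companion_generate (K := Subgroup.closure {A', B'})
      (Subgroup.subset_closure (by simp [A'])) hρ (Subgroup.subset_closure (by simp [B']))
      hβ hρ3 hgen
  · by_cases h3 : (3 : F) = 0
    · exact .inl h3
    · exact .inr (.inl h3)

end Orders

section FieldElements

variable {F : Type*} [Field F]

/-- `x` generates `F` as a ring. -/
def GeneratesField (x : F) : Prop := ∀ S : Subring F, x ∈ S → S = ⊤

theorem GeneratesField.of_mem {x y : F} (hx : GeneratesField x)
    (h : ∀ S : Subring F, y ∈ S → x ∈ S) : GeneratesField y := fun S hy ↦ hx S (h S hy)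

theorem GeneratesField.not_mem_bot (hbot : (⊥ : Subring F) ≠ ⊤) {x : F} (hx : GeneratesField x) :
    x ∉ (⊥ : Subring F) := fun h ↦ hbot (hx _ h)

theorem Subring.pow_eq_self_of_mem_bot {p : ℕ} [Fact p.Prime] [CharP F p] {x : F} (hx : x ∈ (⊥ : Subring F)) :
    x ^ p = x := by
  obtain ⟨n, rfl⟩ := Subring.mem_bot.1 hx
  rw [← frobenius_def, map_intCast]

variable [Fintype F]

theorem exists_primitive_element : ∃ g : F, g ≠ 0 ∧ GeneratesField g ∧
    (∀ x : F, x ≠ 0 → ∃ n : ℕ, g ^ n = x) ∧ ∀ n : ℕ, g ^ n = 1 → Fintype.card F - 1 ∣ n := by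
  classical
  obtain ⟨g, hg⟩ := IsCyclic.exists_generator (α := Fˣ)
  have hpow (x : F) (hx : x ≠ 0) : ∃ n : ℕ, (g : F) ^ n = x := by
    obtain ⟨n, hn⟩ := (mem_powers_iff_mem_zpowers (x := g)).2 (hg (Units.mk0 x hx))
    exact ⟨n, by simpa using congr_arg Units.val hn⟩
  refine ⟨g, g.ne_zero, fun S hS ↦ ?_, hpow, fun n hn ↦ ?_⟩
  · rw [Subring.eq_top_iff']
    intro x
    rcases eq_or_ne x 0 with rfl | hx
    · exact S.zero_mem
    · obtain ⟨n, rfl⟩ := hpow x hx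
      exact S.pow_mem hS n
  · rw [← Fintype.card_units, ← orderOf_eq_card_of_forall_mem_zpowers hg |>.trans
      Nat.card_eq_fintype_card]
    exact orderOf_dvd_of_pow_eq_one (Units.ext (by simpa using hn))

variable {p : ℕ} [Fact p.Prime]

theorem Subring.exists_pow_eq_self {e : ℕ} (he : Fintype.card F = p ^ e) (S : Subring F) :
    ∃ d, 0 < d ∧ (∀ x ∈ S, x ^ p ^ d = x) ∧ (S ≠ ⊤ → d < e) := by
  classical
  have hdvd : Nat.card S ∣ p ^ e := by
    rw [← he, ← Nat.card_eq_fintype_card]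
    exact AddSubgroup.card_addSubgroup_dvd_card S.toAddSubgroup
  obtain ⟨d, hde, hd⟩ := (Nat.dvd_prime_pow Fact.out).1 hdvd
  let _ : Fintype S := Fintype.ofFinite S
  let _ : Field S := Fintype.fieldOfDomain S
  refine ⟨d, Nat.pos_of_ne_zero ?_, fun x hx ↦ ?_, fun hS ↦ lt_of_le_of_ne hde ?_⟩
  · rintro rfl
    have : 1 < Nat.card S := Finite.one_lt_card
    rw [hd, pow_zero] at this
    exact lt_irrefl _ this
  · have := FiniteField.pow_card (⟨x, hx⟩ : S)
    rw [← Nat.card_eq_fintype_card, hd] at this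
    simpa using congr_arg Subtype.val this
  · rintro rfl
    refine hS (Subring.toAddSubgroup_injective (AddSubgroup.eq_top_of_card_eq _ ?_))
    exact hd.trans (he.symm.trans Nat.card_eq_fintype_card.symm)

variable [CharP F p]

theorem GeneratesField.card_le {x : F} (hx : GeneratesField x) {n : ℕ} (hn : 0 < n)
    (h : x ^ p ^ n = x) : Fintype.card F ≤ p ^ n := by
  classical
  have htop := hx ((iterateFrobenius F p n).eqLocus (RingHom.id F))
    (by simpa [RingHom.mem_eqLocus, iterateFrobenius_def] using h)
  have hall (y : F) : y ^ p ^ n = y := by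
    have : y ∈ (iterateFrobenius F p n).eqLocus (RingHom.id F) := htop ▸ Subring.mem_top y
    simpa [RingHom.mem_eqLocus, iterateFrobenius_def] using this
  have hp1 : 1 < p ^ n := Nat.one_lt_pow hn.ne' (Fact.out : p.Prime).one_lt
  have hne : (Polynomial.X ^ p ^ n - Polynomial.X : Polynomial F) ≠ 0 :=
    FiniteField.X_pow_card_sub_X_ne_zero F hp1
  calc Fintype.card F = (Finset.univ : Finset F).card := rfl
    _ ≤ (Polynomial.X ^ p ^ n - Polynomial.X : Polynomial F).natDegree :=
      Polynomial.card_le_degree_of_subset_roots fun y _ ↦ by simp [hne, hall, sub_eq_zero]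
    _ = p ^ n := FiniteField.X_pow_card_sub_X_natDegree_eq F hp1

/-- If two distinct elements, one of them a generator, have the same image under
`z ↦ z³ + z²`, then some generator is not in the image. -/
theorem exists_generatesField_not_mem_range {z₁ z₂ : F} (h : z₁ ^ 3 + z₁ ^ 2 = z₂ ^ 3 + z₂ ^ 2)
    (hne : z₁ ≠ z₂) (hz : GeneratesField z₁) :
    ∃ w : F, GeneratesField w ∧ ∀ z : F, z ^ 3 + z ^ 2 ≠ w := by
  by_contra! hc
  have hpre {w z : F} (hw : GeneratesField w) (hz : z ^ 3 + z ^ 2 = w) : GeneratesField z :=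
    hw.of_mem fun S hS ↦ hz ▸ S.add_mem (S.pow_mem hS 3) (S.pow_mem hS 2)
  choose f hf using hc
  let g : {w : F // GeneratesField w} → {w : F // GeneratesField w} :=
    fun w ↦ ⟨f w.1 w.2, hpre w.2 (hf w.1 w.2)⟩
  have hg (w) : (g w).1 ^ 3 + (g w).1 ^ 2 = w.1 := hf w.1 w.2
  have hinj : Function.Injective g := fun w w' hww ↦ Subtype.ext (by rw [← hg, hww, hg])
  have hsurj := Finite.injective_iff_surjective.1 hinj
  obtain ⟨w₁, hw₁⟩ := hsurj ⟨z₁, hz⟩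
  have h1 := hg w₁
  rw [hw₁] at h1
  have hz₂ : GeneratesField z₂ := hpre w₁.2 (h ▸ h1)
  obtain ⟨w₂, hw₂⟩ := hsurj ⟨z₂, hz₂⟩
  have h2 := hg w₂
  rw [hw₂] at h2
  have : w₁ = w₂ := Subtype.ext (h1.symm.trans (h.trans h2))
  exact hne (congr_arg Subtype.val (hw₁.symm.trans (this ▸ hw₂)))

theorem exists_generatesField_not_mem_range_of_sq_add (hbot : (⊥ : Subring F) ≠ ⊤) {σ : F}
    (hσ : GeneratesField (σ ^ 2 + σ)) :
    ∃ w : F, GeneratesField w ∧ ∀ z : F, z ^ 3 + z ^ 2 ≠ w := by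
  have hσ' : GeneratesField σ := hσ.of_mem fun S hS ↦ S.add_mem (S.pow_mem hS 2) hS
  have h1 : σ - 1 ≠ 0 := fun h ↦ hσ'.not_mem_bot hbot (by rw [sub_eq_zero.1 h]; simp)
  have h2 : σ + 1 ≠ 0 := fun h ↦ hσ'.not_mem_bot hbot (by rw [eq_neg_of_add_eq_zero_left h]; simp)
  have h3 : σ ^ 2 + σ + 1 ≠ 0 := fun h ↦
    hσ.not_mem_bot hbot (by rw [eq_neg_of_add_eq_zero_left h]; simp)
  refine exists_generatesField_not_mem_range (z₁ := -(σ ^ 2 + σ) / (σ ^ 2 + σ + 1))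
    (z₂ := -(σ + 1) / (σ ^ 2 + σ + 1)) (by field_simp; ring) (fun h ↦ ?_)
    (hσ.of_mem fun S hS ↦ ?_)
  · rw [div_left_inj' h3] at h
    have : (σ - 1) * (σ + 1) = 0 := by linear_combination -h
    exact (mul_ne_zero h1 h2) this
  · have h4 := S.inv_mem_of_finite (S.add_mem hS S.one_mem)
    have h5 : σ ^ 2 + σ =
        (-(σ ^ 2 + σ) / (σ ^ 2 + σ + 1) + 1)⁻¹ - 1 := by
      have : -(σ ^ 2 + σ) / (σ ^ 2 + σ + 1) + 1 = (σ ^ 2 + σ + 1)⁻¹ := by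
        rw [div_add_one h3, neg_add_cancel_left, one_div]
      rw [this, inv_inv, add_sub_cancel_right]
    rw [h5]
    exact S.sub_mem h4 S.one_mem

theorem exists_generatesField_sq_add_of_two_ne_zero (h2 : (2 : F) ≠ 0) :
    ∃ σ : F, GeneratesField (σ ^ 2 + σ) := by
  obtain ⟨g, hg0, hg, hpow, -⟩ := exists_primitive_element (F := F)
  refine ⟨g - 2⁻¹, fun S hS ↦ (Subring.eq_top_iff' S).2 fun x ↦ ?_⟩
  have h2S : (2 : F)⁻¹ ∈ S := S.inv_mem_of_finite (by simp)
  have hgS : g ^ 2 ∈ S := by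
    have : g ^ 2 = (g - 2⁻¹) ^ 2 + (g - 2⁻¹) + 2⁻¹ ^ 2 := by field_simp; ring
    rw [this]
    exact S.add_mem hS (S.pow_mem h2S 2)
  have hsq (y : F) : y ^ 2 ∈ S := by
    rcases eq_or_ne y 0 with rfl | hy
    · simp
    · obtain ⟨n, rfl⟩ := hpow y hy
      rw [← pow_mul, mul_comm, pow_mul]
      exact S.pow_mem hgS n
  have : x = ((x + 1) * 2⁻¹) ^ 2 - ((x - 1) * 2⁻¹) ^ 2 := by field_simp; ring
  rw [this]
  exact S.sub_mem (hsq _) (hsq _)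

theorem dvd_of_pow_sub_one_dvd {p d e : ℕ} (hp : 1 < p) (h : p ^ e - 1 ∣ p ^ d - 1) : e ∣ d := by
  have h1 := Nat.pow_sub_one_gcd_pow_sub_one p e d
  rw [Nat.gcd_eq_left h] at h1
  have h2 : p ^ e = p ^ Nat.gcd e d := by
    have := Nat.one_le_pow e p (by omega)
    have := Nat.one_le_pow (Nat.gcd e d) p (by omega)
    omega
  rw [Nat.pow_right_injective hp h2]
  exact Nat.gcd_dvd_right e d

/-- A primitive element whose image under `x ↦ x² + x` fails to generate the field is conjugate to
its translate by one over the subfield of index two. -/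
theorem pow_eq_add_one_of_not_generatesField [CharP F 2] {e : ℕ} (he : Fintype.card F = 2 ^ e)
    {g : F} (hg0 : g ≠ 0) (hg : GeneratesField g)
    (hord : ∀ n : ℕ, g ^ n = 1 → Fintype.card F - 1 ∣ n)
    (hη : ¬ GeneratesField (g ^ 2 + g)) : ∃ d, 2 * d = e ∧ g ^ 2 ^ d = g + 1 := by
  simp only [GeneratesField, not_forall] at hη
  obtain ⟨S, hS, hStop⟩ := hη
  obtain ⟨d, hd0, hfix, hde⟩ := S.exists_pow_eq_self he
  replace hde := hde hStop
  have h1 := hfix _ hS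
  rw [add_pow_char_pow, ← pow_mul, mul_comm, pow_mul] at h1
  have h2 : (g ^ 2 ^ d - g) * (g ^ 2 ^ d - (g + 1)) = 0 := by
    linear_combination h1 + (g + g ^ 2 - g ^ 2 ^ d * g - g ^ 2 ^ d) * CharTwo.two_eq_zero (R := F)
  rcases mul_eq_zero.1 h2 with h3 | h3
  · have h4 := hg.card_le (p := 2) hd0 (sub_eq_zero.1 h3)
    rw [he, Nat.pow_le_pow_iff_right (by norm_num)] at h4
    omega
  · replace h3 := sub_eq_zero.1 h3
    refine ⟨d, ?_, h3⟩
    have h4 : g ^ 2 ^ (d * 2) = g := by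
      rw [mul_two, pow_add, pow_mul, h3, add_pow_char_pow, h3, one_pow, add_assoc,
        CharTwo.add_self_eq_zero, add_zero]
    have h5 : g ^ (2 ^ (d * 2) - 1) = 1 := by
      rw [pow_sub₀ _ hg0 Nat.one_le_two_pow, h4, pow_one, mul_inv_cancel₀ hg0]
    have h6 := hord _ h5
    rw [he] at h6
    obtain ⟨c, hc⟩ := dvd_of_pow_sub_one_dvd (by norm_num) h6
    have hc1 : c = 1 := by
      rcases c with _ | _ | c
      · omega
      · rfl
      · nlinarith
    rw [mul_comm, hc, hc1, mul_one]

theorem exists_generatesField_sq_add_of_charTwo [CharP F 2] (h4 : 4 < Fintype.card F) :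
    ∃ σ : F, GeneratesField (σ ^ 2 + σ) := by
  obtain ⟨n, -, he⟩ := FiniteField.card F 2
  obtain ⟨g, hg0, hg, -, hord⟩ := exists_primitive_element (F := F)
  by_contra! hc
  obtain ⟨d, hd, h1⟩ := pow_eq_add_one_of_not_generatesField he hg0 hg hord (hc g)
  obtain ⟨d', hd', h2⟩ := pow_eq_add_one_of_not_generatesField he (inv_ne_zero hg0)
    (hg.of_mem fun S hS ↦ by simpa using S.inv_mem_of_finite hS)
    (fun n hn ↦ hord n (by simpa using hn)) (hc g⁻¹)
  obtain rfl : d = d' := by omega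
  rw [inv_pow, h1] at h2
  have h3 : g + 1 ≠ 0 := by
    rw [← h1]
    exact pow_ne_zero _ hg0
  field_simp at h2
  have h5 : g ^ 3 = 1 := by
    linear_combination (1 - g) * h2
  have := Nat.le_of_dvd (by norm_num) (hord 3 h5)
  omega

theorem exists_generatesField_irreducible (h2 : Fintype.card F ≠ 2) (h4 : Fintype.card F ≠ 4) :
    ∃ v : F, v ≠ 0 ∧ GeneratesField v ∧ (∀ y : F, y ^ 3 ≠ v * (y + 1)) ∧
      (v ^ 3 ≠ 1 ∨ (2 : F) ≠ 0) := by
  obtain ⟨p, hp, n, hpr, hn⟩ := FiniteField.card' F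
  have := Fact.mk hpr
  have htwo : (2 : F) = 0 → p = 2 ∧ 4 < Fintype.card F := fun h ↦ by
    obtain rfl : p = 2 := (CharP.eq F hp (ringChar.of_eq
      (CharP.ringChar_of_prime_eq_zero Nat.prime_two (mod_cast h))))
    refine ⟨rfl, ?_⟩
    rw [hn] at h2 h4 ⊢
    by_contra! hle
    have : (n : ℕ) ≤ 2 :=
      (Nat.pow_le_pow_iff_right (by norm_num)).1 (hle.trans_eq (by norm_num : 4 = 2 ^ 2))
    have := n.pos
    interval_cases (n : ℕ) <;> simp at h2 h4
  obtain ⟨w, hw, hwr⟩ : ∃ w : F, GeneratesField w ∧ ∀ z : F, z ^ 3 + z ^ 2 ≠ w := by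
    by_cases hbot : (⊥ : Subring F) = ⊤
    · exact exists_generatesField_not_mem_range (z₁ := 0) (z₂ := -1) (by ring) (by simp)
        fun S _ ↦ top_le_iff.1 (hbot ▸ bot_le)
    · by_cases h : (2 : F) = 0
      · obtain ⟨rfl, h4'⟩ := htwo h
        obtain ⟨σ, hσ⟩ := exists_generatesField_sq_add_of_charTwo h4'
        exact exists_generatesField_not_mem_range_of_sq_add hbot hσ
      · obtain ⟨σ, hσ⟩ := exists_generatesField_sq_add_of_two_ne_zero h
        exact exists_generatesField_not_mem_range_of_sq_add hbot hσ
  have hw0 : w ≠ 0 := fun h ↦ hwr 0 (by simp [h])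
  have hv : GeneratesField w⁻¹ := hw.of_mem fun S hS ↦ by simpa using S.inv_mem_of_finite hS
  refine ⟨w⁻¹, inv_ne_zero hw0, hv, fun y hy ↦ ?_, ?_⟩
  · have hy0 : y ≠ 0 := by
      rintro rfl
      simp at hy
      exact hw0 hy.symm
    refine hwr y⁻¹ ?_
    field_simp at hy ⊢
    linear_combination -hy
  · by_contra! h
    obtain ⟨rfl, h4'⟩ := htwo h.2
    have := hv.card_le (p := 2) (n := 2) (by norm_num)
      (by rw [show 2 ^ 2 = 3 + 1 by norm_num, pow_succ, h.1, one_mul])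
    omega

end FieldElements

section ScalingParameters

variable {F : Type*} [Field F]

/-- The parameters of the second generating pair in `hasBeauvilleStructure_of_parameters`. -/
def ScalingParameters (ρ a b : F) : Prop :=
  ρ ≠ 0 ∧ ρ ^ 3 ≠ 1 ∧ a ≠ 0 ∧ b ≠ 0 ∧ a ^ 2 - a⁻¹ ≠ 0 ∧ a ^ 2 - a⁻¹ = ρ ^ 2 * (b ^ 2 - b⁻¹) ∧
    a ^ 3 ≠ 4 ∧ 2 * a ^ 3 ≠ -1 ∧ b ^ 3 ≠ 4 ∧ 2 * b ^ 3 ≠ -1 ∧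
      ∀ S : Subring F, ρ ^ 3 ∈ S → (a ^ 2 - a⁻¹) ^ 3 ∈ S → S = ⊤

theorem exists_scalingParameters_of_bot_eq_top (hbot : (⊥ : Subring F) = ⊤) (h2 : (2 : F) ≠ 0) :
    ∃ ρ a b : F, ScalingParameters ρ a b := by
  have hS (S : Subring F) : S = ⊤ := top_le_iff.1 (hbot ▸ bot_le)
  have h1 : (-1 : F) ^ 3 ≠ 1 := fun h ↦ h2 (by linear_combination -h)
  by_cases h5 : (5 : F) = 0
  · have hinv : (2 : F)⁻¹ = 3 := inv_eq_of_mul_eq_one_right (by linear_combination h5)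
    have hβ : (2 : F) ^ 2 - 2⁻¹ = 1 := by rw [hinv]; norm_num
    refine ⟨-1, 2, 2, by simp, h1, h2, h2, by rw [hβ]; exact one_ne_zero, by norm_num, ?_, ?_, ?_,
      ?_, fun S _ _ ↦ hS S⟩
    · exact fun h ↦ one_ne_zero (α := F) (by linear_combination h5 - h)
    · exact fun h ↦ h2 (by linear_combination h - 3 * h5)
    · exact fun h ↦ one_ne_zero (α := F) (by linear_combination h5 - h)
    · exact fun h ↦ h2 (by linear_combination h - 3 * h5)
  · have hβ : (-1 : F) ^ 2 - (-1)⁻¹ = 2 := by norm_num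
    refine ⟨-1, -1, -1, by simp, h1, by simp, by simp, by rwa [hβ], by norm_num, ?_, ?_, ?_, ?_,
      fun S _ _ ↦ hS S⟩
    · exact fun h ↦ h5 (by linear_combination -h)
    · exact fun h ↦ one_ne_zero (α := F) (by linear_combination -h)
    · exact fun h ↦ h5 (by linear_combination -h)
    · exact fun h ↦ one_ne_zero (α := F) (by linear_combination -h)

variable [Fintype F]

theorem generatesField_pow_three {p e : ℕ} [Fact p.Prime] (he : Fintype.card F = p ^ e)
    (h4 : Fintype.card F ≠ 4) {g : F} (hg0 : g ≠ 0)
    (hord : ∀ n : ℕ, g ^ n = 1 → Fintype.card F - 1 ∣ n) : GeneratesField (g ^ 3) := by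
  intro S hS
  by_contra hStop
  obtain ⟨d, hd0, hfix, hde⟩ := S.exists_pow_eq_self he
  replace hde := hde hStop
  have hp : 2 ≤ p := (Fact.out : p.Prime).two_le
  have hs : 2 ≤ p ^ d := hp.trans (Nat.le_self_pow hd0.ne' p)
  have h1 : g ^ (3 * (p ^ d - 1)) = 1 := by
    rw [pow_mul, pow_sub₀ _ (pow_ne_zero 3 hg0) (by omega), hfix _ hS, pow_one,
      mul_inv_cancel₀ (pow_ne_zero 3 hg0)]
  obtain ⟨c, hc⟩ := hord _ h1
  have hle : 2 * p ^ d ≤ p ^ e := by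
    calc 2 * p ^ d ≤ p ^ d * p := by nlinarith
      _ = p ^ (d + 1) := (pow_succ p d).symm
      _ ≤ p ^ e := Nat.pow_le_pow_right (by omega) hde
  rw [he] at hc h4
  have hdvd : p ^ d ∣ p ^ e := Nat.pow_dvd_pow p hde.le
  generalize p ^ d = s at *
  generalize p ^ e = q at *
  obtain rfl : c = 1 := by
    rcases c with _ | _ | c
    · omega
    · rfl
    · have : (q - 1) * 2 ≤ (q - 1) * (c + 1 + 1) := Nat.mul_le_mul_left _ (by omega)
      omega
  have h2 : s ∣ 2 := by
    have : 3 * s = q + 2 := by omega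
    exact (Nat.dvd_add_right hdvd).1 (this ▸ Dvd.intro_left 3 rfl)
  have := Nat.le_of_dvd two_pos h2
  omega

theorem pow_six_not_mem_bot {p e : ℕ} [Fact p.Prime] [CharP F p] (he : Fintype.card F = p ^ e)
    (hbot : (⊥ : Subring F) ≠ ⊤) (h4 : Fintype.card F ≠ 4) (h25 : Fintype.card F ≠ 25) {g : F}
    (hg0 : g ≠ 0) (hord : ∀ n : ℕ, g ^ n = 1 → Fintype.card F - 1 ∣ n) :
    g ^ 6 ∉ (⊥ : Subring F) := fun hmem ↦ by
  have hp : 2 ≤ p := (Fact.out : p.Prime).two_le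
  have h1 : g ^ (6 * (p - 1)) = 1 := by
    rw [pow_mul, pow_sub₀ _ (pow_ne_zero 6 hg0) (by omega), pow_one,
      Subring.pow_eq_self_of_mem_bot hmem, mul_inv_cancel₀ (pow_ne_zero 6 hg0)]
  have h2 := hord _ h1
  obtain ⟨d, hd0, -, hde⟩ := (⊥ : Subring F).exists_pow_eq_self he
  replace hde := hde hbot
  rw [he] at h2 h4 h25
  obtain ⟨r, rfl⟩ : ∃ r, p = r + 2 := ⟨p - 2, by omega⟩
  rcases (show e = 2 ∨ 3 ≤ e by omega) with rfl | he3
  · have h3 : (r + 2) ^ 2 - 1 = (r + 1) * (r + 3) := by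
      rw [Nat.sub_eq_iff_eq_add (Nat.one_le_pow _ _ (by omega))]
      ring
    rw [h3, show 6 * (r + 2 - 1) = (r + 1) * 6 by rw [mul_comm]; rfl,
      Nat.mul_dvd_mul_iff_left (by omega)] at h2
    have : r ≤ 3 := by have := Nat.le_of_dvd (by norm_num) h2; omega
    clear hord h1 hmem he
    interval_cases r <;> revert h2 h4 h25 <;> decide
  · have h5 := Nat.le_of_dvd (by omega) h2
    have h6 : (r + 2) ^ 3 ≤ (r + 2) ^ e := Nat.pow_le_pow_right (by omega) he3
    have h7 : (r + 2) ^ 3 ≤ 6 * (r + 1) + 1 := by omega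
    nlinarith [sq_nonneg r, pow_nonneg (Nat.zero_le r) 3]

theorem exists_scalingParameters_of_primitive {p e : ℕ} [Fact p.Prime] [CharP F p]
    (he : Fintype.card F = p ^ e) (hbot : (⊥ : Subring F) ≠ ⊤) (h4 : Fintype.card F ≠ 4)
    (h25 : Fintype.card F ≠ 25) : ∃ ρ a b : F, ScalingParameters ρ a b := by
  obtain ⟨g, hg0, -, -, hord⟩ := exists_primitive_element (F := F)
  have h6 := pow_six_not_mem_bot he hbot h4 h25 hg0 hord
  have hne (n : ℤ) : g ^ 6 ≠ n := fun h ↦ h6 (h ▸ intCast_mem _ n)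
  have hne' (m n : ℤ) (hn : (n : F) ≠ 0) : (m : F) * g ^ 6 ≠ n := fun h ↦ by
    have hm : (m : F) ≠ 0 := fun hm ↦ hn (by rw [← h, hm, zero_mul])
    refine h6 ?_
    rw [show g ^ 6 = (m : F)⁻¹ * n by rw [← h, inv_mul_cancel_left₀ hm]]
    exact Subring.mul_mem _ (Subring.inv_mem_of_finite _ (intCast_mem _ m)) (intCast_mem _ n)
  refine ⟨g, -g ^ 2, -(g ^ 2)⁻¹, hg0, fun h ↦ hne 1 ?_, by simpa, by simpa, fun h ↦ hne (-1) ?_, ?_,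
    fun h ↦ hne (-4) ?_, fun h ↦ hne' 2 1 (by simp) ?_, fun h ↦ hne' 4 (-1) (by simp) ?_,
    fun h ↦ hne 2 ?_, fun S hS _ ↦ generatesField_pow_three he h4 hg0 hord S hS⟩
  · rw [show g ^ 6 = (g ^ 3) ^ 2 by ring, h]; simp
  · field_simp at h
    push_cast
    linear_combination h
  · field_simp
    ring
  · push_cast
    linear_combination -h
  · push_cast
    linear_combination -h
  · field_simp at h
    push_cast
    linear_combination -h
  · field_simp at h
    push_cast
    linear_combination h

theorem exists_scalingParameters_of_card_eq (h25 : Fintype.card F = 25) :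
    ∃ ρ a b : F, ScalingParameters ρ a b := by
  have h5 : (5 : F) = 0 := by
    have h : ((25 : ℕ) : F) = 0 := h25 ▸ FiniteField.cast_card_eq_zero F
    have : (5 : F) ^ 2 = 0 := by norm_num at h ⊢; exact h
    exact pow_eq_zero_iff two_ne_zero |>.1 this
  have : Fact (Nat.Prime 5) := ⟨by norm_num⟩
  have hchar : ringChar F = 5 := CharP.ringChar_of_prime_eq_zero (by norm_num) (mod_cast h5)
  have : CharP F 5 := ringChar.of_eq hchar
  have h2 : (2 : F) ≠ 0 := fun h ↦ one_ne_zero (α := F) (by linear_combination h5 - 2 * h)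
  obtain ⟨i, hi⟩ := (FiniteField.isSquare_iff (by rw [hchar]; norm_num) h2).2
    (by rw [h25]; linear_combination 819 * h5)
  have hibot : i ∉ (⊥ : Subring F) := fun h ↦ by
    obtain ⟨n, rfl⟩ := Subring.mem_bot.1 h
    have h1 : ((n * n - 2 : ℤ) : F) = 0 := by push_cast; linear_combination -hi
    rw [CharP.intCast_eq_zero_iff F 5, Int.dvd_iff_emod_eq_zero, Int.sub_emod, Int.mul_emod] at h1
    have := Int.emod_nonneg n (b := 5) (by norm_num)
    have := Int.emod_lt_of_pos n (b := 5) (by norm_num)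
    push_cast at h1
    generalize n % 5 = m at *
    interval_cases m <;> simp at h1
  have hne (n : ℤ) : i ≠ n := fun h ↦ hibot (h ▸ intCast_mem _ n)
  have hi2 : 2 + i ≠ 0 := fun h ↦ hne (-2) (by push_cast; linear_combination h)
  have hinv : (2 + i)⁻¹ = 1 + 2 * i :=
    inv_eq_of_mul_eq_one_right (by linear_combination (1 + i) * h5 - 2 * hi)
  have hβ : (2 + i) ^ 2 - (2 + i)⁻¹ = 2 * i := by
    rw [hinv]
    linear_combination h5 - hi
  have hi3 : (2 + i) ^ 3 = - i := by linear_combination (-6 - i) * hi + (4 + 3 * i) * h5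
  have hi4 : (2 + i) ^ 3 ≠ 4 := fun h ↦ hne (-4) (by push_cast; linear_combination hi3 - h)
  have hi5 : 2 * (2 + i) ^ 3 ≠ -1 := fun h ↦ hne 3 (by
    push_cast; linear_combination -3 * h + 6 * hi3 - i * h5)
  refine ⟨-1, 2 + i, 2 + i, by simp, fun h ↦ h2 (by linear_combination -h), hi2, hi2, ?_, by simp,
    hi4, hi5, hi4, hi5, fun S _ hS ↦ ?_⟩
  · rw [hβ]
    exact mul_ne_zero h2 (fun h ↦ hne 0 (by simpa using h))
  · by_contra hStop
    obtain ⟨d, hd0, hfix, hd2⟩ := S.exists_pow_eq_self (p := 5) (e := 2) h25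
    have hd := hd2 hStop
    obtain rfl : d = 1 := by omega
    have hiS : i ∈ S := by
      rw [hβ] at hS
      have : i = (2 * i) ^ 3 := by linear_combination 8 * i * hi - 3 * i * h5
      rwa [this]
    have h1 := hfix i hiS
    rw [pow_one] at h1
    refine hne 0 ?_
    push_cast
    linear_combination 2 * h1 + 2 * i * (i ^ 2 + 2) * hi - i * h5

/-- Suitable parameters exist in all finite fields other than those with two or four elements. -/
theorem exists_scalingParameters (h2 : Fintype.card F ≠ 2) (h4 : Fintype.card F ≠ 4) :
    ∃ ρ a b : F, ScalingParameters ρ a b := by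
  obtain ⟨p, hp, n, hpr, hn⟩ := FiniteField.card' F
  have := Fact.mk hpr
  by_cases hbot : (⊥ : Subring F) = ⊤
  · refine exists_scalingParameters_of_bot_eq_top hbot fun h ↦ h2 ?_
    obtain rfl : p = 2 := (CharP.eq F hp (ringChar.of_eq
      (CharP.ringChar_of_prime_eq_zero Nat.prime_two (mod_cast h))))
    have h1 : GeneratesField (1 : F) := fun S _ ↦ top_le_iff.1 (hbot ▸ bot_le)
    have h3 := h1.card_le (p := 2) one_pos (one_pow _)
    have : 1 < Fintype.card F := Fintype.one_lt_card
    omega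
  · by_cases h25 : Fintype.card F = 25
    · exact exists_scalingParameters_of_card_eq h25
    · exact exists_scalingParameters_of_primitive hn hbot h4 h25

theorem hasBeauvilleStructure_of_card_ne (h2 : Fintype.card F ≠ 2) (h4 : Fintype.card F ≠ 4)
    {k : ℕ} (hk2 : 2 ≤ k) (hk : k * Nat.card (MulAut PSL(3, F)) ≤ phi2 PSL(3, F)) :
    HasBeauvilleStructure (Fin k → PSL(3, F)) := by
  obtain ⟨v, hv0, hv, hvr, hv3⟩ := exists_generatesField_irreducible h2 h4
  obtain ⟨ρ, a, b, hρ, hρ3, ha, hb, hβ, hab, ha4, ha2, hb4, hb2, hgen⟩ :=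
    exists_scalingParameters h2 h4
  exact hasBeauvilleStructure_of_parameters hv0 hv hvr hv3 hρ hρ3 ha hb hβ hab ha4 ha2 hb4 hb2 hgen
    hk2 hk

end ScalingParameters

/-- The value at `(x, y)` of a word in the letters `x, x⁻¹, y, y⁻¹`, indexed in this order. -/
def pairWord {G : Type*} [Group G] (x y : G) (w : List (Fin 4)) : G :=
  (w.map ![x, x⁻¹, y, y⁻¹]).prod

theorem mem_closure_of_pairWord {G : Type*} [Group G] {x y z : G} (w : List (Fin 4))
    (h : pairWord x y w = z) : z ∈ Subgroup.closure {x, y} := by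
  have hx : x ∈ Subgroup.closure {x, y} := Subgroup.subset_closure (Set.mem_insert _ _)
  have hy : y ∈ Subgroup.closure {x, y} := Subgroup.subset_closure (Set.mem_insert_of_mem _ rfl)
  rw [← h]
  refine Subgroup.list_prod_mem _ fun t ht ↦ ?_
  obtain ⟨i, -, rfl⟩ := List.mem_map.1 ht
  fin_cases i
  exacts [hx, inv_mem hx, hy, inv_mem hy]

section BaseField

open Matrix

variable {K F : Type*} [Field K] [Field F]

/-- The map from the special linear group over `K` to the projective one over an isomorphic
field. -/
def PSL3.baseMap (f : K →+* F) : SL(3, K) →* PSL(3, F) :=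
  PSL3.proj.comp (Matrix.SpecialLinearGroup.map f)

theorem PSL3.baseMap_surjective {f : K →+* F} (hf : Function.Surjective f) :
    Function.Surjective (PSL3.baseMap f) := by
  refine PSL3.proj_surjective.comp fun M ↦ ?_
  choose g hg using hf
  have hm : f.mapMatrix (of fun i j ↦ g (M i j)) = (M : Matrix (Fin 3) (Fin 3) F) := by
    ext i j
    simp [hg]
  refine ⟨⟨of fun i j ↦ g (M i j), f.injective ?_⟩, Subtype.ext hm⟩
  rw [RingHom.map_det, hm, M.2, map_one]

theorem PSL3.baseMap_ne_one {f : K →+* F} {M : SL(3, K)} {i j : Fin 3} (hij : i ≠ j)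
    (h : M i j ≠ 0) : PSL3.baseMap f M ≠ 1 := by
  refine PSL3.proj_ne_one hij ?_
  simpa using h

theorem PSL3.orderOf_baseMap {f : K →+* F} {M : SL(3, K)} {p n : ℕ} (hp : p.Prime)
    {i j : Fin 3} (hij : i ≠ j) (h1 : (M ^ p ^ n) i j ≠ 0) (h2 : M ^ p ^ (n + 1) = 1) :
    orderOf (PSL3.baseMap f M) = p ^ (n + 1) := by
  have := Fact.mk hp
  refine orderOf_eq_prime_pow ?_ ?_
  · rw [← map_pow]
    exact PSL3.baseMap_ne_one hij h1
  · rw [← map_pow, h2, map_one]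

theorem PSL3.isGenTriple_baseMap {f : K →+* F} (hf : Function.Surjective f) {γ β : K} {y : SL(3, K)}
    (h : ∀ r, SL3.tv 1 0 r ∈ Subgroup.closure {SL3.companion γ β, y}) :
    IsGenTriple (PSL3.baseMap f (SL3.companion γ β), PSL3.baseMap f y,
      (PSL3.baseMap f (SL3.companion γ β) * PSL3.baseMap f y)⁻¹) := by
  refine isGenTriple_of_closure ?_
  rw [← Set.image_pair, ← MonoidHom.map_closure,
    SL3.eq_top_of_tv_mem (Subgroup.subset_closure (Set.mem_insert _ _)) h,
    Subgroup.map_top_of_surjective _ (PSL3.baseMap_surjective hf)]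

end BaseField

section FieldFour

open Matrix

/-- The field with four elements, by coordinates with respect to `1` and a root of `X ^ 2 + X + 1`. -/
structure GF4 where
  fst : Bool
  snd : Bool

namespace GF4

instance : DecidableEq GF4 := fun x y ↦ decidable_of_iff (x.1 = y.1 ∧ x.2 = y.2)
  (by cases x; cases y; simp)

instance : Fintype GF4 :=
  ⟨{⟨false, false⟩, ⟨true, false⟩, ⟨false, true⟩, ⟨true, true⟩}, by rintro ⟨_ | _, _ | _⟩ <;> decide⟩

instance : Zero GF4 := ⟨⟨false, false⟩⟩
instance : One GF4 := ⟨⟨true, false⟩⟩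
instance : Add GF4 := ⟨fun x y ↦ ⟨x.1 ^^ y.1, x.2 ^^ y.2⟩⟩
instance : Neg GF4 := ⟨fun x ↦ x⟩
instance : Mul GF4 :=
  ⟨fun x y ↦ ⟨(x.1 && y.1) ^^ (x.2 && y.2), (x.1 && y.2) ^^ (x.2 && y.1) ^^ (x.2 && y.2)⟩⟩
instance : Inv GF4 := ⟨fun x ↦ ⟨x.1 ^^ x.2, x.2⟩⟩

instance : CommRing GF4 where
  add_assoc := by decide
  zero_add := by decide
  add_zero := by decide
  add_comm := by decide
  neg_add_cancel := by decide
  mul_assoc := by decide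
  one_mul := by decide
  mul_one := by decide
  zero_mul := by decide
  mul_zero := by decide
  mul_comm := by decide
  left_distrib := by decide
  right_distrib := by decide
  nsmul := nsmulRec
  zsmul := zsmulRec

instance : Field GF4 where
  exists_pair_ne := ⟨0, 1, by decide⟩
  mul_inv_cancel := by decide
  inv_zero := by decide
  nnqsmul := _
  nnqsmul_def _ _ := rfl
  qsmul := _
  qsmul_def _ _ := rfl

/-- The generator of the field. -/
def omega : GF4 := ⟨false, true⟩

theorem exists_surjective_ringHom {F : Type*} [Field F] [Fintype F] (h4 : Fintype.card F = 4) :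
    ∃ f : GF4 →+* F, Function.Surjective f := by
  classical
  obtain ⟨w, -, hw⟩ := Finset.exists_mem_notMem_of_card_lt_card (s := ({0, 1} : Finset F))
    (t := (Finset.univ : Finset F))
    (by rw [Finset.card_univ, h4]; exact lt_of_le_of_lt Finset.card_le_two (by norm_num))
  simp only [Finset.mem_insert, Finset.mem_singleton, not_or] at hw
  have h2 : (2 : F) = 0 := by
    have := FiniteField.cast_card_eq_zero F
    rw [h4, show ((4 : ℕ) : F) = 2 * 2 by norm_num] at this
    exact mul_self_eq_zero.1 this
  have hw2 : w * w + w + 1 = 0 := by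
    have := FiniteField.pow_card w
    rw [h4] at this
    have h : w * (w - 1) * (w * w + w + 1) = 0 := by linear_combination this
    exact (mul_eq_zero.1 h).resolve_left (mul_ne_zero hw.1 (sub_ne_zero.2 hw.2))
  let c : Bool → F := fun b ↦ if b then 1 else 0
  let f : GF4 →+* F :=
    { toFun x := c x.1 + c x.2 * w
      map_one' := by change c true + c false * w = 1; simp [c]
      map_zero' := by change c false + c false * w = 0; simp [c]
      map_add' x y := by
        obtain ⟨a, b⟩ := x
        obtain ⟨a', b'⟩ := y
        change c (a ^^ a') + c (b ^^ b') * w = c a + c b * w + (c a' + c b' * w)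
        have hc (a b : Bool) : c (a ^^ b) = c a + c b := by
          cases a <;> cases b <;> simp [c]
          linear_combination -h2
        rw [hc, hc]
        ring
      map_mul' x y := by
        obtain ⟨a, b⟩ := x
        obtain ⟨a', b'⟩ := y
        change c ((a && a') ^^ (b && b')) + c ((a && b') ^^ (b && a') ^^ (b && b')) * w =
          (c a + c b * w) * (c a' + c b' * w)
        have hc (a b : Bool) : c (a ^^ b) = c a + c b := by
          cases a <;> cases b <;> simp [c]
          linear_combination -h2
        have hm (a b : Bool) : c (a && b) = c a * c b := by
          cases a <;> cases b <;> simp [c]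
        rw [hc, hc, hc, hm, hm, hm, hm]
        linear_combination (-c b * c b') * hw2 + c b * c b' * (1 + w) * h2 }
  refine ⟨f, (Fintype.bijective_iff_injective_and_card f).2 ⟨f.injective, ?_⟩ |>.surjective⟩
  rw [h4]
  rfl

end GF4


theorem SL3.tv_mem_of_omega {K : Subgroup SL(3, GF4)} (h1 : SL3.tv 1 0 1 ∈ K)
    (h2 : SL3.tv 1 0 GF4.omega ∈ K) (r : GF4) : SL3.tv 1 0 r ∈ K := by
  obtain ⟨_ | _, _ | _⟩ := r
  · exact (congr_arg (· ∈ K) (show SL3.tv 1 0 _ = 1 by decide +kernel)).mpr K.one_mem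
  · exact h2
  · exact h1
  · exact (congr_arg (· ∈ K) (show SL3.tv 1 0 _ = SL3.tv 1 0 1 * SL3.tv 1 0 GF4.omega by
      decide +kernel)).mpr (K.mul_mem h1 h2)

theorem GF4.exists_isGenTriple_seven_seven_four {F : Type*} [Field F] {f : GF4 →+* F}
    (hf : Function.Surjective f) : ∃ T : PSL(3, F) × PSL(3, F) × PSL(3, F), IsGenTriple T ∧
      ∀ x, orderOf (tripleEntry T x) = ![7, 7, 4] x := by
  let y : SL(3, GF4) := ⟨!![0, 0, GF4.omega ^ 2; 1, 0, GF4.omega ^ 2; 0, GF4.omega, 0], by decide⟩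
  have h := PSL3.isGenTriple_baseMap hf (SL3.tv_mem_of_omega
    (mem_closure_of_pairWord (x := SL3.companion 0 1) (y := y)
      [0, 3, 1, 2, 2, 1, 3, 0] (by decide +kernel))
    (mem_closure_of_pairWord
      [1, 2, 2, 1, 3, 0, 0, 3] (by decide +kernel)))
  refine ⟨_, h, fun x ↦ ?_⟩
  fin_cases x
  · exact PSL3.orderOf_baseMap (p := 7) (n := 0) (i := 0) (j := 2) (by norm_num) (by decide)
      (by decide +kernel) (by decide +kernel)
  · exact PSL3.orderOf_baseMap (p := 7) (n := 0) (i := 0) (j := 2) (by norm_num) (by decide)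
      (by decide +kernel) (by decide +kernel)
  · refine (orderOf_inv _).trans ?_
    rw [← map_mul]
    exact PSL3.orderOf_baseMap (p := 2) (n := 1) (i := 0) (j := 1) (by norm_num) (by decide)
      (by decide +kernel) (by decide +kernel)

theorem GF4.exists_isGenTriple_four_four_seven {F : Type*} [Field F] {f : GF4 →+* F}
    (hf : Function.Surjective f) : ∃ T : PSL(3, F) × PSL(3, F) × PSL(3, F), IsGenTriple T ∧
      ∀ x, orderOf (tripleEntry T x) = ![4, 4, 7] x := by
  let y : SL(3, GF4) := ⟨!![1, 0, GF4.omega ^ 2; 0, 0, GF4.omega; 0, GF4.omega ^ 2, 0], by decide⟩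
  have h := PSL3.isGenTriple_baseMap hf (SL3.tv_mem_of_omega
    (mem_closure_of_pairWord (x := SL3.companion 1 1) (y := y)
      [3, 0, 0, 2, 2, 0, 0, 2] (by decide +kernel))
    (mem_closure_of_pairWord
      [2, 0, 0, 2, 1, 2, 0, 2, 1, 2, 0, 0, 3] (by decide +kernel)))
  refine ⟨_, h, fun x ↦ ?_⟩
  fin_cases x
  · exact PSL3.orderOf_baseMap (p := 2) (n := 1) (i := 0) (j := 1) (by norm_num) (by decide)
      (by decide +kernel) (by decide +kernel)
  · exact PSL3.orderOf_baseMap (p := 2) (n := 1) (i := 0) (j := 1) (by norm_num) (by decide)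
      (by decide +kernel) (by decide +kernel)
  · refine (orderOf_inv _).trans ?_
    rw [← map_mul]
    exact PSL3.orderOf_baseMap (p := 7) (n := 0) (i := 0) (j := 1) (by norm_num) (by decide)
      (by decide +kernel) (by decide +kernel)

theorem GF4.exists_isGenTriple_five_five_three {F : Type*} [Field F] {f : GF4 →+* F}
    (hf : Function.Surjective f) : ∃ T : PSL(3, F) × PSL(3, F) × PSL(3, F), IsGenTriple T ∧
      ∀ x, orderOf (tripleEntry T x) = ![5, 5, 3] x := by
  let y : SL(3, GF4) := ⟨!![0, 0, 1; 0, 1, 0; 1, 0, GF4.omega], by decide⟩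
  have h := PSL3.isGenTriple_baseMap hf (SL3.tv_mem_of_omega
    (mem_closure_of_pairWord (x := SL3.companion (GF4.omega ^ 2) (GF4.omega ^ 2)) (y := y)
      [3, 1, 2, 1, 2, 0, 3, 0, 2, 2] (by decide +kernel))
    (mem_closure_of_pairWord
      [1, 2, 2, 0, 0, 3, 3, 0, 0, 2, 0, 0, 3, 0, 2] (by decide +kernel)))
  refine ⟨_, h, fun x ↦ ?_⟩
  fin_cases x
  · exact PSL3.orderOf_baseMap (p := 5) (n := 0) (i := 0) (j := 2) (by norm_num) (by decide)
      (by decide +kernel) (by decide +kernel)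
  · exact PSL3.orderOf_baseMap (p := 5) (n := 0) (i := 0) (j := 2) (by norm_num) (by decide)
      (by decide +kernel) (by decide +kernel)
  · refine (orderOf_inv _).trans ?_
    rw [← map_mul]
    exact PSL3.orderOf_baseMap (p := 3) (n := 0) (i := 0) (j := 2) (by norm_num) (by decide)
      (by decide +kernel) (by decide +kernel)

theorem TripleEquiv.order_eq {H : Type*} [Group H] {T T' : H × H × H} {n n' : Fin 3 → ℕ}
    (h : TripleEquiv T T') (hn : ∀ x, orderOf (tripleEntry T x) = n x)
    (hn' : ∀ x, orderOf (tripleEntry T' x) = n' x) : n = n' :=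
  funext fun x ↦ by rw [← hn, ← hn', h.orderOf_eq]

theorem hasBeauvilleStructure_of_card_eq_four {F : Type*} [Field F] [Fintype F]
    (h4 : Fintype.card F = 4) {k : ℕ} (hk2 : 2 ≤ k)
    (hk : k * Nat.card (MulAut PSL(3, F)) ≤ phi2 PSL(3, F)) :
    HasBeauvilleStructure (Fin k → PSL(3, F)) := by
  obtain ⟨f, hf⟩ := GF4.exists_surjective_ringHom h4
  obtain ⟨T₁, g₁, o₁⟩ := GF4.exists_isGenTriple_seven_seven_four hf
  obtain ⟨T₂, g₂, o₂⟩ := GF4.exists_isGenTriple_five_five_three hf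
  obtain ⟨T₃, g₃, o₃⟩ := GF4.exists_isGenTriple_four_four_seven hf
  have := PSL3.isSimpleGroup (F := F)
  have rot {T : PSL(3, F) × PSL(3, F) × PSL(3, F)} {n : Fin 3 → ℕ}
      (h : ∀ x, orderOf (tripleEntry T x) = n x) (x : Fin 3) :
      orderOf (tripleEntry (rotTriple T) x) = n (x + 1) := by rw [tripleEntry_rotTriple, h]
  refine hasBeauvilleStructure_of_three PSL3.exists_mul_ne_mul g₁ g₂ g₃ (fun x ↦ ?_) (fun x ↦ ?_)
    (fun x x' ↦ ?_) (fun h ↦ ?_) (fun h ↦ ?_) (fun h ↦ ?_)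
    ⟨fun h ↦ ?_, fun h ↦ ?_, fun h ↦ ?_⟩ ⟨fun h ↦ ?_, fun h ↦ ?_, fun h ↦ ?_⟩ (fun l x ↦ ?_) hk2 hk
  · rw [← orderOf_eq_one_iff.ne, o₁]
    revert x
    decide
  · rw [← orderOf_eq_one_iff.ne, o₂]
    revert x
    decide
  · rw [o₁, o₂]
    revert x x'
    decide
  · exact absurd (h.order_eq (rot o₁) o₁) (by decide)
  · exact absurd (h.order_eq (rot o₂) o₂) (by decide)
  · exact absurd (h.order_eq (rot o₃) o₃) (by decide)
  · exact absurd (h.order_eq o₃ o₁) (by decide)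
  · exact absurd (h.order_eq o₃ (rot o₁)) (by decide)
  · exact absurd (h.order_eq o₃ (rot (rot o₁))) (by decide)
  · exact absurd (h.order_eq o₃ o₂) (by decide)
  · exact absurd (h.order_eq o₃ (rot o₂)) (by decide)
  · exact absurd (h.order_eq o₃ (rot (rot o₂))) (by decide)
  · obtain ⟨x', hx'⟩ : ∃ x' : Fin 3, ![4, 4, 7] x = ![7, 7, 4] x' := by
      revert x
      decide
    exact ⟨x', Or.inl (by rw [o₃, o₁, hx'])⟩

end FieldFour

section FieldTwo

theorem Nat.factorization_le_of_dvd {a b l e : ℕ} (hl : l.Prime) (hb : b ≠ 0) (hab : a ∣ b)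
    (h : ¬ l ^ (e + 1) ∣ b) : a.factorization l ≤ e := by
  by_contra! hlt
  exact h (((hl.pow_dvd_iff_le_factorization (ne_zero_of_dvd_ne_zero hb hab)).2 hlt).trans hab)

theorem exists_injective_extending {X : Type*} [Finite X] {L : List X} (hL : L.Nodup) {k : ℕ}
    (hk : k ≤ Nat.card X) : ∃ U : Fin k → X, Function.Injective U ∧
      ∀ (i : Fin k) (hi : i.1 < L.length), U i = L[i.1] := by
  classical
  have := Fintype.ofFinite X
  rw [Nat.card_eq_fintype_card] at hk
  set L' := L ++ Finset.univ.toList.filter (· ∉ L) with hL'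
  have hnd : L'.Nodup := by
    refine List.Nodup.append hL ((Finset.nodup_toList _).filter _) ?_
    intro a ha ha'
    simp [ha] at ha'
  have hlen : k ≤ L'.length := by
    rw [← List.toFinset_card_of_nodup hnd]
    refine hk.trans (Finset.card_le_card fun a _ ↦ ?_)
    by_cases ha : a ∈ L <;> simp [hL', ha]
  refine ⟨fun i ↦ L'[i.1]'(i.2.trans_le hlen), fun i j h ↦ Fin.ext ?_, fun i hi ↦ ?_⟩
  · exact (hnd.getElem_inj_iff).1 h
  · simp [hL', List.getElem_append_left, hi]

theorem GenClass.order_dvd {H : Type*} [Group H] {n : ℕ} (hn : ∀ x : H, x ^ n = 1) (c : GenClass H) (x : Fin 3) :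
    c.order x ∣ n := by
  obtain ⟨T, h, rfl⟩ := c.exists_rep
  exact orderOf_dvd_of_pow_eq_one (hn _)

variable {H : Type*} [Group H] [Finite H] [IsSimpleGroup H]

/-- The Beauville criterion by a permutation `π` of a family of generating triples, in a group of
exponent dividing `84`. -/
theorem hasBeauvilleStructure_of_perm (hna : ∃ x y : H, x * y ≠ y * x) (hexp : ∀ x : H, x ^ 84 = 1)
    {k : ℕ} {U : Fin k → GenClass H} (hU : Function.Injective U) (π : Equiv.Perm (Fin k))
    {i₁ i₂ : Fin k} (h₁ : ∀ x, (U i₁).order x = 4) (h₂ : ∀ x, (U i₂).order x = 7) (hπ : π i₁ = i₂)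
    (h3 : ∀ i x, 3 ∣ (U i).order x →
      ∃ j, 3 ∣ (U j).order x ∧ ∀ x', ¬ 3 ∣ (U (π j)).order x') :
    HasBeauvilleStructure (Fin k → H) := by
  refine hasBeauvilleStructure_of_classes hna U (U ∘ π) hU (hU.comp π.injective)
    (fun x ↦ ⟨i₁, i₂, by norm_num [h₁, h₂]⟩)
    (fun x ↦ ⟨π.symm i₁, π.symm i₂, by norm_num [h₁, h₂]⟩) ?_
  rintro l hl x x' E ⟨i, hi⟩ ⟨m, hm0, hm, hmE⟩ ⟨m', hm0', hm', hmE'⟩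
  beta_reduce at hm hmE hm' hmE'
  simp only [Function.comp_apply] at hm' hmE'
  have hdvd (c : GenClass H) (x : Fin 3) : c.order x ∣ 84 := c.order_dvd hexp x
  have hle (e : ℕ) (he : ¬ l ^ (e + 1) ∣ 84) (c : GenClass H) (x : Fin 3) :
      (c.order x).factorization l ≤ e :=
    Nat.factorization_le_of_dvd hl (by norm_num) (hdvd c x) he
  have h84 : l ∣ 2 * 2 * 3 * 7 := (Nat.dvd_of_factorization_pos
    (by rw [(hmE i).1 hi]; exact hm0.ne')).trans (hdvd (U i) x)
  have hl' : l = 2 ∨ l = 3 ∨ l = 7 := by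
    simp only [hl.dvd_mul, Nat.prime_dvd_prime_iff_eq hl Nat.prime_two,
      Nat.prime_dvd_prime_iff_eq hl Nat.prime_three,
      Nat.prime_dvd_prime_iff_eq hl (by norm_num : Nat.Prime 7)] at h84
    tauto
  have hmem {j : Fin k} {e : ℕ} (he : ¬ l ^ (e + 1) ∣ 84) (hj : l ^ e ∣ (U j).order x) : j ∈ E := by
    refine (hmE j).2 (le_antisymm (hm j) ?_)
    rw [← (hmE i).1 hi]
    exact (hle e he _ _).trans ((hl.pow_dvd_iff_le_factorization
      (ne_zero_of_dvd_ne_zero (by norm_num) (hdvd _ _))).1 hj)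
  have hmem' {j : Fin k} {e : ℕ} (he : ¬ l ^ (e + 1) ∣ 84) (hj : l ^ e ∣ (U (π j)).order x') :
      j ∈ E := by
    refine (hmE' j).2 (le_antisymm (hm' j) ?_)
    rw [← (hmE' i).1 hi]
    exact (hle e he _ _).trans ((hl.pow_dvd_iff_le_factorization
      (ne_zero_of_dvd_ne_zero (by norm_num) (hdvd _ _))).1 hj)
  have hnot {j : Fin k} (hj : j ∈ E) : l ∣ (U j).order x ∧ l ∣ (U (π j)).order x' :=
    ⟨Nat.dvd_of_factorization_pos (by rw [(hmE j).1 hj]; exact hm0.ne'),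
      Nat.dvd_of_factorization_pos (by rw [(hmE' j).1 hj]; exact hm0'.ne')⟩
  obtain rfl | rfl | rfl := hl'
  · have := (hnot (hmem (j := i₁) (e := 2) (by norm_num) (by norm_num [h₁]))).2
    norm_num [hπ, h₂] at this
  · obtain ⟨j, hj, hj'⟩ := h3 i x (hnot hi).1
    exact hj' x' (hnot (hmem (e := 1) (by norm_num) (by simpa using hj))).2
  · have := (hnot (hmem' (j := i₁) (e := 1) (by norm_num) (by norm_num [hπ, h₂]))).1
    norm_num [h₁] at this

theorem hasBeauvilleStructure_of_orders (hna : ∃ x y : H, x * y ≠ y * x)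
    (hexp : ∀ x : H, x ^ 84 = 1) {c₁ c₂ c₃ c₄ c₅ : GenClass H} (h₁ : c₁.order = ![4, 4, 4])
    (h₂ : c₂.order = ![7, 7, 7]) (h₃ : c₃.order = ![3, 3, 7]) (h₄ : c₄.order = ![4, 4, 7])
    (h₅ : c₅.order = ![3, 7, 3]) {k : ℕ} (hk2 : 2 ≤ k) (hk : k ≤ Nat.card (GenClass H)) :
    HasBeauvilleStructure (Fin k → H) := by
  have hL : [c₁, c₂, c₃, c₄, c₅].Nodup := by
    refine List.Nodup.of_map GenClass.order ?_
    simp only [List.map_cons, List.map_nil, h₁, h₂, h₃, h₄, h₅]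
    decide
  obtain ⟨U, hU, hUL⟩ := exists_injective_extending hL hk
  have o₁ (x : Fin 3) : c₁.order x = 4 := by rw [h₁]; fin_cases x <;> rfl
  have o₂ (x : Fin 3) : c₂.order x = 7 := by rw [h₂]; fin_cases x <;> rfl
  have o₄ (x : Fin 3) : ¬ 3 ∣ c₄.order x := by rw [h₄]; revert x; decide
  have u₁ : U ⟨0, by omega⟩ = c₁ := hUL _ (by simp)
  have u₂ : U ⟨1, by omega⟩ = c₂ := hUL _ (by simp)
  have key (π : Equiv.Perm (Fin k)) (hπ : π ⟨0, by omega⟩ = ⟨1, by omega⟩) (h3) :=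
    hasBeauvilleStructure_of_perm hna hexp hU π (by simpa only [u₁] using o₁)
      (by simpa only [u₂] using o₂) hπ h3
  have hsmall (i : Fin k) (x : Fin 3) (hi : 3 ∣ (U i).order x) (h5 : k < 5) : i.1 = 2 := by
    obtain ⟨i, hik⟩ := i
    have hi' : i < 4 := by omega
    have := hUL ⟨i, hik⟩ (by simp; omega)
    interval_cases i
    · rw [this] at hi; norm_num [o₁] at hi
    · rw [this] at hi; norm_num [o₂] at hi
    · rfl
    · rw [this] at hi; exact absurd hi (o₄ x)
  obtain h | h | h : k = 2 ∨ (2 < k ∧ k < 5) ∨ 5 ≤ k := by omega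
  · refine key (Equiv.swap ⟨0, by omega⟩ ⟨1, by omega⟩) (Equiv.swap_apply_left _ _) fun i x hi ↦ ?_
    have := hsmall i x hi (by omega)
    omega
  · set π : Equiv.Perm (Fin k) := Equiv.swap ⟨1, by omega⟩ ⟨2, by omega⟩ *
      Equiv.swap ⟨0, by omega⟩ ⟨2, by omega⟩ with hπ
    have h2 : π ⟨2, by omega⟩ = ⟨0, by omega⟩ := by simp [hπ, Equiv.swap_apply_def]
    refine key π (by simp [hπ, Equiv.swap_apply_def]) fun i x hi ↦ ⟨i, hi, fun x' ↦ ?_⟩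
    have hi2 : i = ⟨2, by omega⟩ := Fin.ext (hsmall i x hi h.2)
    rw [hi2, h2, u₁, o₁]
    norm_num
  · set π : Equiv.Perm (Fin k) := Equiv.swap ⟨1, by omega⟩ ⟨2, by omega⟩ *
      Equiv.swap ⟨0, by omega⟩ ⟨2, by omega⟩ * Equiv.swap ⟨3, by omega⟩ ⟨4, by omega⟩ with hπ
    have h2 : π ⟨2, by omega⟩ = ⟨0, by omega⟩ := by simp [hπ, Equiv.swap_apply_def]
    have h4 : π ⟨4, by omega⟩ = ⟨3, by omega⟩ := by simp [hπ, Equiv.swap_apply_def]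
    have u₃ : U ⟨2, by omega⟩ = c₃ := hUL _ (by simp)
    have u₄ : U ⟨3, by omega⟩ = c₄ := hUL _ (by simp)
    have u₅ : U ⟨4, by omega⟩ = c₅ := hUL _ (by simp)
    refine key π (by simp [hπ, Equiv.swap_apply_def]) fun _ x _ ↦ ?_
    have hx : 3 ∣ c₃.order x ∨ 3 ∣ c₅.order x := by
      rw [h₃, h₅]
      fin_cases x <;> simp
    refine hx.elim (fun hx ↦ ⟨⟨2, by omega⟩, by rwa [u₃], fun x' ↦ ?_⟩)
      (fun hx ↦ ⟨⟨4, by omega⟩, by rwa [u₅], fun x' ↦ ?_⟩)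
    · rw [h2, u₁, o₁]
      norm_num
    · rw [h4, u₄]
      exact o₄ x'

theorem exists_surjective_ringHom_of_card_eq_two {F : Type*} [Field F] [Fintype F]
    (h2 : Fintype.card F = 2) : ∃ f : ZMod 2 →+* F, Function.Surjective f := by
  have : CharP F 2 := charP_of_card_eq_prime (p := 2) h2
  refine ⟨ZMod.castHom dvd_rfl F, ((Fintype.bijective_iff_injective_and_card _).2
    ⟨RingHom.injective _, ?_⟩).surjective⟩
  rw [h2, ZMod.card]

theorem SL3.pow_eq_one_of_zmod_two (M : SL(3, ZMod 2)) : M ^ 84 = 1 := by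
  apply Subtype.ext
  rw [Matrix.SpecialLinearGroup.coe_pow, Matrix.SpecialLinearGroup.coe_one]
  obtain ⟨M, hM⟩ := M
  change M ^ 84 = 1
  have hdeg := M.charpoly_natDegree_eq_dim
  have h0 := M.det_eq_sign_charpoly_coeff
  have h3 := M.charpoly_monic.coeff_natDegree
  have hp := M.aeval_self_charpoly
  rw [hM, Fintype.card_fin] at h0
  rw [Fintype.card_fin] at hdeg
  rw [hdeg] at h3
  rw [Polynomial.aeval_eq_sum_range, hdeg] at hp
  have h2 : (2 : Matrix (Fin 3) (Fin 3) (ZMod 2)) = 0 := CharTwo.two_eq_zero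
  have h0' : M.charpoly.coeff 0 = 1 := by
    revert h0
    generalize M.charpoly.coeff 0 = c
    revert c
    decide
  simp only [Finset.sum_range_succ, Finset.sum_range_zero, h3, h0', zero_add, one_smul,
    pow_zero, pow_one] at hp
  generalize M.charpoly.coeff 1 = b at hp
  generalize M.charpoly.coeff 2 = a at hp
  have hab (c : ZMod 2) : c = 0 ∨ c = 1 := by revert c; decide
  obtain rfl | rfl := hab a <;> obtain rfl | rfl := hab b <;>
    simp only [zero_smul, one_smul, add_zero] at hp
  · have : M ^ 3 = 1 := by
      rw [← sub_eq_zero, show M ^ 3 - 1 = (1 + M ^ 3) - 2 * 1 by noncomm_ring, hp, h2,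
        zero_mul, sub_zero]
    rw [show 84 = 3 * 28 by norm_num, pow_mul, this, one_pow]
  · have : M ^ 7 = 1 := by
      rw [← sub_eq_zero, show M ^ 7 - 1 = (1 + M + M ^ 3) * (M ^ 4 + M ^ 2 + M + 1) -
        2 * (M ^ 5 + M ^ 4 + M ^ 3 + M ^ 2 + M + 1) by noncomm_ring, hp, h2, zero_mul, zero_mul,
        sub_zero]
    rw [show 84 = 7 * 12 by norm_num, pow_mul, this, one_pow]
  · have : M ^ 7 = 1 := by
      rw [← sub_eq_zero, show M ^ 7 - 1 = (1 + M ^ 2 + M ^ 3) * (M ^ 4 + M ^ 3 + M ^ 2 + 1) -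
        2 * (M ^ 6 + M ^ 5 + M ^ 4 + M ^ 3 + M ^ 2 + 1) by noncomm_ring, hp, h2, zero_mul, zero_mul,
        sub_zero]
    rw [show 84 = 7 * 12 by norm_num, pow_mul, this, one_pow]
  · have : M ^ 4 = 1 := by
      rw [← sub_eq_zero, show M ^ 4 - 1 = (1 + M + M ^ 2 + M ^ 3) * (M + 1) -
        2 * (M ^ 3 + M ^ 2 + M + 1) by noncomm_ring, hp, h2, zero_mul, zero_mul, sub_zero]
    rw [show 84 = 4 * 21 by norm_num, pow_mul, this, one_pow]

theorem SL3.tv_mem_of_one {K : Subgroup SL(3, ZMod 2)} (h : SL3.tv 1 0 1 ∈ K) (r : ZMod 2) :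
    SL3.tv 1 0 r ∈ K := by
  fin_cases r
  · exact (congr_arg (· ∈ K) (show SL3.tv 1 0 _ = 1 by decide +kernel)).mpr K.one_mem
  · exact h

theorem exists_genClass {F : Type*} [Field F] {f : ZMod 2 →+* F} (hf : Function.Surjective f)
    {γ β : ZMod 2} {y : SL(3, ZMod 2)} {w : List (Fin 4)}
    (hw : pairWord (SL3.companion γ β) y w = SL3.tv 1 0 1) {n₁ n₂ n₃ : ℕ}
    (h₁ : orderOf (PSL3.baseMap f (SL3.companion γ β)) = n₁) (h₂ : orderOf (PSL3.baseMap f y) = n₂)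
    (h₃ : orderOf (PSL3.baseMap f (SL3.companion γ β * y)) = n₃) :
    ∃ c : GenClass PSL(3, F), c.order = ![n₁, n₂, n₃] := by
  refine ⟨GenClass.mk (PSL3.isGenTriple_baseMap hf
    (SL3.tv_mem_of_one (mem_closure_of_pairWord w hw))), funext fun x ↦ ?_⟩
  rw [GenClass.order_mk]
  fin_cases x
  · exact h₁
  · exact h₂
  · refine (orderOf_inv _).trans ?_
    rw [← map_mul]
    exact h₃

theorem hasBeauvilleStructure_of_card_eq_two {F : Type*} [Field F] [Fintype F]
    (h2 : Fintype.card F = 2) {k : ℕ} (hk2 : 2 ≤ k)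
    (hk : k * Nat.card (MulAut PSL(3, F)) ≤ phi2 PSL(3, F)) :
    HasBeauvilleStructure (Fin k → PSL(3, F)) := by
  obtain ⟨f, hf⟩ := exists_surjective_ringHom_of_card_eq_two h2
  have := PSL3.isSimpleGroup (F := F)
  have hexp (g : PSL(3, F)) : g ^ 84 = 1 := by
    obtain ⟨M, rfl⟩ := PSL3.baseMap_surjective hf g
    rw [← map_pow, SL3.pow_eq_one_of_zmod_two, map_one]
  obtain ⟨c₁, h₁⟩ := exists_genClass hf (γ := 1) (β := 1)
    (y := ⟨!![1, 0, 0; 1, 1, 1; 1, 0, 1], by decide⟩) (w := [2, 2]) (by decide +kernel)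
    (PSL3.orderOf_baseMap (p := 2) (n := 1) (i := 0) (j := 1) (by norm_num) (by decide)
      (by decide +kernel) (by decide +kernel))
    (PSL3.orderOf_baseMap (p := 2) (n := 1) (i := 1) (j := 0) (by norm_num) (by decide)
      (by decide +kernel) (by decide +kernel))
    (PSL3.orderOf_baseMap (p := 2) (n := 1) (i := 0) (j := 1) (by norm_num) (by decide)
      (by decide +kernel) (by decide +kernel))
  obtain ⟨c₂, h₂⟩ := exists_genClass hf (γ := 0) (β := 1)
    (y := ⟨!![0, 1, 0; 1, 1, 1; 0, 1, 1], by decide⟩) (w := [1, 2, 0, 2]) (by decide +kernel)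
    (PSL3.orderOf_baseMap (p := 7) (n := 0) (i := 0) (j := 2) (by norm_num) (by decide)
      (by decide +kernel) (by decide +kernel))
    (PSL3.orderOf_baseMap (p := 7) (n := 0) (i := 0) (j := 1) (by norm_num) (by decide)
      (by decide +kernel) (by decide +kernel))
    (PSL3.orderOf_baseMap (p := 7) (n := 0) (i := 0) (j := 1) (by norm_num) (by decide)
      (by decide +kernel) (by decide +kernel))
  obtain ⟨c₃, h₃⟩ := exists_genClass hf (γ := 0) (β := 0)
    (y := ⟨!![0, 0, 1; 1, 1, 1; 0, 1, 1], by decide⟩) (w := [0, 3, 0, 3]) (by decide +kernel)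
    (PSL3.orderOf_baseMap (p := 3) (n := 0) (i := 0) (j := 2) (by norm_num) (by decide)
      (by decide +kernel) (by decide +kernel))
    (PSL3.orderOf_baseMap (p := 3) (n := 0) (i := 0) (j := 2) (by norm_num) (by decide)
      (by decide +kernel) (by decide +kernel))
    (PSL3.orderOf_baseMap (p := 7) (n := 0) (i := 0) (j := 1) (by norm_num) (by decide)
      (by decide +kernel) (by decide +kernel))
  obtain ⟨c₄, h₄⟩ := exists_genClass hf (γ := 1) (β := 1)
    (y := ⟨!![1, 0, 0; 0, 1, 1; 1, 0, 1], by decide⟩) (w := [2, 2]) (by decide +kernel)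
    (PSL3.orderOf_baseMap (p := 2) (n := 1) (i := 0) (j := 1) (by norm_num) (by decide)
      (by decide +kernel) (by decide +kernel))
    (PSL3.orderOf_baseMap (p := 2) (n := 1) (i := 1) (j := 0) (by norm_num) (by decide)
      (by decide +kernel) (by decide +kernel))
    (PSL3.orderOf_baseMap (p := 7) (n := 0) (i := 0) (j := 2) (by norm_num) (by decide)
      (by decide +kernel) (by decide +kernel))
  obtain ⟨c₅, h₅⟩ := exists_genClass hf (γ := 0) (β := 0)
    (y := ⟨!![0, 0, 1; 1, 1, 0; 0, 1, 1], by decide⟩) (w := [0, 3, 0, 3]) (by decide +kernel)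
    (PSL3.orderOf_baseMap (p := 3) (n := 0) (i := 0) (j := 2) (by norm_num) (by decide)
      (by decide +kernel) (by decide +kernel))
    (PSL3.orderOf_baseMap (p := 7) (n := 0) (i := 0) (j := 2) (by norm_num) (by decide)
      (by decide +kernel) (by decide +kernel))
    (PSL3.orderOf_baseMap (p := 3) (n := 0) (i := 0) (j := 1) (by norm_num) (by decide)
      (by decide +kernel) (by decide +kernel))
  exact hasBeauvilleStructure_of_orders PSL3.exists_mul_ne_mul
    hexp h₁ h₂ h₃ h₄ h₅ hk2 (le_card_genClass hk)

end FieldTwo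

/-- For `H = PSL₃(F_q)`, `q ≥ 2` a prime power, `Hᵏ` admits an unmixed Beauville structure
for every `k` with `2 ≤ k` and `k·|Aut H| ≤ φ₂(H)`. -/
theorem beauville_psl3_powers (F : Type*) [Field F] [Fintype F] (hq : 2 ≤ Fintype.card F)
    (k : ℕ) (hk2 : 2 ≤ k) (hk : k * Nat.card (MulAut PSL(3, F)) ≤ phi2 PSL(3, F)) :
    HasBeauvilleStructure (Fin k → PSL(3, F)) := by
  rcases eq_or_ne (Fintype.card F) 2 with h2 | h2
  · exact hasBeauvilleStructure_of_card_eq_two h2 hk2 hk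
  · rcases eq_or_ne (Fintype.card F) 4 with h4 | h4
    · exact hasBeauvilleStructure_of_card_eq_four h4 hk2 hk
    · exact hasBeauvilleStructure_of_card_ne h2 h4 hk2 hk
end

section
/- Let H be a non-abelian finite simple group, k ≥ 1, and let a = (a_j), b = (b_j), c = (c_j) be elements of Hᵏ with a·b·c = 1. Then {a, b, c} generates Hᵏ if and only if, for each j ∈ {1,…,k}, the component triple (a_j, b_j, c_j) is a generating triple of H, and for all j ≠ j′ the triples (a_j, b_j, c_j) and (a_{j′}, b_{j′}, c_{j′}) are inequivalent under Aut(H). -/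
open scoped MatrixGroups

/-- The values at `j` of the elements of `K` that are trivial at every coordinate in `S`. -/
def Subgroup.evalTrivialOn {ι H : Type*} [Group H] (K : Subgroup (ι → H)) (S : Set ι) (j : ι) :
    Subgroup H :=
  (K ⊓ Subgroup.pi S fun _ => ⊥).map (Pi.evalMonoidHom (fun _ => H) j)

theorem Subgroup.mem_evalTrivialOn {ι H : Type*} [Group H] {K : Subgroup (ι → H)} {S : Set ι}
    {j : ι} {x : H} : x ∈ K.evalTrivialOn S j ↔ ∃ g ∈ K, (∀ i ∈ S, g i = 1) ∧ g j = x := by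
  simp [Subgroup.evalTrivialOn, Subgroup.mem_map, Subgroup.mem_pi, and_assoc]

theorem Subgroup.normal_evalTrivialOn {ι H : Type*} [Group H] {K : Subgroup (ι → H)}
    (S : Set ι) {j : ι} (hK : ∀ x : H, ∃ g ∈ K, g j = x) : (K.evalTrivialOn S j).Normal where
  conj_mem x hx y := by
    obtain ⟨g, hg, hgS, rfl⟩ := Subgroup.mem_evalTrivialOn.1 hx
    obtain ⟨u, hu, rfl⟩ := hK y
    exact Subgroup.mem_evalTrivialOn.2 ⟨u * g * u⁻¹, K.mul_mem (K.mul_mem hu hg) (K.inv_mem hu),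
      fun i hi => by simp [hgS i hi], rfl⟩

/-- If triviality at `i` forces triviality at `j` in a subgroup of a power of a finite group with
surjective coordinates, then the `j`-th coordinate is an automorphic image of the `i`-th. -/
theorem Subgroup.exists_mulAut_of_evalTrivialOn_eq_bot {ι H : Type*} [Group H] [Finite H]
    {K : Subgroup (ι → H)} {i j : ι} (hi : ∀ x : H, ∃ g ∈ K, g i = x)
    (hj : ∀ x : H, ∃ g ∈ K, g j = x) (h : K.evalTrivialOn {i} j = ⊥) :
    ∃ α : MulAut H, ∀ g ∈ K, α (g i) = g j := by
  let p (l : ι) : K →* H := (Pi.evalMonoidHom (fun _ => H) l).comp K.subtype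
  have hpi : Function.Surjective (p i) := fun x => by
    obtain ⟨g, hg, rfl⟩ := hi x
    exact ⟨⟨g, hg⟩, rfl⟩
  have hker : (p i).ker ≤ (p j).ker := fun g hg => by
    have : (g : ι → H) j ∈ K.evalTrivialOn {i} j :=
      Subgroup.mem_evalTrivialOn.2 ⟨g, g.2, fun l hl => (Set.mem_singleton_iff.1 hl) ▸ hg, rfl⟩
    rwa [h, Subgroup.mem_bot] at this
  let φ : H →* H := (p i).liftOfSurjective hpi ⟨p j, hker⟩
  have hφ : ∀ g ∈ K, φ (g i) = g j := fun g hg =>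
    (p i).liftOfRightInverse_comp_apply _ (Function.rightInverse_surjInv hpi) ⟨p j, hker⟩ ⟨g, hg⟩
  have hsurj : Function.Surjective φ := fun x => by
    obtain ⟨g, hg, rfl⟩ := hj x
    exact ⟨g i, hφ g hg⟩
  exact ⟨MulEquiv.ofBijective φ ⟨Finite.injective_iff_surjective.2 hsurj, hsurj⟩, hφ⟩

/-- A subgroup of a finite power of a non-abelian simple group which surjects onto every
coordinate and in which no coordinate determines another one is the whole power. -/
theorem Subgroup.eq_top_of_evalTrivialOn_eq_top {ι H : Type*} [Finite ι] [Group H]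
    [IsSimpleGroup H] (hna : ¬ ∀ x y : H, x * y = y * x) {K : Subgroup (ι → H)}
    (hK : ∀ j, ∀ x : H, ∃ g ∈ K, g j = x)
    (h : ∀ i j, i ≠ j → K.evalTrivialOn {i} j = ⊤) : K = ⊤ := by
  classical
  have := Fintype.ofFinite ι
  have key : ∀ (j : ι) (S : Finset ι), j ∉ S → K.evalTrivialOn S j = ⊤ := by
    intro j S
    induction S using Finset.induction_on with
    | empty =>
      intro _
      refine (Subgroup.eq_top_iff' _).2 fun x => Subgroup.mem_evalTrivialOn.2 ?_
      simpa using hK j x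
    | insert i S _ ih =>
      intro hj
      rw [Finset.mem_insert, not_or] at hj
      refine (Subgroup.normal_evalTrivialOn _ (hK j)).eq_bot_or_eq_top.resolve_left fun hbot => ?_
      refine hna fun x y => ?_
      obtain ⟨g, hg, hgS, rfl⟩ := Subgroup.mem_evalTrivialOn.1
        ((ih hj.2).symm ▸ Subgroup.mem_top x)
      obtain ⟨u, hu, hui, rfl⟩ := Subgroup.mem_evalTrivialOn.1
        ((h i j (Ne.symm hj.1)).symm ▸ Subgroup.mem_top y)
      have hmem : g j * u j * (g j)⁻¹ * (u j)⁻¹ ∈ K.evalTrivialOn ↑(insert i S) j := by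
        refine Subgroup.mem_evalTrivialOn.2 ⟨g * u * g⁻¹ * u⁻¹, ?_, fun l hl => ?_, rfl⟩
        · exact K.mul_mem (K.mul_mem (K.mul_mem hg hu) (K.inv_mem hg)) (K.inv_mem hu)
        · rcases Finset.mem_insert.1 hl with rfl | hl
          · simp [hui l rfl]
          · simp [hgS l hl]
      rw [hbot, Subgroup.mem_bot] at hmem
      rwa [mul_inv_eq_one, mul_inv_eq_iff_eq_mul] at hmem
  refine (Subgroup.eq_top_iff' K).2 fun f => Subgroup.pi_mem_of_mulSingle_mem f fun j => ?_
  obtain ⟨g, hg, hgS, hgj⟩ := Subgroup.mem_evalTrivialOn.1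
    ((key j (Finset.univ.erase j) (by simp)).symm ▸ Subgroup.mem_top (f j))
  convert hg
  ext l
  by_cases hl : l = j
  · subst hl
    simp [hgj]
  · rw [Pi.mulSingle_eq_of_ne hl, hgS l (by simp [hl])]

theorem map_eval_closure_triple {ι H : Type*} [Group H] (a b c : ι → H) (j : ι) :
    (Subgroup.closure {a, b, c}).map (Pi.evalMonoidHom (fun _ => H) j) =
      Subgroup.closure {a j, b j, c j} := by
  simp [MonoidHom.map_closure, Set.image_insert_eq]

/-- Corollary 3.3: for a non-abelian finite simple group `H` and `a, b, c ∈ Hᵏ` with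
`a·b·c = 1`, the set `{a,b,c}` generates `Hᵏ` iff each component triple is a generating
triple of `H` and distinct component triples are inequivalent under `Aut H`. -/
theorem generating_triple_power_iff (H : Type*) [Group H] [Finite H] [IsSimpleGroup H]
    (hna : ¬ ∀ x y : H, x * y = y * x) (k : ℕ) (hk : 1 ≤ k)
    (a b c : Fin k → H) (habc : a * b * c = 1) :
    Subgroup.closure ({a, b, c} : Set (Fin k → H)) = ⊤ ↔
      ((∀ j, IsGenTriple (a j, b j, c j)) ∧
        ∀ j j', j ≠ j' → ¬ TripleEquiv (a j, b j, c j) (a j', b j', c j')) := by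
  constructor
  · intro htop
    refine ⟨fun j => ⟨congrFun habc j, ?_⟩, ?_⟩
    · change Subgroup.closure {a j, b j, c j} = ⊤
      rw [← map_eval_closure_triple, htop]
      exact Subgroup.map_top_of_surjective _ (Function.surjective_eval j)
    · rintro j j' hne ⟨α, ha, hb, hc⟩
      let e (l : Fin k) := Pi.evalMonoidHom (fun _ : Fin k => H) l
      have heq : α.toMonoidHom.comp (e j) = e j' := by
        refine MonoidHom.eq_of_eqOn_dense htop ?_
        rintro x (rfl | rfl | rfl)
        exacts [ha, hb, hc]
      obtain ⟨x, hx⟩ := exists_ne (1 : H)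
      refine hx ?_
      simpa [e, Pi.mulSingle_eq_of_ne hne] using
        (DFunLike.congr_fun heq (Pi.mulSingle j' x)).symm
  · rintro ⟨hgen, hineq⟩
    have hsurj : ∀ j, ∀ x : H, ∃ g ∈ Subgroup.closure {a, b, c}, g j = x := fun j x => by
      have hx : x ∈ (Subgroup.closure {a, b, c}).map (Pi.evalMonoidHom (fun _ => H) j) := by
        rw [map_eval_closure_triple, (hgen j).2]
        exact Subgroup.mem_top x
      exact hx
    refine Subgroup.eq_top_of_evalTrivialOn_eq_top hna hsurj fun i j hij => ?_
    refine (Subgroup.normal_evalTrivialOn _ (hsurj j)).eq_bot_or_eq_top.resolve_left fun hbot => ?_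
    obtain ⟨α, hα⟩ := Subgroup.exists_mulAut_of_evalTrivialOn_eq_bot (hsurj i) (hsurj j) hbot
    exact hineq i j hij ⟨α, hα a (Subgroup.subset_closure (by simp)),
      hα b (Subgroup.subset_closure (by simp)), hα c (Subgroup.subset_closure (by simp))⟩
end
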